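/- arXiv:2305.17365 — 2 statements merged into one kernel-verified Lean document; each statement's English description precedes it below -/
import Mathlib

section
/- There exists an absolute constant C > 0 such that the following holds. Let d ≥ 3, let v_1, …, v_d be distinct unit vectors in ℝ^d, b_1, …, b_d ∈ ℝ, and A = {x ∈ ℝ^d : x·v_j ≤ b_j for j = 1,…,d}. Then for every d×d real matrix M, |∫_A ⟨M, ∇²φ_d(z)⟩ dz| ≤ C (log d) max_{j ≠ k : v_k ≠ −v_j} ( |v_jᵀ M v_j| + |v_jᵀ M v_{jk}| + |v_{jk}ᵀ M v_{jk}| ). -/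
open MeasureTheory Matrix Real

/-- the standard Gaussian density on `ℝ^d` -/
noncomputable def gaussPDF (d : ℕ) (z : Fin d → ℝ) : ℝ :=
  (2 * π) ^ (-(d : ℝ) / 2) * Real.exp (-(∑ i, z i ^ 2) / 2)

/-- the second partial derivative `∂_a ∂_c φ_d(z)` -/
noncomputable def gaussPDF2 (d : ℕ) (a c : Fin d) (z : Fin d → ℝ) : ℝ :=
  fderiv ℝ (fun w => fderiv ℝ (gaussPDF d) w (Pi.single c 1)) z (Pi.single a 1)

/-- For unit vectors `v ≠ ±w`, the unique unit vector in `span{v, w}` orthogonal to `v`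
and with positive inner product with `w`. -/
noncomputable def perpUnit {d : ℕ} (v w : Fin d → ℝ) : Fin d → ℝ :=
  (Real.sqrt (∑ i, (w i - (v ⬝ᵥ w) * v i) ^ 2))⁻¹ • fun i => w i - (v ⬝ᵥ w) * v i


/-! ### Functions of at most exponential growth and Gaussian integration by parts -/

/-- continuous functions with at most exponential growth -/
def Tame {d : ℕ} (F : (Fin d → ℝ) → ℝ) : Prop :=
  Continuous F ∧ ∃ C c : ℝ, 0 ≤ C ∧ 0 ≤ c ∧ ∀ x, |F x| ≤ C * Real.exp (c * ∑ i, |x i|)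

lemma Tame.of_bdd {d : ℕ} {F : (Fin d → ℝ) → ℝ} (h : Continuous F) (C : ℝ)
    (hC : ∀ x, |F x| ≤ C) : Tame F := by
  refine ⟨h, C, 0, (abs_nonneg _).trans (hC 0), le_rfl, fun x => ?_⟩
  simpa using hC x

lemma Tame.const {d : ℕ} (c : ℝ) : Tame (fun _ : Fin d → ℝ => c) :=
  Tame.of_bdd continuous_const |c| (fun _ => le_rfl)

lemma Tame.mul {d : ℕ} {F G : (Fin d → ℝ) → ℝ} (hF : Tame F) (hG : Tame G) :
    Tame (fun x => F x * G x) := by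
  obtain ⟨h1, C1, c1, hC1, hc1, hb1⟩ := hF
  obtain ⟨h2, C2, c2, hC2, hc2, hb2⟩ := hG
  refine ⟨h1.mul h2, C1 * C2, c1 + c2, by positivity, by positivity, fun x => ?_⟩
  rw [abs_mul, add_mul, Real.exp_add]
  calc |F x| * |G x| ≤ (C1 * Real.exp (c1 * ∑ i, |x i|)) * (C2 * Real.exp (c2 * ∑ i, |x i|)) :=
        mul_le_mul (hb1 x) (hb2 x) (abs_nonneg _) (by positivity)
    _ = _ := by ring

lemma Tame.add {d : ℕ} {F G : (Fin d → ℝ) → ℝ} (hF : Tame F) (hG : Tame G) :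
    Tame (fun x => F x + G x) := by
  obtain ⟨h1, C1, c1, hC1, hc1, hb1⟩ := hF
  obtain ⟨h2, C2, c2, hC2, hc2, hb2⟩ := hG
  refine ⟨h1.add h2, C1 + C2, c1 + c2, by positivity, by positivity, fun x => ?_⟩
  have hs : 0 ≤ ∑ i, |x i| := Finset.sum_nonneg fun i _ => abs_nonneg _
  have e1 : Real.exp (c1 * ∑ i, |x i|) ≤ Real.exp ((c1 + c2) * ∑ i, |x i|) := by
    apply Real.exp_le_exp.2; nlinarith
  have e2 : Real.exp (c2 * ∑ i, |x i|) ≤ Real.exp ((c1 + c2) * ∑ i, |x i|) := by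
    apply Real.exp_le_exp.2; nlinarith
  calc |F x + G x| ≤ |F x| + |G x| := abs_add_le _ _
    _ ≤ C1 * Real.exp (c1 * ∑ i, |x i|) + C2 * Real.exp (c2 * ∑ i, |x i|) :=
        add_le_add (hb1 x) (hb2 x)
    _ ≤ C1 * Real.exp ((c1 + c2) * ∑ i, |x i|) + C2 * Real.exp ((c1 + c2) * ∑ i, |x i|) := by
        gcongr
    _ = _ := by ring

lemma Tame.neg {d : ℕ} {F : (Fin d → ℝ) → ℝ} (hF : Tame F) : Tame (fun x => - F x) := by
  simpa using (Tame.const (-1)).mul hF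

lemma Tame.sub {d : ℕ} {F G : (Fin d → ℝ) → ℝ} (hF : Tame F) (hG : Tame G) :
    Tame (fun x => F x - G x) := by
  simpa [sub_eq_add_neg] using hF.add hG.neg

lemma Tame.sum {d : ℕ} {ι : Type*} (s : Finset ι) {F : ι → (Fin d → ℝ) → ℝ}
    (hF : ∀ i, Tame (F i)) : Tame (fun x => ∑ i ∈ s, F i x) := by
  classical
  induction s using Finset.induction_on with
  | empty => simpa using Tame.const 0
  | insert a s ha ih =>
    simp only [Finset.sum_insert ha]
    exact (hF a).add ih

lemma abs_dot_le {d : ℕ} (x w : Fin d → ℝ) : |x ⬝ᵥ w| ≤ (∑ i, |w i|) * ∑ i, |x i| := by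
  unfold dotProduct
  refine (Finset.abs_sum_le_sum_abs _ _).trans ?_
  rw [Finset.mul_sum]
  refine Finset.sum_le_sum fun i _ => ?_
  rw [abs_mul, mul_comm]
  exact mul_le_mul_of_nonneg_right
    (Finset.single_le_sum (f := fun i => |w i|) (fun i _ => abs_nonneg _) (Finset.mem_univ i))
    (abs_nonneg _)

lemma cont_dot {d : ℕ} (w : Fin d → ℝ) : Continuous (fun x : Fin d → ℝ => x ⬝ᵥ w) := by
  unfold dotProduct; fun_prop

lemma Tame.exp_dot {d : ℕ} (w : Fin d → ℝ) :
    Tame (fun x : Fin d → ℝ => Real.exp (x ⬝ᵥ w)) := by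
  refine ⟨Real.continuous_exp.comp (cont_dot w), 1, ∑ i, |w i|, zero_le_one,
    Finset.sum_nonneg fun i _ => abs_nonneg _, fun x => ?_⟩
  rw [abs_of_pos (Real.exp_pos _), one_mul]
  exact Real.exp_le_exp.2 ((le_abs_self _).trans (abs_dot_le x w))

lemma Tame.dot {d : ℕ} (w : Fin d → ℝ) : Tame (fun x : Fin d → ℝ => x ⬝ᵥ w) := by
  refine ⟨cont_dot w, 1, ∑ i, |w i|, zero_le_one,
    Finset.sum_nonneg fun i _ => abs_nonneg _, fun x => ?_⟩
  rw [one_mul]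
  have := Real.add_one_le_exp ((∑ i, |w i|) * ∑ i, |x i|)
  linarith [abs_dot_le x w]

lemma Tame.coord {d : ℕ} (a : Fin d) : Tame (fun x : Fin d → ℝ => x a) := by
  have := Tame.dot (Pi.single a (1:ℝ))
  simpa using this

lemma gaussPDF_nonneg {d : ℕ} (x : Fin d → ℝ) : 0 ≤ gaussPDF d x := by
  unfold gaussPDF; positivity

lemma gaussPDF_cont (d : ℕ) : Continuous (gaussPDF d) := by
  unfold gaussPDF; fun_prop

lemma integrable_quarter (d : ℕ) :
    Integrable (fun x : Fin d → ℝ => Real.exp (-(∑ i, x i ^ 2) / 4)) := by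
  have h : (fun x : Fin d → ℝ => Real.exp (-(∑ i, x i ^ 2) / 4))
      = fun x => ∏ i, Real.exp (-(1/4) * x i ^ 2) := by
    funext x
    rw [← Real.exp_sum, ← Finset.mul_sum]
    congr 1; ring
  rw [h]
  exact Integrable.fintype_prod (fun i => integrable_exp_neg_mul_sq (by norm_num))

lemma Tame.integrable {d : ℕ} {F : (Fin d → ℝ) → ℝ} (hF : Tame F) :
    Integrable (fun x => F x * gaussPDF d x) := by
  obtain ⟨h1, C, c, hC, hc, hb⟩ := hF
  refine Integrable.mono'
    ((integrable_quarter d).const_mul (C * (2 * π) ^ (-(d : ℝ) / 2) * Real.exp (d * c ^ 2)))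
    (h1.mul (gaussPDF_cont d)).aestronglyMeasurable (ae_of_all _ fun x => ?_)
  rw [Real.norm_eq_abs, abs_mul, abs_of_nonneg (gaussPDF_nonneg x)]
  have key : Real.exp (c * ∑ i, |x i|) * Real.exp (-(∑ i, x i ^ 2) / 2)
      ≤ Real.exp (d * c ^ 2) * Real.exp (-(∑ i, x i ^ 2) / 4) := by
    rw [← Real.exp_add, ← Real.exp_add]
    apply Real.exp_le_exp.2
    have : ∑ i, (c * |x i|) ≤ ∑ i : Fin d, (c ^ 2 + x i ^ 2 / 4) := by
      refine Finset.sum_le_sum fun i _ => ?_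
      nlinarith [sq_nonneg (c - |x i| / 2), sq_abs (x i)]
    rw [← Finset.mul_sum, Finset.sum_add_distrib, ← Finset.sum_div] at this
    simp at this
    linarith
  calc |F x| * gaussPDF d x ≤ (C * Real.exp (c * ∑ i, |x i|)) * gaussPDF d x :=
        mul_le_mul_of_nonneg_right (hb x) (gaussPDF_nonneg x)
    _ = C * (2 * π) ^ (-(d : ℝ) / 2) *
        (Real.exp (c * ∑ i, |x i|) * Real.exp (-(∑ i, x i ^ 2) / 2)) := by
        unfold gaussPDF; ring
    _ ≤ C * (2 * π) ^ (-(d : ℝ) / 2) *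
        (Real.exp (d * c ^ 2) * Real.exp (-(∑ i, x i ^ 2) / 4)) := by gcongr
    _ = _ := by ring

lemma integral_gaussPDF (d : ℕ) : ∫ x, gaussPDF d x = 1 := by
  have h : gaussPDF d = fun x => ∏ i, ((2 * π) ^ (-(1 : ℝ) / 2) * Real.exp (-(1/2) * x i ^ 2)) := by
    funext x
    rw [Finset.prod_mul_distrib, ← Real.exp_sum, ← Finset.mul_sum, gaussPDF, Finset.prod_const,
      Finset.card_univ, Fintype.card_fin, ← Real.rpow_natCast, ← Real.rpow_mul (by positivity)]
    congr 2 <;> ring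
  rw [h, integral_fintype_prod_volume_eq_pow
    (fun t : ℝ => (2 * π) ^ (-(1 : ℝ) / 2) * Real.exp (-(1/2) * t ^ 2)),
    integral_const_mul, integral_gaussian, Real.sqrt_eq_rpow]
  have : (π / (1/2)) = 2 * π := by ring
  rw [this, ← Real.rpow_add (by positivity)]
  norm_num

/-- expectation under the standard Gaussian -/
noncomputable def EE {d : ℕ} (F : (Fin d → ℝ) → ℝ) : ℝ := ∫ x, F x * gaussPDF d x

lemma EE_exp {d : ℕ} (w : Fin d → ℝ) :
    EE (fun x => Real.exp (x ⬝ᵥ w)) = Real.exp (w ⬝ᵥ w / 2) := by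
  have h : ∀ x : Fin d → ℝ, Real.exp (x ⬝ᵥ w) * gaussPDF d x
      = Real.exp (w ⬝ᵥ w / 2) * gaussPDF d (x - w) := by
    intro x
    unfold gaussPDF
    rw [mul_left_comm, mul_left_comm (Real.exp (w ⬝ᵥ w / 2)), ← Real.exp_add, ← Real.exp_add]
    congr 2
    have : ∑ i, (x - w) i ^ 2 = ∑ i, x i ^ 2 - 2 * (x ⬝ᵥ w) + w ⬝ᵥ w := by
      unfold dotProduct
      rw [Finset.mul_sum, ← Finset.sum_sub_distrib, ← Finset.sum_add_distrib]
      refine Finset.sum_congr rfl fun i _ => ?_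
      simp; ring
    rw [this]; ring
  unfold EE
  simp_rw [h]
  rw [integral_const_mul, integral_sub_right_eq_self (gaussPDF d) w, integral_gaussPDF, mul_one]

lemma EE_add {d : ℕ} {F G : (Fin d → ℝ) → ℝ} (hF : Tame F) (hG : Tame G) :
    EE (fun x => F x + G x) = EE F + EE G := by
  unfold EE
  rw [← integral_add hF.integrable hG.integrable]
  simp_rw [add_mul]

lemma EE_sub {d : ℕ} {F G : (Fin d → ℝ) → ℝ} (hF : Tame F) (hG : Tame G) :
    EE (fun x => F x - G x) = EE F - EE G := by
  unfold EE
  rw [← integral_sub hF.integrable hG.integrable]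
  simp_rw [sub_mul]

lemma EE_sum {d : ℕ} {ι : Type*} (s : Finset ι) {F : ι → (Fin d → ℝ) → ℝ}
    (hF : ∀ i, Tame (F i)) : EE (fun x => ∑ i ∈ s, F i x) = ∑ i ∈ s, EE (F i) := by
  unfold EE
  rw [← integral_finsetSum s (fun i _ => (hF i).integrable)]
  simp_rw [Finset.sum_mul]

lemma EE_const_mul {d : ℕ} (c : ℝ) (F : (Fin d → ℝ) → ℝ) :
    EE (fun x => c * F x) = c * EE F := by
  unfold EE
  rw [← integral_const_mul]
  simp_rw [mul_assoc]

lemma EE_const {d : ℕ} (c : ℝ) : EE (fun _ : Fin d → ℝ => c) = c := by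
  unfold EE
  rw [integral_const_mul, integral_gaussPDF, mul_one]

lemma EE_mono {d : ℕ} {F G : (Fin d → ℝ) → ℝ} (hF : Tame F) (hG : Tame G)
    (h : ∀ x, F x ≤ G x) : EE F ≤ EE G :=
  integral_mono hF.integrable hG.integrable
    (fun x => mul_le_mul_of_nonneg_right (h x) (gaussPDF_nonneg x))

/-- The second function is the derivative of `F` in direction `w`, everywhere -/
def LD {d : ℕ} (F F' : (Fin d → ℝ) → ℝ) (w : Fin d → ℝ) : Prop :=
  ∀ x, HasDerivAt (fun t : ℝ => F (x + t • w)) (F' x) 0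

lemma LD.const {d : ℕ} (c : ℝ) (w : Fin d → ℝ) : LD (fun _ => c) (fun _ => 0) w :=
  fun _ => hasDerivAt_const _ _

lemma LD.mul {d : ℕ} {F F' G G' : (Fin d → ℝ) → ℝ} {w : Fin d → ℝ} (hF : LD F F' w)
    (hG : LD G G' w) : LD (fun x => F x * G x) (fun x => F' x * G x + F x * G' x) w := by
  intro x
  have h := (hF x).fun_mul (hG x)
  simp only [zero_smul, add_zero] at h
  exact h

lemma LD.add {d : ℕ} {F F' G G' : (Fin d → ℝ) → ℝ} {w : Fin d → ℝ} (hF : LD F F' w)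
    (hG : LD G G' w) : LD (fun x => F x + G x) (fun x => F' x + G' x) w := by
  intro x
  exact (hF x).add (hG x)

lemma LD.const_mul {d : ℕ} {F F' : (Fin d → ℝ) → ℝ} {w : Fin d → ℝ} (c : ℝ) (hF : LD F F' w) :
    LD (fun x => c * F x) (fun x => c * F' x) w := by
  intro x
  exact (hF x).const_mul c

lemma LD.sum {d : ℕ} {ι : Type*} (s : Finset ι) {F F' : ι → (Fin d → ℝ) → ℝ} {w : Fin d → ℝ}
    (hF : ∀ i, LD (F i) (F' i) w) : LD (fun x => ∑ i ∈ s, F i x) (fun x => ∑ i ∈ s, F' i x) w := by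
  intro x
  exact HasDerivAt.fun_sum fun i _ => hF i x

lemma LD.exp {d : ℕ} {F F' : (Fin d → ℝ) → ℝ} {w : Fin d → ℝ} (hF : LD F F' w) :
    LD (fun x => Real.exp (F x)) (fun x => Real.exp (F x) * F' x) w := by
  intro x
  simpa using (hF x).exp

lemma LD.inv {d : ℕ} {F F' : (Fin d → ℝ) → ℝ} {w : Fin d → ℝ} (hF : LD F F' w)
    (h0 : ∀ x, F x ≠ 0) : LD (fun x => (F x)⁻¹) (fun x => -F' x / F x ^ 2) w := by
  intro x
  have h := (hF x).fun_inv (by simpa using h0 x)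
  simp only [zero_smul, add_zero] at h
  exact h

lemma LD.dot {d : ℕ} (u w : Fin d → ℝ) : LD (fun x => x ⬝ᵥ u) (fun _ => w ⬝ᵥ u) w := by
  intro x
  have : (fun t : ℝ => (x + t • w) ⬝ᵥ u) = fun t => x ⬝ᵥ u + t * (w ⬝ᵥ u) := by
    funext t; rw [add_dotProduct, smul_dotProduct, smul_eq_mul]
  rw [this]
  simpa using ((hasDerivAt_id (0:ℝ)).mul_const (w ⬝ᵥ u)).const_add (x ⬝ᵥ u)

lemma LD.coord {d : ℕ} (a : Fin d) (w : Fin d → ℝ) : LD (fun x => x a) (fun _ => w a) w := by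
  have := LD.dot (Pi.single a (1:ℝ)) w
  simpa using this

lemma LD.congr {d : ℕ} {F F' G' : (Fin d → ℝ) → ℝ} {w : Fin d → ℝ} (hF : LD F F' w)
    (h : ∀ x, F' x = G' x) : LD F G' w := by
  intro x; rw [← h x]; exact hF x

lemma LD.gauss {d : ℕ} (w : Fin d → ℝ) :
    LD (gaussPDF d) (fun x => -(x ⬝ᵥ w) * gaussPDF d x) w := by
  have h : gaussPDF d = fun x => (2 * π) ^ (-(d : ℝ) / 2) * Real.exp ((-1/2) * (x ⬝ᵥ x)) := by
    funext x; unfold gaussPDF dotProduct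
    congr 2; simp_rw [pow_two]; ring
  have hq : LD (fun x : Fin d → ℝ => x ⬝ᵥ x) (fun x => 2 * (x ⬝ᵥ w)) w := by
    have := LD.sum Finset.univ (fun i : Fin d =>
      (LD.dot (Pi.single i (1:ℝ)) w).mul (LD.dot (Pi.single i (1:ℝ)) w))
    simp only [dotProduct_single, mul_one] at this
    refine LD.congr (F := fun x => x ⬝ᵥ x) this fun x => ?_
    change ∑ i, (w i * x i + x i * w i) = 2 * (x ⬝ᵥ w)
    simp only [dotProduct, Finset.mul_sum]
    exact Finset.sum_congr rfl fun i _ => by ring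
  rw [h]
  refine ((hq.const_mul (-1/2)).exp.const_mul _).congr fun x => ?_
  ring

/-- Gaussian integration by parts -/
lemma gauss_ibp {d : ℕ} {F F' : (Fin d → ℝ) → ℝ} {w : Fin d → ℝ} (hF : Tame F) (hF' : Tame F')
    (h : LD F F' w) : EE F' = EE (fun x => (x ⬝ᵥ w) * F x) := by
  have hi := (hF.mul (Tame.dot w)).neg.integrable
  have := integral_bilinear_hasLineDerivAt_right_eq_neg_left_of_integrable
    (μ := (volume : Measure (Fin d → ℝ))) (f := F) (f' := F') (g := gaussPDF d)
    (g' := fun x => -(x ⬝ᵥ w) * gaussPDF d x) (v := w) (B := ContinuousLinearMap.mul ℝ ℝ)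
    (by simpa using hF'.integrable)
    (by
      refine hi.congr (ae_of_all _ fun x => ?_)
      simp; ring)
    (by simpa using hF.integrable)
    (fun x _ => h x) (fun x _ => LD.gauss w x)
  simp only [ContinuousLinearMap.mul_apply'] at this
  unfold EE
  rw [eq_comm, neg_eq_iff_eq_neg] at this
  rw [this, ← integral_neg]
  refine integral_congr_ae (ae_of_all _ fun x => ?_)
  simp only; ring


/-! ### Softmax weights -/

noncomputable def ez {d : ℕ} (v : Fin d → Fin d → ℝ) (b : Fin d → ℝ) (τ : ℝ) (j : Fin d)
    (x : Fin d → ℝ) : ℝ := Real.exp (τ * (x ⬝ᵥ v j - b j))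

noncomputable def P0 {d : ℕ} (v : Fin d → Fin d → ℝ) (b : Fin d → ℝ) (τ : ℝ)
    (x : Fin d → ℝ) : ℝ := (1 + ∑ j, ez v b τ j x)⁻¹

noncomputable def PP {d : ℕ} (v : Fin d → Fin d → ℝ) (b : Fin d → ℝ) (τ : ℝ) (j : Fin d)
    (x : Fin d → ℝ) : ℝ := ez v b τ j x * P0 v b τ x

section softmax

variable {d : ℕ} (v : Fin d → Fin d → ℝ) (b : Fin d → ℝ) (τ : ℝ)

lemma ez_pos (j : Fin d) (x : Fin d → ℝ) : 0 < ez v b τ j x := Real.exp_pos _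

lemma ZZ_pos (x : Fin d → ℝ) : 0 < 1 + ∑ j, ez v b τ j x := by
  have : 0 ≤ ∑ j, ez v b τ j x := Finset.sum_nonneg fun j _ => (ez_pos v b τ j x).le
  linarith

lemma P0_pos (x : Fin d → ℝ) : 0 < P0 v b τ x := inv_pos.2 (ZZ_pos v b τ x)

lemma PP_pos (j : Fin d) (x : Fin d → ℝ) : 0 < PP v b τ j x :=
  mul_pos (ez_pos v b τ j x) (P0_pos v b τ x)

lemma P_sum (x : Fin d → ℝ) : P0 v b τ x + ∑ j, PP v b τ j x = 1 := by
  have := (ZZ_pos v b τ x).ne'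
  unfold PP
  rw [← Finset.sum_mul]
  unfold P0
  field_simp

lemma PP_sum_le (x : Fin d → ℝ) : ∑ j, PP v b τ j x ≤ 1 := by
  linarith [P_sum v b τ x, P0_pos v b τ x]

lemma P0_le (x : Fin d → ℝ) : P0 v b τ x ≤ 1 := by
  have : 0 ≤ ∑ j, PP v b τ j x := Finset.sum_nonneg fun j _ => (PP_pos v b τ j x).le
  linarith [P_sum v b τ x]

lemma PP_le (j : Fin d) (x : Fin d → ℝ) : PP v b τ j x ≤ 1 :=
  (Finset.single_le_sum (f := fun j => PP v b τ j x) (fun j _ => (PP_pos v b τ j x).le)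
    (Finset.mem_univ j)).trans (PP_sum_le v b τ x)

lemma ez_cont (j : Fin d) : Continuous (ez v b τ j) := by
  have := cont_dot (v j)
  unfold ez; fun_prop

lemma P0_cont : Continuous (P0 v b τ) := by
  have h := ez_cont v b τ
  unfold P0
  exact Continuous.inv₀ (by fun_prop) (fun x => (ZZ_pos v b τ x).ne')

lemma P0_tame : Tame (P0 v b τ) :=
  Tame.of_bdd (P0_cont v b τ) 1 fun x => by
    rw [abs_of_pos (P0_pos v b τ x)]; exact P0_le v b τ x

lemma PP_tame (j : Fin d) : Tame (PP v b τ j) :=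
  Tame.of_bdd ((ez_cont v b τ j).mul (P0_cont v b τ)) 1 fun x => by
    rw [abs_of_pos (PP_pos v b τ j x)]; exact PP_le v b τ j x

lemma ez_LD (j : Fin d) (w : Fin d → ℝ) :
    LD (ez v b τ j) (fun x => τ * (w ⬝ᵥ v j) * ez v b τ j x) w := by
  refine ((((LD.dot (v j) w).add (LD.const (-b j) w)).const_mul τ).exp).congr fun x => ?_
  simp only [ez, sub_eq_add_neg]; ring

lemma P0_LD (w : Fin d → ℝ) :
    LD (P0 v b τ) (fun x => -τ * P0 v b τ x * ∑ k, PP v b τ k x * (w ⬝ᵥ v k)) w := by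
  refine (((LD.const 1 w).add (LD.sum Finset.univ (fun j => ez_LD v b τ j w))).inv
    (fun x => (ZZ_pos v b τ x).ne')).congr fun x => ?_
  have hz := (ZZ_pos v b τ x).ne'
  have h1 : ∑ k, PP v b τ k x * (w ⬝ᵥ v k)
      = P0 v b τ x * ∑ k, (w ⬝ᵥ v k) * ez v b τ k x := by
    rw [Finset.mul_sum]; exact Finset.sum_congr rfl fun k _ => by unfold PP; ring
  have h2 : ∑ k, τ * (w ⬝ᵥ v k) * ez v b τ k x = τ * ∑ k, (w ⬝ᵥ v k) * ez v b τ k x := by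
    rw [Finset.mul_sum]; exact Finset.sum_congr rfl fun k _ => by ring
  rw [h1, h2]
  unfold P0
  field_simp
  ring

lemma PP_LD (j : Fin d) (w : Fin d → ℝ) :
    LD (PP v b τ j)
      (fun x => τ * PP v b τ j x * ((w ⬝ᵥ v j) - ∑ k, PP v b τ k x * (w ⬝ᵥ v k))) w := by
  refine ((ez_LD v b τ j w).mul (P0_LD v b τ w)).congr fun x => ?_
  simp only [PP]; ring

end softmax

lemma sum_rot {d : ℕ} (f : Fin d → Fin d → Fin d → ℝ) :
    ∑ j, ∑ k, ∑ l, f k l j = ∑ j, ∑ k, ∑ l, f j k l := by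
  rw [Finset.sum_comm]
  exact Finset.sum_congr rfl fun j _ => Finset.sum_comm

lemma triple_nonneg {d : ℕ} (c : Fin d → Fin d → ℝ) (hs : ∀ j k, c j k = c k j)
    (ht : ∀ j k l, 0 ≤ 3 - (c j k ^ 2 + c j l ^ 2 + c k l ^ 2) - 2 * (c j k + c j l + c k l)
      + 2 * (c j k * c j l + c j k * c k l + c j l * c k l))
    (p : Fin d → ℝ) (hp : ∀ j, 0 ≤ p j) :
    0 ≤ ∑ j, ∑ k, ∑ l, p j * p k * p l * (1 - c j k ^ 2 - 2 * (1 - c j k) * c j l) := by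
  set f : Fin d → Fin d → Fin d → ℝ := fun j k l =>
    p j * p k * p l * (1 - c j k ^ 2 - 2 * (1 - c j k) * c j l) with hf
  have h1 := sum_rot f
  have h2 := sum_rot (fun j k l => f k l j)
  have h3 : 0 ≤ ∑ j, ∑ k, ∑ l, (f j k l + f k l j + f l j k) := by
    refine Finset.sum_nonneg fun j _ => Finset.sum_nonneg fun k _ => Finset.sum_nonneg fun l _ => ?_
    have e : f j k l + f k l j + f l j k = (p j * p k * p l) *
        (3 - (c j k ^ 2 + c j l ^ 2 + c k l ^ 2) - 2 * (c j k + c j l + c k l)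
      + 2 * (c j k * c j l + c j k * c k l + c j l * c k l)) := by
      simp only [hf]
      rw [hs k j, hs l j, hs l k]; ring
    rw [e]
    exact mul_nonneg (mul_nonneg (mul_nonneg (hp j) (hp k)) (hp l)) (ht j k l)
  simp only [Finset.sum_add_distrib] at h3
  change 0 ≤ ∑ j, ∑ k, ∑ l, f j k l
  linarith

lemma gram_tri {d : ℕ} (v : Fin d → Fin d → ℝ) (hv : ∀ j, v j ⬝ᵥ v j = 1) (j k l : Fin d) :
    0 ≤ 3 - ((v j ⬝ᵥ v k) ^ 2 + (v j ⬝ᵥ v l) ^ 2 + (v k ⬝ᵥ v l) ^ 2)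
      - 2 * (v j ⬝ᵥ v k + v j ⬝ᵥ v l + v k ⬝ᵥ v l)
      + 2 * ((v j ⬝ᵥ v k) * (v j ⬝ᵥ v l) + (v j ⬝ᵥ v k) * (v k ⬝ᵥ v l)
        + (v j ⬝ᵥ v l) * (v k ⬝ᵥ v l)) := by
  have h := Finset.sum_mul_sq_le_sq_mul_sq Finset.univ (v j - v k) (v j - v l)
  have h1 : ∑ i, (v j - v k) i * (v j - v l) i = (v j - v k) ⬝ᵥ (v j - v l) := rfl
  have h2 : ∑ i, (v j - v k) i ^ 2 = (v j - v k) ⬝ᵥ (v j - v k) := by simp [dotProduct, pow_two]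
  have h3 : ∑ i, (v j - v l) i ^ 2 = (v j - v l) ⬝ᵥ (v j - v l) := by simp [dotProduct, pow_two]
  rw [h1, h2, h3] at h
  simp only [sub_dotProduct, dotProduct_sub, hv] at h
  rw [dotProduct_comm (v k) (v j), dotProduct_comm (v l) (v j)] at h
  nlinarith

lemma dot_le_one {d : ℕ} {u w : Fin d → ℝ} (hu : u ⬝ᵥ u = 1) (hw : w ⬝ᵥ w = 1) :
    |u ⬝ᵥ w| ≤ 1 := by
  have h := Finset.sum_mul_sq_le_sq_mul_sq Finset.univ u w
  have h1 : ∑ i, u i * w i = u ⬝ᵥ w := rfl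
  have h2 : ∑ i, u i ^ 2 = u ⬝ᵥ u := by simp [dotProduct, pow_two]
  have h3 : ∑ i, w i ^ 2 = w ⬝ᵥ w := by simp [dotProduct, pow_two]
  rw [h1, h2, h3, hu, hw] at h
  exact abs_le_one_iff_mul_self_le_one.2 (by nlinarith)

/-- pointwise lower bound for the second symmetric function -/
lemma sigma2_ptwise {d : ℕ} (v : Fin d → Fin d → ℝ) (hv : ∀ j, v j ⬝ᵥ v j = 1) (p0 : ℝ)
    (p : Fin d → ℝ) (hp : ∀ j, 0 ≤ p j) (hsum : p0 + ∑ j, p j = 1) :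
    p0 * ∑ j, ∑ k, p j * p k * (1 - (v j ⬝ᵥ v k) ^ 2) ≤
      ∑ j, ∑ k, (1 - v j ⬝ᵥ v k) *
        (p j * p k * (1 + v j ⬝ᵥ v k - 2 * ∑ l, p l * (v j ⬝ᵥ v l))) := by
  have h := triple_nonneg (fun j k => v j ⬝ᵥ v k) (fun j k => dotProduct_comm _ _)
    (gram_tri v hv) p hp
  have e : ∑ j, ∑ k, ∑ l, p j * p k * p l *
        (1 - (v j ⬝ᵥ v k) ^ 2 - 2 * (1 - v j ⬝ᵥ v k) * (v j ⬝ᵥ v l))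
      = (∑ l, p l) * ∑ j, ∑ k, p j * p k * (1 - (v j ⬝ᵥ v k) ^ 2)
        - ∑ j, ∑ k, (1 - v j ⬝ᵥ v k) * (p j * p k * (2 * ∑ l, p l * (v j ⬝ᵥ v l))) := by
    rw [Finset.mul_sum, ← Finset.sum_sub_distrib]
    refine Finset.sum_congr rfl fun j _ => ?_
    rw [Finset.mul_sum, ← Finset.sum_sub_distrib]
    refine Finset.sum_congr rfl fun k _ => ?_
    simp only [Finset.mul_sum, Finset.sum_mul]
    rw [← Finset.sum_sub_distrib]
    refine Finset.sum_congr rfl fun l _ => ?_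
    ring
  have e2 : ∑ j, ∑ k, (1 - v j ⬝ᵥ v k) *
        (p j * p k * (1 + v j ⬝ᵥ v k - 2 * ∑ l, p l * (v j ⬝ᵥ v l)))
      = ∑ j, ∑ k, p j * p k * (1 - (v j ⬝ᵥ v k) ^ 2)
        - ∑ j, ∑ k, (1 - v j ⬝ᵥ v k) * (p j * p k * (2 * ∑ l, p l * (v j ⬝ᵥ v l))) := by
    rw [← Finset.sum_sub_distrib]
    refine Finset.sum_congr rfl fun j _ => ?_
    rw [← Finset.sum_sub_distrib]
    refine Finset.sum_congr rfl fun k _ => ?_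
    ring
  rw [e] at h
  have hp : ∑ l, p l = 1 - p0 := by linarith
  rw [hp] at h
  rw [e2]
  nlinarith


/-! ### The three integral estimates -/

section estimates

variable {d : ℕ} (v : Fin d → Fin d → ℝ) (b : Fin d → ℝ) (τ : ℝ)

lemma estA (hv : ∀ j, v j ⬝ᵥ v j = 1) (Ψ : (Fin d → ℝ) → ℝ)
    (Ψ' : Fin d → (Fin d → ℝ) → ℝ) (hΨ : Tame Ψ) (hΨ' : ∀ j, Tame (Ψ' j))
    (hLD : ∀ j, LD Ψ (Ψ' j) (v j)) (hge : ∀ j x, |x ⬝ᵥ v j| ≤ Ψ x)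
    (hder : ∀ j x, |Ψ' j x| ≤ Ψ x ^ 2 / 2) :
    EE (fun x => τ * (Ψ x * (P0 v b τ x * ∑ j, PP v b τ j x
      + ∑ j, ∑ k, (1 - v j ⬝ᵥ v k) * (PP v b τ j x * PP v b τ k x))))
      ≤ 3 / 2 * EE (fun x => Ψ x ^ 2) := by
  have tP := PP_tame v b τ
  have tP0 := P0_tame v b τ
  have tmu : ∀ j, Tame (fun x => τ * PP v b τ j x *
      ((v j ⬝ᵥ v j) - ∑ k, PP v b τ k x * (v j ⬝ᵥ v k))) := fun j =>
    ((Tame.const τ).mul (tP j)).mul ((Tame.const _).sub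
      (Tame.sum _ fun k => (tP k).mul (Tame.const _)))
  have ibp : ∀ j, _ := fun j => gauss_ibp (hΨ.mul (tP j))
    (((hΨ' j).mul (tP j)).add (hΨ.mul (tmu j))) ((hLD j).mul (PP_LD v b τ j (v j)))
  have t1 : ∀ j, Tame (fun x => Ψ' j x * PP v b τ j x) := fun j => (hΨ' j).mul (tP j)
  have t2 : ∀ j, Tame (fun x => (x ⬝ᵥ v j) * (Ψ x * PP v b τ j x)) := fun j =>
    (Tame.dot (v j)).mul (hΨ.mul (tP j))
  have t3 : ∀ j, Tame (fun x => Ψ x * (τ * PP v b τ j x *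
      ((v j ⬝ᵥ v j) - ∑ k, PP v b τ k x * (v j ⬝ᵥ v k)))) := fun j => hΨ.mul (tmu j)
  have e1 : EE (fun x => τ * (Ψ x * (P0 v b τ x * ∑ j, PP v b τ j x
      + ∑ j, ∑ k, (1 - v j ⬝ᵥ v k) * (PP v b τ j x * PP v b τ k x))))
      = EE (fun x => ∑ j, (Ψ x * (τ * PP v b τ j x *
      ((v j ⬝ᵥ v j) - ∑ k, PP v b τ k x * (v j ⬝ᵥ v k))))) := by
    congr 1; funext x
    have hs := P_sum v b τ x
    rw [Finset.mul_sum, ← Finset.sum_add_distrib, Finset.mul_sum, Finset.mul_sum]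
    refine Finset.sum_congr rfl fun j _ => ?_
    have : ∑ k, (1 - v j ⬝ᵥ v k) * (PP v b τ j x * PP v b τ k x)
        = PP v b τ j x * (∑ k, PP v b τ k x - ∑ k, PP v b τ k x * (v j ⬝ᵥ v k)) := by
      rw [← Finset.sum_sub_distrib, Finset.mul_sum]
      exact Finset.sum_congr rfl fun k _ => by ring
    rw [this, hv, ← hs]; ring
  have e2 : EE (fun x => ∑ j, (Ψ x * (τ * PP v b τ j x *
      ((v j ⬝ᵥ v j) - ∑ k, PP v b τ k x * (v j ⬝ᵥ v k)))))
      = EE (fun x => ∑ j, ((x ⬝ᵥ v j) * (Ψ x * PP v b τ j x) - Ψ' j x * PP v b τ j x)) := by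
    rw [EE_sum _ t3, EE_sum _ (fun j => (t2 j).sub (t1 j))]
    refine Finset.sum_congr rfl fun j _ => ?_
    have h := ibp j
    rw [EE_add (t1 j) (t3 j)] at h
    rw [EE_sub (t2 j) (t1 j)]
    linarith
  have tsq : Tame (fun x => Ψ x ^ 2) := by simpa [pow_two] using hΨ.mul hΨ
  rw [e1, e2, ← EE_const_mul]
  refine EE_mono (Tame.sum _ fun j => (t2 j).sub (t1 j)) ((Tame.const _).mul tsq) fun x => ?_
  have hpt : ∀ j, (x ⬝ᵥ v j) * (Ψ x * PP v b τ j x) - Ψ' j x * PP v b τ j x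
      ≤ (3 / 2 * Ψ x ^ 2) * PP v b τ j x := by
    intro j
    have h0 := (PP_pos v b τ j x).le
    have h1 := hge j x
    have h2 := hder j x
    have hΨ0 : 0 ≤ Ψ x := (abs_nonneg _).trans h1
    have h3 : (x ⬝ᵥ v j) * Ψ x ≤ Ψ x ^ 2 := by nlinarith [le_abs_self (x ⬝ᵥ v j)]
    have h4 : -Ψ' j x ≤ Ψ x ^ 2 / 2 := (neg_le_abs _).trans h2
    nlinarith
  refine (Finset.sum_le_sum fun j _ => hpt j).trans ?_
  rw [← Finset.mul_sum]
  have := PP_sum_le v b τ x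
  nlinarith [sq_nonneg (Ψ x)]

lemma estB (hτ : 0 ≤ τ) (hv : ∀ j, v j ⬝ᵥ v j = 1) (Ψ : (Fin d → ℝ) → ℝ) (hΨ : Tame Ψ)
    (hge : ∀ j x, |x ⬝ᵥ v j| ≤ Ψ x) :
    EE (fun x => τ ^ 2 * (P0 v b τ x *
      ∑ j, ∑ k, PP v b τ j x * PP v b τ k x * (1 - (v j ⬝ᵥ v k) ^ 2)))
      ≤ EE (fun x => τ * (Ψ x * (P0 v b τ x * ∑ j, PP v b τ j x
      + ∑ j, ∑ k, (1 - v j ⬝ᵥ v k) * (PP v b τ j x * PP v b τ k x)))) := by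
  have tP := PP_tame v b τ
  have tP0 := P0_tame v b τ
  set c : Fin d → Fin d → ℝ := fun j k => v j ⬝ᵥ v k with hc
  have tF : ∀ j k, Tame (fun x => τ * PP v b τ j x * PP v b τ k x *
      (1 + c j k - 2 * ∑ l, PP v b τ l x * c j l)) := fun j k =>
    (((Tame.const τ).mul (tP j)).mul (tP k)).mul ((Tame.const _).sub ((Tame.const 2).mul
      (Tame.sum _ fun k => (tP k).mul (Tame.const _))))
  have ibp : ∀ j k, EE (fun x => τ * PP v b τ j x * PP v b τ k x *
      (1 + c j k - 2 * ∑ l, PP v b τ l x * c j l))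
      = EE (fun x => (x ⬝ᵥ v j) * (PP v b τ j x * PP v b τ k x)) := fun j k =>
    gauss_ibp ((tP j).mul (tP k)) (tF j k)
      (((PP_LD v b τ j (v j)).mul (PP_LD v b τ k (v j))).congr fun x => by
        simp only [hc, hv]; ring)
  have t2 : ∀ j k, Tame (fun x => (x ⬝ᵥ v j) * (PP v b τ j x * PP v b τ k x)) := fun j k =>
    (Tame.dot (v j)).mul ((tP j).mul (tP k))
  have tF' : ∀ j k, Tame (fun x => τ * (1 - c j k) * (τ * PP v b τ j x * PP v b τ k x *
      (1 + c j k - 2 * ∑ l, PP v b τ l x * c j l))) := fun j k => (Tame.const _).mul (tF j k)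
  have t2' : ∀ j k, Tame (fun x => τ * (1 - c j k) *
      ((x ⬝ᵥ v j) * (PP v b τ j x * PP v b τ k x))) := fun j k => (Tame.const _).mul (t2 j k)
  have e : EE (fun x => ∑ j, ∑ k, τ * (1 - c j k) * (τ * PP v b τ j x * PP v b τ k x *
      (1 + c j k - 2 * ∑ l, PP v b τ l x * c j l)))
      = EE (fun x => ∑ j, ∑ k, τ * (1 - c j k) *
      ((x ⬝ᵥ v j) * (PP v b τ j x * PP v b τ k x))) := by
    rw [EE_sum _ fun j => Tame.sum _ fun k => tF' j k,
      EE_sum _ fun j => Tame.sum _ fun k => t2' j k]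
    refine Finset.sum_congr rfl fun j _ => ?_
    rw [EE_sum _ fun k => tF' j k, EE_sum _ fun k => t2' j k]
    refine Finset.sum_congr rfl fun k _ => ?_
    rw [EE_const_mul, EE_const_mul, ibp]
  have i1 : EE (fun x => τ ^ 2 * (P0 v b τ x *
      ∑ j, ∑ k, PP v b τ j x * PP v b τ k x * (1 - (v j ⬝ᵥ v k) ^ 2)))
      ≤ EE (fun x => ∑ j, ∑ k, τ * (1 - c j k) * (τ * PP v b τ j x * PP v b τ k x *
      (1 + c j k - 2 * ∑ l, PP v b τ l x * c j l))) := by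
    refine EE_mono ((Tame.const _).mul (tP0.mul (Tame.sum _ fun j => Tame.sum _ fun k =>
      ((tP j).mul (tP k)).mul (Tame.const _)))) (Tame.sum _ fun j => Tame.sum _ fun k => tF' j k)
      fun x => ?_
    have h := sigma2_ptwise v hv (P0 v b τ x) (fun j => PP v b τ j x)
      (fun j => (PP_pos v b τ j x).le) (P_sum v b τ x)
    refine (mul_le_mul_of_nonneg_left h (sq_nonneg τ)).trans (le_of_eq ?_)
    simp only [Finset.mul_sum (a := τ ^ 2)]
    refine Finset.sum_congr rfl fun j _ => Finset.sum_congr rfl fun k _ => ?_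
    simp only [hc]; ring
  rw [e] at i1
  refine i1.trans ?_
  refine EE_mono (Tame.sum _ fun j => Tame.sum _ fun k => t2' j k)
    ((Tame.const _).mul (hΨ.mul ((tP0.mul (Tame.sum _ tP)).add
      (Tame.sum _ fun j => Tame.sum _ fun k => (Tame.const _).mul ((tP j).mul (tP k))))))
    fun x => ?_
  have h1 : ∑ j, ∑ k, τ * (1 - c j k) * ((x ⬝ᵥ v j) * (PP v b τ j x * PP v b τ k x))
      ≤ ∑ j, ∑ k, τ * (Ψ x * ((1 - c j k) * (PP v b τ j x * PP v b τ k x))) := by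
    refine Finset.sum_le_sum fun j _ => Finset.sum_le_sum fun k _ => ?_
    have hc1 : 0 ≤ 1 - c j k := by
      have := (le_abs_self _).trans (dot_le_one (hv j) (hv k)); simp only [hc]; linarith
    have hq : 0 ≤ τ * ((1 - c j k) * (PP v b τ j x * PP v b τ k x)) :=
      mul_nonneg hτ (mul_nonneg hc1 (mul_nonneg (PP_pos v b τ j x).le (PP_pos v b τ k x).le))
    have := mul_le_mul_of_nonneg_right ((le_abs_self _).trans (hge j x)) hq
    linarith
  refine h1.trans ?_
  have h2 : 0 ≤ τ * (Ψ x * (P0 v b τ x * ∑ j, PP v b τ j x)) := by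
    rcases isEmpty_or_nonempty (Fin d) with h | ⟨⟨j⟩⟩
    · simp
    · have hΨ0 : 0 ≤ Ψ x := (abs_nonneg _).trans (hge j x)
      have : 0 ≤ ∑ j, PP v b τ j x := Finset.sum_nonneg fun j _ => (PP_pos v b τ j x).le
      have := (P0_pos v b τ x).le
      positivity
  simp only [← Finset.mul_sum]
  simp only [hc] at *
  linarith

/-- exact formula for the smoothed second-derivative integral -/
lemma estC_formula (M : Matrix (Fin d) (Fin d) ℝ) :
    EE (fun x => P0 v b τ x * ∑ a, ∑ c, M a c * (x a * x c - if a = c then 1 else 0))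
      = EE (fun x => τ ^ 2 * (P0 v b τ x *
        (2 * ∑ j, ∑ k, PP v b τ j x * PP v b τ k x * (v j ⬝ᵥ M.mulVec (v k))
          - ∑ j, PP v b τ j x * (v j ⬝ᵥ M.mulVec (v j))))) := by
  have tP := PP_tame v b τ
  have tP0 := P0_tame v b τ
  -- first integration by parts
  have tG : ∀ a : Fin d, Tame (fun x => -τ * P0 v b τ x * ∑ k, PP v b τ k x *
      ((Pi.single a (1:ℝ)) ⬝ᵥ v k)) := fun a =>
    ((Tame.const _).mul tP0).mul (Tame.sum _ fun k => (tP k).mul (Tame.const _))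
  have tI : ∀ a c : Fin d, Tame (fun x : Fin d → ℝ => P0 v b τ x * if a = c then (1:ℝ) else 0) :=
    fun a c => tP0.mul (Tame.const _)
  have s1 : ∀ a c : Fin d, EE (fun x => P0 v b τ x * (x a * x c - if a = c then 1 else 0))
      = EE (fun x => (-τ * P0 v b τ x * ∑ k, PP v b τ k x * v k a) * x c) := by
    intro a c
    have h := gauss_ibp (tP0.mul (Tame.coord c))
      (((tG a).mul (Tame.coord c)).add (tI a c))
      (((P0_LD v b τ (Pi.single a (1:ℝ))).mul (LD.coord c (Pi.single a (1:ℝ)))).congr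
        (G' := fun x => (-τ * P0 v b τ x * ∑ k, PP v b τ k x *
          ((Pi.single a (1:ℝ)) ⬝ᵥ v k)) * x c + P0 v b τ x * if a = c then (1:ℝ) else 0)
        fun x => by simp [Pi.single_apply, eq_comm])
    rw [EE_add ((tG a).mul (Tame.coord c)) (tI a c)] at h
    have h2 : EE (fun x => P0 v b τ x * (x a * x c - if a = c then 1 else 0))
        = EE (fun x => (x ⬝ᵥ Pi.single a (1:ℝ)) * (P0 v b τ x * x c))
          - EE (fun x : Fin d → ℝ => P0 v b τ x * if a = c then (1:ℝ) else 0) := by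
      rw [← EE_sub ((Tame.dot _).mul (tP0.mul (Tame.coord c))) (tI a c)]
      congr 1; funext x
      simp only [dotProduct_single, mul_one]; ring
    rw [h2, ← h]
    simp
  have tH : ∀ a c : Fin d, Tame (fun x => (-τ * P0 v b τ x * ∑ k, PP v b τ k x * v k a) * x c) :=
    fun a c => (((Tame.const _).mul tP0).mul (Tame.sum _ fun k => (tP k).mul (Tame.const _))).mul
      (Tame.coord c)
  have tQ : ∀ a c : Fin d, Tame (fun x => P0 v b τ x * (x a * x c - if a = c then 1 else 0)) :=
    fun a c => tP0.mul (((Tame.coord a).mul (Tame.coord c)).sub (Tame.const _))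
  have tQ' : ∀ a c : Fin d, Tame (fun x => M a c *
      (P0 v b τ x * (x a * x c - if a = c then 1 else 0))) :=
    fun a c => (Tame.const (M a c)).mul (tQ a c)
  have tH' : ∀ a c : Fin d, Tame (fun x => M a c *
      ((-τ * P0 v b τ x * ∑ k, PP v b τ k x * v k a) * x c)) :=
    fun a c => (Tame.const (M a c)).mul (tH a c)
  have tL : ∀ j, Tame (fun x => (x ⬝ᵥ (v j ᵥ* M)) * (P0 v b τ x * PP v b τ j x)) := fun j =>
    (Tame.dot _).mul (tP0.mul (tP j))
  have s2 : EE (fun x => P0 v b τ x * ∑ a, ∑ c, M a c * (x a * x c - if a = c then 1 else 0))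
      = EE (fun x => ∑ j, -τ * ((x ⬝ᵥ (v j ᵥ* M)) * (P0 v b τ x * PP v b τ j x))) := by
    have l : EE (fun x => P0 v b τ x * ∑ a, ∑ c, M a c * (x a * x c - if a = c then 1 else 0))
        = EE (fun x => ∑ a, ∑ c, M a c * (P0 v b τ x * (x a * x c - if a = c then 1 else 0))) := by
      congr 1; funext x
      rw [Finset.mul_sum]; refine Finset.sum_congr rfl fun a _ => ?_
      rw [Finset.mul_sum]; refine Finset.sum_congr rfl fun c _ => ?_
      ring
    have r : EE (fun x => ∑ j, -τ * ((x ⬝ᵥ (v j ᵥ* M)) * (P0 v b τ x * PP v b τ j x)))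
        = EE (fun x => ∑ a, ∑ c, M a c *
          ((-τ * P0 v b τ x * ∑ k, PP v b τ k x * v k a) * x c)) := by
      congr 1; funext x
      have hx : ∀ j, x ⬝ᵥ (v j ᵥ* M) = ∑ a, ∑ c, v j a * M a c * x c := by
        intro j
        simp only [dotProduct, vecMul, Finset.mul_sum]
        rw [Finset.sum_comm]
        exact Finset.sum_congr rfl fun a _ => Finset.sum_congr rfl fun c _ => by ring
      simp only [hx, Finset.mul_sum, Finset.sum_mul]
      rw [Finset.sum_comm]
      refine Finset.sum_congr rfl fun a _ => ?_
      rw [Finset.sum_comm]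
      exact Finset.sum_congr rfl fun c _ => Finset.sum_congr rfl fun j _ => by ring
    rw [l, r, EE_sum _ fun a => Tame.sum _ fun c => tQ' a c,
      EE_sum _ fun a => Tame.sum _ fun c => tH' a c]
    refine Finset.sum_congr rfl fun a _ => ?_
    rw [EE_sum _ fun c => tQ' a c,
      EE_sum _ fun c => tH' a c]
    refine Finset.sum_congr rfl fun c _ => ?_
    rw [EE_const_mul, EE_const_mul, s1]
  -- second integration by parts
  have tK : ∀ j, Tame (fun x => τ * (P0 v b τ x * PP v b τ j x *
      (v j ⬝ᵥ M.mulVec (v j) - 2 * ∑ k, PP v b τ k x * (v j ⬝ᵥ M.mulVec (v k))))) := fun j =>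
    (Tame.const _).mul ((tP0.mul (tP j)).mul ((Tame.const _).sub ((Tame.const _).mul
      (Tame.sum _ fun k => (tP k).mul (Tame.const _)))))
  have s3 : ∀ j, EE (fun x => (x ⬝ᵥ (v j ᵥ* M)) * (P0 v b τ x * PP v b τ j x))
      = EE (fun x => τ * (P0 v b τ x * PP v b τ j x *
      (v j ⬝ᵥ M.mulVec (v j) - 2 * ∑ k, PP v b τ k x * (v j ⬝ᵥ M.mulVec (v k))))) := by
    intro j
    refine (gauss_ibp (tP0.mul (tP j)) (tK j)
      (((P0_LD v b τ (v j ᵥ* M)).mul (PP_LD v b τ j (v j ᵥ* M))).congr fun x => ?_)).symm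
    simp only [dotProduct_mulVec]; ring
  rw [s2, EE_sum _ fun j => (Tame.const _).mul (tL j)]
  simp_rw [EE_const_mul (-τ), s3, ← EE_const_mul (-τ)]
  rw [← EE_sum _ fun j => (Tame.const _).mul (tK j)]
  congr 1; funext x
  rw [Finset.mul_sum, ← Finset.sum_sub_distrib, Finset.mul_sum, Finset.mul_sum]
  refine Finset.sum_congr rfl fun j _ => ?_
  have : ∑ k, PP v b τ j x * PP v b τ k x * (v j ⬝ᵥ M.mulVec (v k))
      = PP v b τ j x * ∑ k, PP v b τ k x * (v j ⬝ᵥ M.mulVec (v k)) := by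
    rw [Finset.mul_sum]; exact Finset.sum_congr rfl fun k _ => by ring
  rw [this]; ring

end estimates


lemma EE_abs_le {d : ℕ} {F G : (Fin d → ℝ) → ℝ} (hF : Tame F) (hG : Tame G)
    (h : ∀ x, |F x| ≤ G x) : |EE F| ≤ EE G := by
  rw [abs_le]
  constructor
  · have := EE_mono ((Tame.const (-1)).mul hG) hF (fun x => by linarith [(abs_le.1 (h x)).1])
    rw [EE_const_mul] at this
    linarith
  · exact EE_mono hF hG (fun x => (abs_le.1 (h x)).2)

lemma estC {d : ℕ} (v : Fin d → Fin d → ℝ) (b : Fin d → ℝ) (τ : ℝ)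
    (hτ : 0 ≤ τ) (hv : ∀ j, v j ⬝ᵥ v j = 1) (Ψ : (Fin d → ℝ) → ℝ)
    (Ψ' : Fin d → (Fin d → ℝ) → ℝ) (hΨ : Tame Ψ) (hΨ' : ∀ j, Tame (Ψ' j))
    (hLD : ∀ j, LD Ψ (Ψ' j) (v j)) (hge : ∀ j x, |x ⬝ᵥ v j| ≤ Ψ x)
    (hder : ∀ j x, |Ψ' j x| ≤ Ψ x ^ 2 / 2)
    (M : Matrix (Fin d) (Fin d) ℝ) (K : ℝ) (hK : 0 ≤ K)
    (hm : ∀ j, |v j ⬝ᵥ M.mulVec (v j)| ≤ K)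
    (hmm : ∀ j k, |v j ⬝ᵥ M.mulVec (v k) + v k ⬝ᵥ M.mulVec (v j)
      - (v j ⬝ᵥ v k) * (v j ⬝ᵥ M.mulVec (v j) + v k ⬝ᵥ M.mulVec (v k))|
      ≤ 4 * K * (1 - (v j ⬝ᵥ v k) ^ 2)) :
    |EE (fun x => P0 v b τ x * ∑ a, ∑ c, M a c * (x a * x c - if a = c then 1 else 0))|
      ≤ 15 / 2 * K * EE (fun x => Ψ x ^ 2) := by
  have tP := PP_tame v b τ
  have tP0 := P0_tame v b τ
  have hA := estA v b τ hv Ψ Ψ' hΨ hΨ' hLD hge hder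
  have hB := estB v b τ hτ hv Ψ hΨ hge
  set m : Fin d → Fin d → ℝ := fun j k => v j ⬝ᵥ M.mulVec (v k) with hmdef
  set c : Fin d → Fin d → ℝ := fun j k => v j ⬝ᵥ v k with hc
  have hcs : ∀ j k, c j k = c k j := fun j k => dotProduct_comm _ _
  set big := EE (fun x => τ * (Ψ x * (P0 v b τ x * ∑ j, PP v b τ j x
      + ∑ j, ∑ k, (1 - v j ⬝ᵥ v k) * (PP v b τ j x * PP v b τ k x)))) with hbig
  -- ibp
  have tD : ∀ j, Tame (fun x => τ * (P0 v b τ x * PP v b τ j x *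
      (1 - 2 * ∑ k, PP v b τ k x * c j k))) := fun j =>
    (Tame.const _).mul ((tP0.mul (tP j)).mul ((Tame.const _).sub ((Tame.const _).mul
      (Tame.sum _ fun k => (tP k).mul (Tame.const _)))))
  have tL : ∀ j, Tame (fun x => (x ⬝ᵥ v j) * (P0 v b τ x * PP v b τ j x)) := fun j =>
    (Tame.dot _).mul (tP0.mul (tP j))
  have ibp : ∀ j, EE (fun x => τ * (P0 v b τ x * PP v b τ j x *
      (1 - 2 * ∑ k, PP v b τ k x * c j k)))
      = EE (fun x => (x ⬝ᵥ v j) * (P0 v b τ x * PP v b τ j x)) := fun j =>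
    gauss_ibp (tP0.mul (tP j)) (tD j)
      (((P0_LD v b τ (v j)).mul (PP_LD v b τ j (v j))).congr fun x => by
        simp only [hc, hv]; ring)
  have tD' : ∀ j, Tame (fun x => (m j j * τ) * (τ * (P0 v b τ x * PP v b τ j x *
      (1 - 2 * ∑ k, PP v b τ k x * c j k)))) := fun j => (Tame.const _).mul (tD j)
  have tL' : ∀ j, Tame (fun x => (m j j * τ) * ((x ⬝ᵥ v j) * (P0 v b τ x * PP v b τ j x))) :=
    fun j => (Tame.const _).mul (tL j)
  have tR : Tame (fun x => τ ^ 2 * (P0 v b τ x * ∑ j, ∑ k, PP v b τ j x * PP v b τ k x *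
      (m j k + m k j - c j k * (m j j + m k k)))) :=
    (Tame.const _).mul (tP0.mul (Tame.sum _ fun j => Tame.sum _ fun k =>
      ((tP j).mul (tP k)).mul (Tame.const _)))
  have e : EE (fun x => P0 v b τ x * ∑ a, ∑ c, M a c * (x a * x c - if a = c then 1 else 0))
      = EE (fun x => τ ^ 2 * (P0 v b τ x * ∑ j, ∑ k, PP v b τ j x * PP v b τ k x *
      (m j k + m k j - c j k * (m j j + m k k))))
        - EE (fun x => ∑ j, (m j j * τ) * ((x ⬝ᵥ v j) * (P0 v b τ x * PP v b τ j x))) := by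
    have e1 : EE (fun x => ∑ j, (m j j * τ) * ((x ⬝ᵥ v j) * (P0 v b τ x * PP v b τ j x)))
        = EE (fun x => ∑ j, (m j j * τ) * (τ * (P0 v b τ x * PP v b τ j x *
      (1 - 2 * ∑ k, PP v b τ k x * c j k)))) := by
      rw [EE_sum _ tL', EE_sum _ tD']
      refine Finset.sum_congr rfl fun j _ => ?_
      rw [EE_const_mul, EE_const_mul, ibp]
    rw [estC_formula, e1, ← EE_sub tR (Tame.sum _ tD')]
    congr 1; funext x
    set p := fun j => PP v b τ j x with hp
    have q1 : ∑ j, ∑ k, p j * p k * (m j k + m k j - c j k * (m j j + m k k))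
        = 2 * ∑ j, ∑ k, p j * p k * (m j k) - 2 * ∑ j, ∑ k, p j * p k * (c j k * m j j) := by
      have r1 : ∑ j, ∑ k, p j * p k * m k j = ∑ j, ∑ k, p j * p k * m j k := by
        rw [Finset.sum_comm]
        exact Finset.sum_congr rfl fun j _ => Finset.sum_congr rfl fun k _ => by ring
      have r2 : ∑ j, ∑ k, p j * p k * (c j k * m k k) = ∑ j, ∑ k, p j * p k * (c j k * m j j) := by
        rw [Finset.sum_comm]
        exact Finset.sum_congr rfl fun j _ => Finset.sum_congr rfl fun k _ => by
          rw [hcs k j]; ring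
      have r3 : ∑ j, ∑ k, p j * p k * (m j k + m k j - c j k * (m j j + m k k))
          = ∑ j, ∑ k, p j * p k * m j k + ∑ j, ∑ k, p j * p k * m k j
            - (∑ j, ∑ k, p j * p k * (c j k * m j j) + ∑ j, ∑ k, p j * p k * (c j k * m k k)) := by
        simp only [← Finset.sum_add_distrib, ← Finset.sum_sub_distrib]
        exact Finset.sum_congr rfl fun j _ => Finset.sum_congr rfl fun k _ => by ring
      rw [r3, r1, r2]; ring
    have q2 : ∑ j, (m j j * τ) * (τ * (P0 v b τ x * p j * (1 - 2 * ∑ k, p k * c j k)))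
        = τ ^ 2 * (P0 v b τ x * (∑ j, p j * m j j - 2 * ∑ j, ∑ k, p j * p k * (c j k * m j j))) := by
      rw [Finset.mul_sum, ← Finset.sum_sub_distrib, Finset.mul_sum, Finset.mul_sum]
      refine Finset.sum_congr rfl fun j _ => ?_
      have : ∑ k, p j * p k * (c j k * m j j) = p j * m j j * ∑ k, p k * c j k := by
        rw [Finset.mul_sum]; exact Finset.sum_congr rfl fun k _ => by ring
      rw [this]; ring
    change τ ^ 2 * (P0 v b τ x * (2 * ∑ j, ∑ k, p j * p k * m j k - ∑ j, p j * m j j)) = 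
      τ ^ 2 * (P0 v b τ x * ∑ j, ∑ k, p j * p k * (m j k + m k j - c j k * (m j j + m k k)))
       - ∑ j, (m j j * τ) * (τ * (P0 v b τ x * p j * (1 - 2 * ∑ k, p k * c j k)))
    rw [q1, q2]; ring
  have b1 : |EE (fun x => τ ^ 2 * (P0 v b τ x * ∑ j, ∑ k, PP v b τ j x * PP v b τ k x *
      (m j k + m k j - c j k * (m j j + m k k))))| ≤ 4 * K * big := by
    refine le_trans (b := 4 * K * EE (fun x => τ ^ 2 * (P0 v b τ x *
      ∑ j, ∑ k, PP v b τ j x * PP v b τ k x * (1 - (v j ⬝ᵥ v k) ^ 2)))) ?_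
      (mul_le_mul_of_nonneg_left hB (by positivity))
    rw [← EE_const_mul]
    refine EE_abs_le tR ((Tame.const _).mul ((Tame.const _).mul (tP0.mul
      (Tame.sum _ fun j => Tame.sum _ fun k => ((tP j).mul (tP k)).mul (Tame.const _)))))
      fun x => ?_
    rw [abs_mul, abs_mul, abs_of_nonneg (sq_nonneg τ), abs_of_pos (P0_pos v b τ x)]
    have : |∑ j, ∑ k, PP v b τ j x * PP v b τ k x * (m j k + m k j - c j k * (m j j + m k k))|
        ≤ 4 * K * ∑ j, ∑ k, PP v b τ j x * PP v b τ k x * (1 - (v j ⬝ᵥ v k) ^ 2) := by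
      rw [Finset.mul_sum]
      refine (Finset.abs_sum_le_sum_abs _ _).trans (Finset.sum_le_sum fun j _ => ?_)
      rw [Finset.mul_sum]
      refine (Finset.abs_sum_le_sum_abs _ _).trans (Finset.sum_le_sum fun k _ => ?_)
      have h0 : 0 ≤ PP v b τ j x * PP v b τ k x :=
        mul_nonneg (PP_pos v b τ j x).le (PP_pos v b τ k x).le
      rw [abs_mul, abs_of_nonneg h0]
      have := mul_le_mul_of_nonneg_left (hmm j k) h0
      simp only [hmdef, hc]
      linarith
    have := mul_le_mul_of_nonneg_left (mul_le_mul_of_nonneg_left this (P0_pos v b τ x).le)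
      (sq_nonneg τ)
    linarith
  have b2 : |EE (fun x => ∑ j, (m j j * τ) * ((x ⬝ᵥ v j) * (P0 v b τ x * PP v b τ j x)))|
      ≤ K * big := by
    rw [hbig, ← EE_const_mul]
    refine EE_abs_le (Tame.sum _ tL') ((Tame.const _).mul ((Tame.const _).mul (hΨ.mul
      ((tP0.mul (Tame.sum _ tP)).add (Tame.sum _ fun j => Tame.sum _ fun k =>
        (Tame.const _).mul ((tP j).mul (tP k))))))) fun x => ?_
    have h1 : |∑ j, (m j j * τ) * ((x ⬝ᵥ v j) * (P0 v b τ x * PP v b τ j x))|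
        ≤ ∑ j, K * τ * (Ψ x * (P0 v b τ x * PP v b τ j x)) := by
      refine (Finset.abs_sum_le_sum_abs _ _).trans (Finset.sum_le_sum fun j _ => ?_)
      have h0 : 0 ≤ P0 v b τ x * PP v b τ j x :=
        mul_nonneg (P0_pos v b τ x).le (PP_pos v b τ j x).le
      rw [abs_mul, abs_mul, abs_mul, abs_of_nonneg hτ, abs_of_nonneg h0]
      have := hm j
      have := hge j x
      gcongr
    have h2 : 0 ≤ K * τ * (Ψ x * ∑ j, ∑ k, (1 - v j ⬝ᵥ v k) * (PP v b τ j x * PP v b τ k x)) := by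
      rcases isEmpty_or_nonempty (Fin d) with h | ⟨⟨j⟩⟩
      · simp
      · have hΨ0 : 0 ≤ Ψ x := (abs_nonneg _).trans (hge j x)
        refine mul_nonneg (mul_nonneg hK hτ) (mul_nonneg hΨ0 (Finset.sum_nonneg fun j _ =>
          Finset.sum_nonneg fun k _ => mul_nonneg ?_
            (mul_nonneg (PP_pos v b τ j x).le (PP_pos v b τ k x).le)))
        have := (le_abs_self _).trans (dot_le_one (hv j) (hv k)); linarith
    simp only [← Finset.mul_sum] at h1
    linarith
  rw [e]
  refine (abs_sub _ _).trans ?_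
  have := mul_le_mul_of_nonneg_left hA hK
  linarith

/-! ### The weight -/

/-- one-parameter weight dominating all `|x ⬝ᵥ v j|` -/
noncomputable def Wt {d : ℕ} (v : Fin d → Fin d → ℝ) (l : ℝ) (x : Fin d → ℝ) : ℝ :=
  2 * l + l⁻¹ * Real.exp (-(2 * l ^ 2)) *
    ∑ j, (Real.exp (x ⬝ᵥ (l • v j)) + Real.exp (x ⬝ᵥ (-l • v j)))

noncomputable def Wt' {d : ℕ} (v : Fin d → Fin d → ℝ) (l : ℝ) (w : Fin d → ℝ) (x : Fin d → ℝ) : ℝ :=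
  l⁻¹ * Real.exp (-(2 * l ^ 2)) *
    ∑ j, (Real.exp (x ⬝ᵥ (l • v j)) * (w ⬝ᵥ (l • v j))
      + Real.exp (x ⬝ᵥ (-l • v j)) * (w ⬝ᵥ (-l • v j)))

section weight

variable {d : ℕ} (v : Fin d → Fin d → ℝ) (l : ℝ)

lemma Wt_tame : Tame (Wt v l) :=
  (Tame.const _).add ((Tame.const _).mul (Tame.sum _ fun _ =>
    (Tame.exp_dot _).add (Tame.exp_dot _)))

lemma Wt'_tame (w : Fin d → ℝ) : Tame (Wt' v l w) :=
  (Tame.const _).mul (Tame.sum _ fun _ =>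
    ((Tame.exp_dot _).mul (Tame.const _)).add ((Tame.exp_dot _).mul (Tame.const _)))

lemma Wt_LD (w : Fin d → ℝ) : LD (Wt v l) (Wt' v l w) w := by
  refine ((LD.const (2 * l) w).add ((LD.sum Finset.univ fun j =>
    (LD.dot (l • v j) w).exp.add (LD.dot (-l • v j) w).exp).const_mul
      (l⁻¹ * Real.exp (-(2 * l ^ 2))))).congr fun x => ?_
  simp [Wt']

lemma Wt_ge (hl : 0 < l) (k : Fin d) (x : Fin d → ℝ) : |x ⬝ᵥ v k| ≤ Wt v l x := by
  have h1 : Real.exp (l * |x ⬝ᵥ v k|) ≤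
      ∑ j, (Real.exp (x ⬝ᵥ (l • v j)) + Real.exp (x ⬝ᵥ (-l • v j))) := by
    refine le_trans ?_ (Finset.single_le_sum
      (f := fun j => Real.exp (x ⬝ᵥ (l • v j)) + Real.exp (x ⬝ᵥ (-l • v j)))
      (fun j _ => by positivity) (Finset.mem_univ k))
    simp only [dotProduct_smul, smul_eq_mul]
    rcases abs_cases (x ⬝ᵥ v k) with ⟨h, _⟩ | ⟨h, _⟩ <;> rw [h]
    · linarith [Real.exp_pos (-l * (x ⬝ᵥ v k))]
    · have : l * -(x ⬝ᵥ v k) = -l * (x ⬝ᵥ v k) := by ring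
      rw [this]; linarith [Real.exp_pos (l * (x ⬝ᵥ v k))]
  have h2 := Real.add_one_le_exp (-(2 * l ^ 2) + l * |x ⬝ᵥ v k|)
  rw [Real.exp_add] at h2
  have h3 := mul_le_mul_of_nonneg_left h1 (Real.exp_pos (-(2 * l ^ 2))).le
  have h4 : -(2 * l ^ 2) + l * |x ⬝ᵥ v k| ≤ Real.exp (-(2 * l ^ 2)) *
    ∑ j, (Real.exp (x ⬝ᵥ (l • v j)) + Real.exp (x ⬝ᵥ (-l • v j))) := by linarith
  have h5 := mul_le_mul_of_nonneg_left h4 (inv_pos.2 hl).le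
  have h6 : l⁻¹ * (-(2 * l ^ 2) + l * |x ⬝ᵥ v k|) = -(2 * l) + |x ⬝ᵥ v k| := by
    field_simp
  unfold Wt
  rw [h6] at h5
  linarith

lemma Wt'_le (hl : 0 < l) (hv : ∀ j, v j ⬝ᵥ v j = 1) (k : Fin d) (x : Fin d → ℝ) :
    |Wt' v l (v k) x| ≤ Wt v l x ^ 2 / 2 := by
  set S := ∑ j, (Real.exp (x ⬝ᵥ (l • v j)) + Real.exp (x ⬝ᵥ (-l • v j))) with hS
  have hS0 : 0 ≤ S := Finset.sum_nonneg fun j _ => by positivity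
  have h1 : |∑ j, (Real.exp (x ⬝ᵥ (l • v j)) * (v k ⬝ᵥ (l • v j))
      + Real.exp (x ⬝ᵥ (-l • v j)) * (v k ⬝ᵥ (-l • v j)))| ≤ l * S := by
    rw [hS, Finset.mul_sum]
    refine (Finset.abs_sum_le_sum_abs _ _).trans (Finset.sum_le_sum fun j _ => ?_)
    have hc := dot_le_one (hv k) (hv j)
    refine (abs_add_le _ _).trans ?_
    simp only [dotProduct_smul, smul_eq_mul, abs_mul, abs_neg, abs_of_pos hl, Real.abs_exp]
    have e1 := Real.exp_pos (l * (x ⬝ᵥ v j))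
    have e2 := Real.exp_pos (-l * (x ⬝ᵥ v j))
    have : l * |v k ⬝ᵥ v j| ≤ l := by nlinarith
    nlinarith
  set r := l⁻¹ * Real.exp (-(2 * l ^ 2)) with hr
  have hr0 : 0 ≤ r := by positivity
  have h2 : |Wt' v l (v k) x| ≤ r * (l * S) := by
    unfold Wt'
    rw [abs_mul, abs_of_nonneg hr0]
    exact mul_le_mul_of_nonneg_left h1 hr0
  have h3 : Wt v l x = 2 * l + r * S := rfl
  rw [h3]
  have : 0 ≤ r * S := by positivity
  nlinarith

lemma EE_Wt_sq (hl : 1 ≤ l) (hd : Real.exp (l ^ 2) = d) (hv : ∀ j, v j ⬝ᵥ v j = 1) :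
    EE (fun x => Wt v l x ^ 2) ≤ 16 * l ^ 2 := by
  have hl0 : 0 < l := by linarith
  set r := l⁻¹ * Real.exp (-(2 * l ^ 2)) with hr
  have tE : ∀ j, Tame (fun x : Fin d → ℝ =>
      Real.exp (x ⬝ᵥ ((2 * l) • v j)) + Real.exp (x ⬝ᵥ ((-(2 * l)) • v j))) :=
    fun j => (Tame.exp_dot _).add (Tame.exp_dot _)
  have h1 : EE (fun x => Wt v l x ^ 2) ≤ EE (fun x => 8 * l ^ 2 + (4 * d * r ^ 2) * ∑ j,
      (Real.exp (x ⬝ᵥ ((2 * l) • v j)) + Real.exp (x ⬝ᵥ ((-(2 * l)) • v j)))) := by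
    refine EE_mono (by simpa [pow_two] using (Wt_tame v l).mul (Wt_tame v l))
      ((Tame.const _).add ((Tame.const _).mul (Tame.sum _ tE))) fun x => ?_
    set S := ∑ j, (Real.exp (x ⬝ᵥ (l • v j)) + Real.exp (x ⬝ᵥ (-l • v j))) with hS
    have h3 : Wt v l x = 2 * l + r * S := rfl
    have hcs : S ^ 2 ≤ d * ∑ j, (Real.exp (x ⬝ᵥ (l • v j)) + Real.exp (x ⬝ᵥ (-l • v j))) ^ 2 := by
      have := sq_sum_le_card_mul_sum_sq (s := Finset.univ)
        (f := fun j => Real.exp (x ⬝ᵥ (l • v j)) + Real.exp (x ⬝ᵥ (-l • v j)))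
      simp only [Finset.card_univ, Fintype.card_fin] at this
      exact this
    have hcs2 : ∑ j, (Real.exp (x ⬝ᵥ (l • v j)) + Real.exp (x ⬝ᵥ (-l • v j))) ^ 2
        ≤ 2 * ∑ j, (Real.exp (x ⬝ᵥ ((2 * l) • v j)) + Real.exp (x ⬝ᵥ ((-(2 * l)) • v j))) := by
      rw [Finset.mul_sum]
      refine Finset.sum_le_sum fun j _ => ?_
      have e1 : Real.exp (x ⬝ᵥ ((2 * l) • v j)) = Real.exp (x ⬝ᵥ (l • v j)) ^ 2 := by
        rw [← Real.exp_nat_mul]; congr 1; simp only [dotProduct_smul, smul_eq_mul]; push_cast; ring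
      have e2 : Real.exp (x ⬝ᵥ ((-(2 * l)) • v j)) = Real.exp (x ⬝ᵥ (-l • v j)) ^ 2 := by
        rw [← Real.exp_nat_mul]; congr 1; simp only [dotProduct_smul, smul_eq_mul]; push_cast; ring
      rw [e1, e2]
      nlinarith [sq_nonneg (Real.exp (x ⬝ᵥ (l • v j)) - Real.exp (x ⬝ᵥ (-l • v j)))]
    have hcs3 : S ^ 2 ≤ d * (2 * ∑ j, (Real.exp (x ⬝ᵥ ((2 * l) • v j))
        + Real.exp (x ⬝ᵥ ((-(2 * l)) • v j)))) :=
      hcs.trans (mul_le_mul_of_nonneg_left hcs2 (Nat.cast_nonneg d))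
    have := mul_le_mul_of_nonneg_left hcs3 (sq_nonneg r)
    rw [h3]
    nlinarith [sq_nonneg (2 * l - r * S)]
  refine h1.trans ?_
  rw [EE_add (Tame.const _) ((Tame.const _).mul (Tame.sum _ tE)), EE_const, EE_const_mul,
    EE_sum _ tE]
  have h2 : ∀ j, EE (fun x : Fin d → ℝ =>
      Real.exp (x ⬝ᵥ ((2 * l) • v j)) + Real.exp (x ⬝ᵥ ((-(2 * l)) • v j)))
      = 2 * (d : ℝ) ^ 2 := by
    intro j
    rw [EE_add (Tame.exp_dot _) (Tame.exp_dot _), EE_exp, EE_exp, ← hd, ← Real.exp_nat_mul]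
    simp only [dotProduct_smul, smul_dotProduct, smul_eq_mul, hv]
    rw [two_mul]
    congr 2 <;> (push_cast; ring)
  simp only [h2, Finset.sum_const, Finset.card_univ, Fintype.card_fin, nsmul_eq_mul]
  have hdpos : (0:ℝ) < d := hd ▸ Real.exp_pos _
  have h4 : r = l⁻¹ * ((d:ℝ) ^ 2)⁻¹ := by
    rw [hr, ← hd, ← Real.exp_nat_mul, ← Real.exp_neg]; norm_num
  rw [h4]
  have h5 : 4 * (d:ℝ) * (l⁻¹ * ((d:ℝ) ^ 2)⁻¹) ^ 2 * (d * (2 * (d:ℝ) ^ 2)) = 8 * (l⁻¹) ^ 2 := by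
    field_simp; norm_num
  rw [h5]
  have h6 : l⁻¹ ≤ 1 := inv_le_one_of_one_le₀ hl
  have h7 : 0 < l⁻¹ := inv_pos.2 hl0
  nlinarith

end weight

/-! ### The Gaussian Hessian and the limit -/

lemma fderiv_of_LD {d : ℕ} {F F' : (Fin d → ℝ) → ℝ} {w : Fin d → ℝ} (hF : Differentiable ℝ F)
    (h : LD F F' w) (x : Fin d → ℝ) : fderiv ℝ F x w = F' x := by
  have h1 : HasLineDerivAt ℝ F (F' x) x w := h x
  rw [← (hF x).lineDeriv_eq_fderiv, h1.lineDeriv]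

lemma gaussPDF2_eq {d : ℕ} (a c : Fin d) (z : Fin d → ℝ) :
    gaussPDF2 d a c z = (z a * z c - if a = c then 1 else 0) * gaussPDF d z := by
  have hd : Differentiable ℝ (gaussPDF d) := by unfold gaussPDF; fun_prop
  have h1 : (fun w => fderiv ℝ (gaussPDF d) w (Pi.single c 1))
      = fun w => (-1 * w c) * gaussPDF d w := by
    funext w
    rw [fderiv_of_LD hd (LD.gauss (Pi.single c 1)) w]
    simp
  unfold gaussPDF2
  rw [h1]
  have h2 := ((LD.coord c (Pi.single a (1:ℝ))).const_mul (-1)).mul (LD.gauss (Pi.single a (1:ℝ)))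
  rw [fderiv_of_LD (by fun_prop) h2 z]
  simp only [dotProduct_single, mul_one, Pi.single_apply, eq_comm (a := c)]
  ring

lemma P0_tendsto {d : ℕ} (v : Fin d → Fin d → ℝ) (b : Fin d → ℝ) (x : Fin d → ℝ) :
    Filter.Tendsto (fun n : ℕ => P0 v (fun j => b j + ((n:ℝ) + 1)⁻¹) (((n:ℝ) + 1) ^ 2) x)
      Filter.atTop (nhds (Set.indicator {x : Fin d → ℝ | ∀ j, x ⬝ᵥ v j ≤ b j} 1 x)) := by
  have hN : Filter.Tendsto (fun n : ℕ => (n:ℝ) + 1) Filter.atTop Filter.atTop :=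
    Filter.tendsto_atTop_add_const_right _ _ tendsto_natCast_atTop_atTop
  have hez : ∀ (n : ℕ) j, ez v (fun j => b j + ((n:ℝ) + 1)⁻¹) (((n:ℝ) + 1) ^ 2) j x
      = Real.exp (((n:ℝ) + 1) * (((n:ℝ) + 1) * (x ⬝ᵥ v j - b j) - 1)) := by
    intro n j
    unfold ez
    congr 1
    field_simp
    ring
  by_cases hx : x ∈ {x : Fin d → ℝ | ∀ j, x ⬝ᵥ v j ≤ b j}
  · rw [Set.indicator_of_mem hx]
    have h0 : ∀ j, Filter.Tendsto (fun n : ℕ => ez v (fun j => b j + ((n:ℝ) + 1)⁻¹)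
        (((n:ℝ) + 1) ^ 2) j x) Filter.atTop (nhds 0) := by
      intro j
      refine squeeze_zero (g := fun n : ℕ => Real.exp (-((n:ℝ) + 1)))
        (fun n => (ez_pos _ _ _ _ _).le) (fun n => ?_)
        (Real.tendsto_exp_neg_atTop_nhds_zero.comp hN)
      rw [hez]
      apply Real.exp_le_exp.2
      have h1 : x ⬝ᵥ v j - b j ≤ 0 := by linarith [hx j]
      have h2 : (0:ℝ) ≤ (n:ℝ) + 1 := by positivity
      nlinarith [mul_nonneg h2 h2]
    have h1 := ((tendsto_finsetSum Finset.univ fun j _ => h0 j).const_add 1).inv₀ (by simp)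
    simpa [P0] using h1
  · rw [Set.indicator_of_notMem hx]
    simp only [Set.mem_setOf_eq, not_forall, not_le] at hx
    obtain ⟨j, hj⟩ := hx
    refine squeeze_zero (g := fun n : ℕ => Real.exp (-(((n:ℝ) + 1) *
      (((n:ℝ) + 1) * (x ⬝ᵥ v j - b j) - 1)))) (fun n => (P0_pos _ _ _ _).le) (fun n => ?_) ?_
    · rw [Real.exp_neg, ← hez]
      unfold P0
      refine inv_anti₀ (ez_pos _ _ _ _ _) ?_
      have := Finset.single_le_sum (f := fun j => ez v (fun j => b j + ((n:ℝ) + 1)⁻¹)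
        (((n:ℝ) + 1) ^ 2) j x) (fun j _ => (ez_pos _ _ _ _ _).le) (Finset.mem_univ j)
      linarith
    · refine Real.tendsto_exp_neg_atTop_nhds_zero.comp (hN.atTop_mul_atTop₀ ?_)
      exact Filter.tendsto_atTop_add_const_right _ (-1)
        (hN.atTop_mul_const (by linarith))

lemma int_tendsto {d : ℕ} (v : Fin d → Fin d → ℝ) (b : Fin d → ℝ)
    (M : Matrix (Fin d) (Fin d) ℝ) :
    Filter.Tendsto (fun n : ℕ => EE (fun x =>
        P0 v (fun j => b j + ((n:ℝ) + 1)⁻¹) (((n:ℝ) + 1) ^ 2) x *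
          ∑ a, ∑ c, M a c * (x a * x c - if a = c then 1 else 0)))
      Filter.atTop (nhds (∫ z in {x : Fin d → ℝ | ∀ j, x ⬝ᵥ v j ≤ b j},
            ∑ a, ∑ c, M a c * gaussPDF2 d a c z)) := by
  have hmeas : MeasurableSet {x : Fin d → ℝ | ∀ j, x ⬝ᵥ v j ≤ b j} := by
    rw [Set.setOf_forall]
    exact MeasurableSet.iInter fun j =>
      (isClosed_le (cont_dot (v j)) continuous_const).measurableSet
  have tQ : Tame (fun x : Fin d → ℝ =>
      ∑ a, ∑ c, M a c * (x a * x c - if a = c then 1 else 0)) :=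
    Tame.sum _ fun a => Tame.sum _ fun c =>
      (Tame.const (M a c)).mul (((Tame.coord a).mul (Tame.coord c)).sub (Tame.const _))
  have e : ∀ z, ∑ a, ∑ c, M a c * gaussPDF2 d a c z
      = (∑ a, ∑ c, M a c * (z a * z c - if a = c then 1 else 0)) * gaussPDF d z := by
    intro z
    simp only [gaussPDF2_eq, Finset.sum_mul]
    exact Finset.sum_congr rfl fun a _ => Finset.sum_congr rfl fun c _ => by ring
  simp_rw [e]
  rw [← integral_indicator hmeas]
  unfold EE
  refine tendsto_integral_of_dominated_convergence
    (fun x => ‖(∑ a, ∑ c, M a c * (x a * x c - if a = c then 1 else 0)) * gaussPDF d x‖)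
    (fun n => ((P0_tame _ _ _).mul tQ).integrable.aestronglyMeasurable) tQ.integrable.norm
    (fun n => ae_of_all _ fun x => ?_) (ae_of_all _ fun x => ?_)
  · rw [mul_assoc, norm_mul]
    refine mul_le_of_le_one_left (norm_nonneg _) ?_
    rw [Real.norm_eq_abs, abs_of_pos (P0_pos _ _ _ _)]
    exact P0_le _ _ _ _
  · have h := (P0_tendsto v b x).mul_const
      ((∑ a, ∑ c, M a c * (x a * x c - if a = c then 1 else 0)) * gaussPDF d x)
    simp only [mul_assoc] at h ⊢
    convert h using 2
    by_cases hx : x ∈ {x : Fin d → ℝ | ∀ j, x ⬝ᵥ v j ≤ b j}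
    · rw [Set.indicator_of_mem hx, Set.indicator_of_mem hx]; simp
    · rw [Set.indicator_of_notMem hx, Set.indicator_of_notMem hx]; simp



lemma sum_perp {d : ℕ} {u w : Fin d → ℝ} (hu : u ⬝ᵥ u = 1) (hw : w ⬝ᵥ w = 1) :
    ∑ i, (w i - (u ⬝ᵥ w) * u i) ^ 2 = 1 - (u ⬝ᵥ w) ^ 2 := by
  have h : ∑ i, (w i - (u ⬝ᵥ w) * u i) ^ 2
      = w ⬝ᵥ w - 2 * (u ⬝ᵥ w) * (u ⬝ᵥ w) + (u ⬝ᵥ w) ^ 2 * (u ⬝ᵥ u) := by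
    generalize hc : u ⬝ᵥ w = c
    have : 2 * c * c = 2 * c * (u ⬝ᵥ w) := by rw [hc]
    rw [this]
    simp only [dotProduct, Finset.mul_sum, ← Finset.sum_add_distrib, ← Finset.sum_sub_distrib]
    exact Finset.sum_congr rfl fun i _ => by ring
  rw [h, hu, hw]; ring

lemma eq_of_sq {d : ℕ} {u w : Fin d → ℝ} (hu : u ⬝ᵥ u = 1) (hw : w ⬝ᵥ w = 1)
    (h : 1 - (u ⬝ᵥ w) ^ 2 ≤ 0) : w = u ∨ w = -u := by
  have h0 := sum_perp hu hw
  have h1 : ∑ i, (w i - (u ⬝ᵥ w) * u i) ^ 2 = 0 :=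
    le_antisymm (h0 ▸ h) (Finset.sum_nonneg fun i _ => sq_nonneg _)
  rw [Finset.sum_eq_zero_iff_of_nonneg (fun i _ => sq_nonneg _)] at h1
  have h2 : (u ⬝ᵥ w) ^ 2 = 1 := by
    have := h0.symm.trans (Finset.sum_eq_zero (fun i hi => h1 i hi))
    linarith
  have h3 : ∀ i, w i = (u ⬝ᵥ w) * u i := fun i => by
    have := pow_eq_zero_iff (two_ne_zero) |>.1 (h1 i (Finset.mem_univ i)); linarith
  rcases (sq_eq_sq_iff_eq_or_eq_neg.1 (h2.trans (one_pow 2).symm)) with h4 | h4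
  · left; funext i; rw [h3 i, h4, one_mul]
  · right; funext i; rw [h3 i, h4]; simp

lemma perp_forms {d : ℕ} (M : Matrix (Fin d) (Fin d) ℝ) {u w : Fin d → ℝ} (hu : u ⬝ᵥ u = 1)
    (hw : w ⬝ᵥ w = 1) (h : 0 < 1 - (u ⬝ᵥ w) ^ 2) :
    u ⬝ᵥ M.mulVec w - (u ⬝ᵥ w) * (u ⬝ᵥ M.mulVec u)
        = √(1 - (u ⬝ᵥ w) ^ 2) * (u ⬝ᵥ M.mulVec (perpUnit u w)) ∧
      w ⬝ᵥ M.mulVec w - (u ⬝ᵥ w) * (u ⬝ᵥ M.mulVec w) - (u ⬝ᵥ w) * (w ⬝ᵥ M.mulVec u)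
        + (u ⬝ᵥ w) ^ 2 * (u ⬝ᵥ M.mulVec u)
        = (1 - (u ⬝ᵥ w) ^ 2) * (perpUnit u w ⬝ᵥ M.mulVec (perpUnit u w)) := by
  set c := u ⬝ᵥ w with hc
  set s := √(1 - c ^ 2) with hs
  have hs0 : 0 < s := Real.sqrt_pos.2 h
  have hs2 : s ^ 2 = 1 - c ^ 2 := Real.sq_sqrt h.le
  have hp : perpUnit u w = s⁻¹ • (w - c • u) := by
    unfold perpUnit
    rw [sum_perp hu hw]
    rfl
  rw [hp, ← hs2]
  simp only [Matrix.mulVec_smul, Matrix.mulVec_sub, dotProduct_smul, smul_dotProduct,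
    dotProduct_sub, sub_dotProduct, smul_eq_mul]
  constructor <;> · field_simp; try ring

lemma alg_pair {mjj mkk mjk mkj c s K p q p' q' : ℝ} (hK : 0 ≤ K) (hs0 : 0 < s)
    (hs : s ^ 2 = 1 - c ^ 2)
    (h1 : mjk - c * mjj = s * p) (h2 : mkk - c * mjk - c * mkj + c ^ 2 * mjj = s ^ 2 * q)
    (h3 : mkj - c * mkk = s * p') (h4 : mjj - c * mkj - c * mjk + c ^ 2 * mkk = s ^ 2 * q')
    (hj : |mjj| ≤ K) (hk : |mkk| ≤ K) (hp : |p| ≤ K) (hq : |q| ≤ K) (hp' : |p'| ≤ K)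
    (hq' : |q'| ≤ K) :
    |mjk + mkj - c * (mjj + mkk)| ≤ 4 * K * s ^ 2 := by
  set T := mjk + mkj - c * (mjj + mkk) with hT
  have a1 : T = s * (p + p') := by rw [hT]; linarith
  have a2 : 2 * (c * T) = s ^ 2 * (mjj + mkk - q - q') := by
    have : s ^ 2 * (mjj + mkk) = (1 - c ^ 2) * (mjj + mkk) := by rw [hs]
    rw [hT]; linarith
  have b1 : |T| ≤ s * (2 * K) := by
    rw [a1, abs_mul, abs_of_pos hs0]
    refine mul_le_mul_of_nonneg_left ((abs_add_le _ _).trans (by linarith)) hs0.le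
  have b2 : |c| * |T| ≤ s ^ 2 * (2 * K) := by
    have : |2 * (c * T)| ≤ s ^ 2 * (4 * K) := by
      rw [a2, abs_mul, abs_of_nonneg (sq_nonneg s)]
      refine mul_le_mul_of_nonneg_left ?_ (sq_nonneg s)
      rw [abs_le] at *
      constructor <;> linarith [hj.1, hj.2]
    rw [abs_mul, abs_mul, abs_two] at this
    linarith
  by_cases hc : 1 / 2 ≤ |c|
  · nlinarith [mul_le_mul_of_nonneg_right hc (abs_nonneg T)]
  · push Not at hc
    have : c ^ 2 ≤ 1 / 4 := by
      rw [← sq_abs]; nlinarith [abs_nonneg c]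
    have hh : 1 / 2 ≤ s := by
      by_contra hcon
      push Not at hcon
      nlinarith
    nlinarith [mul_nonneg (mul_nonneg hK hs0.le) (sub_nonneg.2 hh)]


/-- second-derivative bound over convex polytopes. -/
theorem stmt7 :
    ∃ C : ℝ, 0 < C ∧
      ∀ d : ℕ, 3 ≤ d →
      ∀ v : Fin d → (Fin d → ℝ), Function.Injective v → (∀ j, ∑ i, v j i ^ 2 = 1) →
      ∀ b : Fin d → ℝ, ∀ M : Matrix (Fin d) (Fin d) ℝ,
        |∫ z in {x : Fin d → ℝ | ∀ j, x ⬝ᵥ v j ≤ b j},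
            ∑ a, ∑ c, M a c * gaussPDF2 d a c z| ≤
          C * Real.log d * sSup {r : ℝ | ∃ j k : Fin d, j ≠ k ∧ v k ≠ -v j ∧
            r = |v j ⬝ᵥ M.mulVec (v j)| + |v j ⬝ᵥ M.mulVec (perpUnit (v j) (v k))| +
                |perpUnit (v j) (v k) ⬝ᵥ M.mulVec (perpUnit (v j) (v k))|} := by
  refine ⟨120, by norm_num, ?_⟩
  intro d hd v hinj hv' b M
  have hv : ∀ j, v j ⬝ᵥ v j = 1 := fun j => by
    rw [← hv' j]; simp only [dotProduct]; exact Finset.sum_congr rfl fun i _ => by ring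
  set S := {r : ℝ | ∃ j k : Fin d, j ≠ k ∧ v k ≠ -v j ∧
            r = |v j ⬝ᵥ M.mulVec (v j)| + |v j ⬝ᵥ M.mulVec (perpUnit (v j) (v k))| +
                |perpUnit (v j) (v k) ⬝ᵥ M.mulVec (perpUnit (v j) (v k))|} with hS
  set K := sSup S with hKdef
  have hfin : S.Finite := by
    refine (Set.finite_range (fun p : Fin d × Fin d =>
      |v p.1 ⬝ᵥ M.mulVec (v p.1)| + |v p.1 ⬝ᵥ M.mulVec (perpUnit (v p.1) (v p.2))| +
        |perpUnit (v p.1) (v p.2) ⬝ᵥ M.mulVec (perpUnit (v p.1) (v p.2))|)).subset ?_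
    rintro r ⟨j, k, -, -, rfl⟩
    exact ⟨(j, k), rfl⟩
  have hle : ∀ j k : Fin d, j ≠ k → v k ≠ -v j →
      |v j ⬝ᵥ M.mulVec (v j)| + |v j ⬝ᵥ M.mulVec (perpUnit (v j) (v k))| +
        |perpUnit (v j) (v k) ⬝ᵥ M.mulVec (perpUnit (v j) (v k))| ≤ K :=
    fun j k hjk hne => le_csSup hfin.bddAbove ⟨j, k, hjk, hne, rfl⟩
  have hex : ∀ j : Fin d, ∃ k, j ≠ k ∧ v k ≠ -v j := by
    intro j
    have h1 : (Finset.univ.erase j).card = d - 1 := by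
      rw [Finset.card_erase_of_mem (Finset.mem_univ j), Finset.card_univ, Fintype.card_fin]
    obtain ⟨k1, hk1, k2, hk2, hne⟩ := Finset.one_lt_card.1
      (show 1 < (Finset.univ.erase j).card by rw [h1]; omega)
    by_cases h : v k1 = -v j
    · refine ⟨k2, (Finset.ne_of_mem_erase hk2).symm, fun h' => hne (hinj (h.trans h'.symm))⟩
    · exact ⟨k1, (Finset.ne_of_mem_erase hk1).symm, h⟩
  have hm : ∀ j, |v j ⬝ᵥ M.mulVec (v j)| ≤ K := by
    intro j
    obtain ⟨k, h1, h2⟩ := hex j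
    have := hle j k h1 h2
    linarith [abs_nonneg (v j ⬝ᵥ M.mulVec (perpUnit (v j) (v k))),
      abs_nonneg (perpUnit (v j) (v k) ⬝ᵥ M.mulVec (perpUnit (v j) (v k)))]
  have hK : 0 ≤ K := (abs_nonneg _).trans (hm ⟨0, by omega⟩)
  have hmm : ∀ j k, |v j ⬝ᵥ M.mulVec (v k) + v k ⬝ᵥ M.mulVec (v j)
      - (v j ⬝ᵥ v k) * (v j ⬝ᵥ M.mulVec (v j) + v k ⬝ᵥ M.mulVec (v k))|
        ≤ 4 * K * (1 - (v j ⬝ᵥ v k) ^ 2) := by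
    intro j k
    by_cases hjk : j = k
    · subst hjk
      rw [hv j]; simp
    by_cases hne : v k = -v j
    · rw [hne]
      simp only [dotProduct_neg, neg_dotProduct, Matrix.mulVec_neg, hv j]
      norm_num
    have hpos : 0 < 1 - (v j ⬝ᵥ v k) ^ 2 := by
      by_contra hcon
      rcases eq_of_sq (hv j) (hv k) (not_lt.1 hcon) with h | h
      · exact hjk (hinj h.symm)
      · exact hne h
    have hcomm : v k ⬝ᵥ v j = v j ⬝ᵥ v k := dotProduct_comm _ _
    obtain ⟨e1, e2⟩ := perp_forms M (hv j) (hv k) hpos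
    obtain ⟨e3, e4⟩ := perp_forms M (hv k) (hv j) (by rw [hcomm]; exact hpos)
    rw [hcomm] at e3 e4
    have l1 := hle j k hjk hne
    have l2 := hle k j (Ne.symm hjk) (fun h => hne (by rw [h, neg_neg]))
    have hs2 : √(1 - (v j ⬝ᵥ v k) ^ 2) ^ 2 = 1 - (v j ⬝ᵥ v k) ^ 2 := Real.sq_sqrt hpos.le
    rw [← hs2] at e2 e4
    have := alg_pair hK (Real.sqrt_pos.2 hpos) hs2 e1 e2 e3 e4 (hm j) (hm k)
      (by linarith [abs_nonneg (v j ⬝ᵥ M.mulVec (v j)),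
        abs_nonneg (perpUnit (v j) (v k) ⬝ᵥ M.mulVec (perpUnit (v j) (v k)))])
      (by linarith [abs_nonneg (v j ⬝ᵥ M.mulVec (v j)),
        abs_nonneg (v j ⬝ᵥ M.mulVec (perpUnit (v j) (v k)))])
      (by linarith [abs_nonneg (v k ⬝ᵥ M.mulVec (v k)),
        abs_nonneg (perpUnit (v k) (v j) ⬝ᵥ M.mulVec (perpUnit (v k) (v j)))])
      (by linarith [abs_nonneg (v k ⬝ᵥ M.mulVec (v k)),
        abs_nonneg (v k ⬝ᵥ M.mulVec (perpUnit (v k) (v j)))])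
    rwa [hs2] at this
  have hd0 : (0:ℝ) < d := by exact_mod_cast (by omega : 0 < d)
  have hlog : 1 ≤ Real.log d := by
    rw [Real.le_log_iff_exp_le hd0]
    have : (3:ℝ) ≤ d := by exact_mod_cast hd
    linarith [Real.exp_one_lt_d9]
  have hl2 : √(Real.log d) ^ 2 = Real.log d := Real.sq_sqrt (by linarith)
  have hl1 : 1 ≤ √(Real.log d) := by rw [Real.one_le_sqrt]; exact hlog
  have hl0 : 0 < √(Real.log d) := by linarith
  have hW := EE_Wt_sq v (√(Real.log d)) hl1 (by rw [hl2, Real.exp_log hd0]) hv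
  rw [hl2] at hW
  refine le_of_tendsto (int_tendsto v b M).abs (Filter.Eventually.of_forall fun n => ?_)
  have := estC v (fun j => b j + ((n:ℝ) + 1)⁻¹) (((n:ℝ) + 1) ^ 2) (by positivity) hv
    (Wt v √(Real.log d)) (fun j => Wt' v √(Real.log d) (v j)) (Wt_tame v _)
    (fun j => Wt'_tame v _ _) (fun j => Wt_LD v _ _) (fun j x => Wt_ge v _ hl0 j x)
    (fun j x => Wt'_le v _ hl0 hv j x) M K hK hm hmm
  refine this.trans ?_
  nlinarith [mul_le_mul_of_nonneg_left hW hK]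
end

section
/- There exists an absolute constant C > 0 such that the following holds. Let d ≥ 3, let v_1, …, v_d be distinct unit vectors in ℝ^d, b_1, …, b_d ∈ ℝ, A = {x ∈ ℝ^d : x·v_j ≤ b_j for j = 1,…,d}, and for t ∈ ℝ let A(t) = {x ∈ ℝ^d : x·v_j ≤ b_j + t for j = 1,…,d}. Then for any κ > 0 and u_1, u_2, u_3 ∈ ℝ^d, sup_{x ∉ A(κ)∖A(−κ)} |∫_A ⟨u_1⊗u_2⊗u_3, ∇³φ_d(z − x)⟩ dz| ≤ C d³ e^{−κ²/4} max { |u_1·w_1| |u_2·w_2| |u_3·w_3| : w_1 ∈ V_1, w_2 ∈ V_1 ∪ V_2, w_3 ∈ V_1 ∪ V_2 ∪ V_3 }. -/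
open MeasureTheory Matrix Real

/-- the third partial derivative `∂_a ∂_c ∂_e φ_d(z)` -/
noncomputable def gaussPDF3 (d : ℕ) (a c e : Fin d) (z : Fin d → ℝ) : ℝ :=
  fderiv ℝ (fun w₁ =>
    fderiv ℝ (fun w₂ => fderiv ℝ (gaussPDF d) w₂ (Pi.single e 1)) w₁ (Pi.single c 1))
    z (Pi.single a 1)

/-- For unit vectors `v, w, u` with three-dimensional span (and `w ≠ ±v`), the unique unit
vector in `span{v, w, u}` orthogonal to `v` and `w`, with positive inner product with `u`. -/
noncomputable def perpUnit2 {d : ℕ} (v w u : Fin d → ℝ) : Fin d → ℝ :=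
  (Real.sqrt (∑ i,
      (u i - (v ⬝ᵥ u) * v i - (perpUnit v w ⬝ᵥ u) * perpUnit v w i) ^ 2))⁻¹ •
    fun i => u i - (v ⬝ᵥ u) * v i - (perpUnit v w ⬝ᵥ u) * perpUnit v w i

namespace GaussPoly

lemma hasLineDeriv_dot {d : ℕ} (u w z : Fin d → ℝ) :
    HasLineDerivAt ℝ (fun y : Fin d → ℝ => u ⬝ᵥ y) (u ⬝ᵥ w) z w := by
  unfold HasLineDerivAt
  have : (fun t : ℝ => u ⬝ᵥ (z + t • w)) = fun t : ℝ => u ⬝ᵥ z + t * (u ⬝ᵥ w) := by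
    ext t; simp [dotProduct_add, dotProduct_smul]
  rw [this]
  simpa using ((hasDerivAt_id (0 : ℝ)).mul_const (u ⬝ᵥ w)).const_add (u ⬝ᵥ z)

lemma gaussPDF_eq {d : ℕ} (z : Fin d → ℝ) :
    gaussPDF d z = (2 * π) ^ (-(d : ℝ) / 2) * Real.exp (-(z ⬝ᵥ z) / 2) := by
  simp [gaussPDF, dotProduct, pow_two]

lemma hasLineDeriv_gauss {d : ℕ} (w z : Fin d → ℝ) :
    HasLineDerivAt ℝ (gaussPDF d) (-(w ⬝ᵥ z) * gaussPDF d z) z w := by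
  unfold HasLineDerivAt
  have : (fun t : ℝ => gaussPDF d (z + t • w)) = fun t : ℝ =>
      (2 * π) ^ (-(d : ℝ) / 2) *
        Real.exp (-(z ⬝ᵥ z + 2 * t * (w ⬝ᵥ z) + t * t * (w ⬝ᵥ w)) / 2) := by
    ext t
    rw [gaussPDF_eq]
    congr 3
    simp [dotProduct_add, add_dotProduct, dotProduct_smul, smul_dotProduct, dotProduct_comm z w]
    ring
  rw [this]
  have h0 := hasDerivAt_id (0 : ℝ)
  have h1 := ((((h0.const_mul 2).mul_const (w ⬝ᵥ z)).const_add (z ⬝ᵥ z)).add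
    ((h0.mul h0).mul_const (w ⬝ᵥ w))).neg.div_const 2
  have h2 := (h1.exp).const_mul ((2 * π) ^ (-(d : ℝ) / 2))
  refine h2.congr_deriv ?_
  simp [gaussPDF_eq]
  ring

/-- first directional derivative -/
noncomputable def D1 {d : ℕ} (u z : Fin d → ℝ) : ℝ := -(u ⬝ᵥ z) * gaussPDF d z

/-- second directional derivative -/
noncomputable def D2 {d : ℕ} (u w z : Fin d → ℝ) : ℝ :=
  ((u ⬝ᵥ z) * (w ⬝ᵥ z) - u ⬝ᵥ w) * gaussPDF d z

/-- third directional derivative -/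
noncomputable def D3 {d : ℕ} (u w y z : Fin d → ℝ) : ℝ :=
  (-((u ⬝ᵥ z) * (w ⬝ᵥ z) * (y ⬝ᵥ z)) + (u ⬝ᵥ w) * (y ⬝ᵥ z) + (u ⬝ᵥ y) * (w ⬝ᵥ z)
    + (w ⬝ᵥ y) * (u ⬝ᵥ z)) * gaussPDF d z

lemma hasLineDeriv_D1 {d : ℕ} (u w z : Fin d → ℝ) :
    HasLineDerivAt ℝ (D1 w) (D2 u w z) z u := by
  have h1 := hasLineDeriv_dot w u z
  have h2 := hasLineDeriv_gauss u z
  unfold HasLineDerivAt at *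
  refine (h1.neg.mul h2).congr_deriv ?_
  simp [D2, dotProduct_comm w u]
  ring

lemma hasLineDeriv_D2 {d : ℕ} (u w y z : Fin d → ℝ) :
    HasLineDerivAt ℝ (D2 w y) (D3 u w y z) z u := by
  have h1 := hasLineDeriv_dot w u z
  have h1' := hasLineDeriv_dot y u z
  have h2 := hasLineDeriv_gauss u z
  unfold HasLineDerivAt at *
  refine (((h1.mul h1').sub_const (w ⬝ᵥ y)).mul h2).congr_deriv ?_
  simp [D3, dotProduct_comm w u, dotProduct_comm y u]
  ring

lemma contDiff_dot {d : ℕ} (u : Fin d → ℝ) {n : WithTop ℕ∞} :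
    ContDiff ℝ n (fun z : Fin d → ℝ => u ⬝ᵥ z) := by
  unfold dotProduct; fun_prop

@[fun_prop]
lemma continuous_dot {d : ℕ} (u : Fin d → ℝ) :
    Continuous (fun z : Fin d → ℝ => u ⬝ᵥ z) := by
  unfold dotProduct; fun_prop

lemma contDiff_gauss {d : ℕ} {n : WithTop ℕ∞} : ContDiff ℝ n (gaussPDF d) := by
  unfold gaussPDF; fun_prop

@[fun_prop]
lemma continuous_gauss {d : ℕ} : Continuous (gaussPDF d) := by
  unfold gaussPDF; fun_prop

@[fun_prop]
lemma continuous_D1 {d : ℕ} (u : Fin d → ℝ) : Continuous (D1 u) := by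
  unfold D1; fun_prop
@[fun_prop]
lemma continuous_D2 {d : ℕ} (u w : Fin d → ℝ) : Continuous (D2 u w) := by
  unfold D2; fun_prop
@[fun_prop]
lemma continuous_D3 {d : ℕ} (u w y : Fin d → ℝ) : Continuous (D3 u w y) := by
  unfold D3; fun_prop

lemma fderiv_of_line {d : ℕ} {f : (Fin d → ℝ) → ℝ} {f' : ℝ} {z u : Fin d → ℝ}
    (hd : DifferentiableAt ℝ f z) (h : HasLineDerivAt ℝ f f' z u) : fderiv ℝ f z u = f' := by
  rw [← hd.lineDeriv_eq_fderiv, h.lineDeriv]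

lemma gaussPDF3_eq {d : ℕ} (a c e : Fin d) (z : Fin d → ℝ) :
    gaussPDF3 d a c e z = D3 (Pi.single a 1) (Pi.single c 1) (Pi.single e 1) z := by
  unfold gaussPDF3
  have h1 : (fun w₂ => fderiv ℝ (gaussPDF d) w₂ (Pi.single e 1)) = D1 (Pi.single e 1) := by
    ext y
    exact fderiv_of_line (contDiff_gauss.differentiable (n := 1) (by simp) y)
      (hasLineDeriv_gauss _ _)
  rw [h1]
  have h2 : (fun w₂ => fderiv ℝ (D1 (Pi.single e 1)) w₂ (Pi.single c 1))
      = D2 (d := d) (Pi.single c 1) (Pi.single e 1) := by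
    ext y
    refine fderiv_of_line (ContDiff.differentiable (n := 1) ?_ (by simp) y) (hasLineDeriv_D1 _ _ _)
    exact (contDiff_dot _).neg.mul contDiff_gauss
  rw [h2]
  refine fderiv_of_line (ContDiff.differentiable (n := 1) ?_ (by simp) z) (hasLineDeriv_D2 _ _ _ _)
  exact (((contDiff_dot _).mul (contDiff_dot _)).sub contDiff_const).mul contDiff_gauss

lemma sum_gaussPDF3 {d : ℕ} (u1 u2 u3 z : Fin d → ℝ) :
    ∑ a, ∑ c, ∑ e, u1 a * u2 c * u3 e * gaussPDF3 d a c e z = D3 u1 u2 u3 z := by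
  have lin3 : ∀ u w : Fin d → ℝ, ∑ e, u3 e * D3 u w (Pi.single e 1) z = D3 u w u3 z := by
    intro u w
    have : ∀ e, u3 e * D3 u w (Pi.single e 1) z =
        (-((u ⬝ᵥ z) * (w ⬝ᵥ z)) * gaussPDF d z) * (u3 e * z e)
        + ((u ⬝ᵥ w) * gaussPDF d z) * (u3 e * z e)
        + ((w ⬝ᵥ z) * gaussPDF d z) * (u e * u3 e)
        + ((u ⬝ᵥ z) * gaussPDF d z) * (w e * u3 e) := by
      intro e; simp [D3]; ring
    simp only [this, Finset.sum_add_distrib, ← Finset.mul_sum]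
    simp only [D3, dotProduct]; ring
  have lin2 : ∀ u y : Fin d → ℝ, ∑ e, u2 e * D3 u (Pi.single e 1) y z = D3 u u2 y z := by
    intro u w
    have : ∀ e, u2 e * D3 u (Pi.single e 1) w z =
        (-((u ⬝ᵥ z) * (w ⬝ᵥ z)) * gaussPDF d z) * (u2 e * z e)
        + ((u ⬝ᵥ w) * gaussPDF d z) * (u2 e * z e)
        + ((w ⬝ᵥ z) * gaussPDF d z) * (u e * u2 e)
        + ((u ⬝ᵥ z) * gaussPDF d z) * (u2 e * w e) := by
      intro e; simp [D3]; ring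
    simp only [this, Finset.sum_add_distrib, ← Finset.mul_sum]
    simp only [D3, dotProduct]; ring
  have lin1 : ∀ u y : Fin d → ℝ, ∑ e, u1 e * D3 (Pi.single e 1) u y z = D3 u1 u y z := by
    intro u w
    have : ∀ e, u1 e * D3 (Pi.single e 1) u w z =
        (-((u ⬝ᵥ z) * (w ⬝ᵥ z)) * gaussPDF d z) * (u1 e * z e)
        + ((u ⬝ᵥ w) * gaussPDF d z) * (u1 e * z e)
        + ((w ⬝ᵥ z) * gaussPDF d z) * (u1 e * u e)
        + ((u ⬝ᵥ z) * gaussPDF d z) * (u1 e * w e) := by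
      intro e; simp [D3]; ring
    simp only [this, Finset.sum_add_distrib, ← Finset.mul_sum]
    simp only [D3, dotProduct]; ring
  simp only [gaussPDF3_eq, mul_assoc, ← Finset.mul_sum, lin3, lin2, lin1]

lemma gauss_pos {d : ℕ} (z : Fin d → ℝ) : 0 < gaussPDF d z := by
  unfold gaussPDF; positivity

lemma integrable_exp_dot {d : ℕ} {c : ℝ} (hc : 0 < c) :
    Integrable (fun z : Fin d → ℝ => Real.exp (-c * (z ⬝ᵥ z))) := by
  have h : (fun z : Fin d → ℝ => Real.exp (-c * (z ⬝ᵥ z)))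
      = fun z => ∏ i, (fun x : ℝ => Real.exp (-c * x ^ 2)) (z i) := by
    ext z
    rw [← Real.exp_sum]; congr 1
    simp [dotProduct, Finset.mul_sum, pow_two]
  rw [h]
  exact Integrable.fintype_prod (f := fun _ : Fin d => fun x : ℝ => Real.exp (-c * x ^ 2))
    (fun _ => integrable_exp_neg_mul_sq hc)

lemma lintegral_gauss {d : ℕ} : ∫⁻ z, ENNReal.ofReal (gaussPDF d z) = 1 := by
  have h : gaussPDF d = fun z : Fin d → ℝ =>
      ∏ i, (fun x : ℝ => (2 * π) ^ (-(1 : ℝ) / 2) * Real.exp (-(1 / 2) * x ^ 2)) (z i) := by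
    ext z
    rw [Finset.prod_mul_distrib, ← Real.exp_sum, gaussPDF]
    congr 1
    · rw [Finset.prod_const, Finset.card_univ, Fintype.card_fin, ← Real.rpow_natCast,
        ← Real.rpow_mul (by positivity)]
      congr 1; ring
    · congr 1
      rw [← Finset.mul_sum]; ring
  have hi : Integrable (gaussPDF d) := by
    have := (integrable_exp_dot (d := d) (c := 1 / 2) (by norm_num)).const_mul
      ((2 * π) ^ (-(d : ℝ) / 2))
    convert this using 2 with z
    rw [gaussPDF_eq]; congr 2; ring
  rw [← ofReal_integral_eq_lintegral_ofReal hi (Filter.Eventually.of_forall fun z => (gauss_pos z).le)]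
  rw [h, integral_fintype_prod_volume_eq_pow
    (fun x : ℝ => (2 * π) ^ (-(1 : ℝ) / 2) * Real.exp (-(1 / 2) * x ^ 2))]
  rw [integral_const_mul, integral_gaussian]
  have : (2 * π) ^ (-(1 : ℝ) / 2) * √(π / (1 / 2)) = 1 := by
    rw [Real.sqrt_eq_rpow, show π / (1 / 2) = 2 * π by ring, ← Real.rpow_add (by positivity)]
    norm_num
  rw [this]; simp

/-- polynomial-times-gaussian is integrable -/
lemma abs_dot_le {d : ℕ} (u z : Fin d → ℝ) : |u ⬝ᵥ z| ≤ (u ⬝ᵥ u + 1) * (1 + z ⬝ᵥ z) := by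
  have h0 : ∀ y : Fin d → ℝ, 0 ≤ y ⬝ᵥ y := fun y => by
    simp only [dotProduct]; exact Finset.sum_nonneg fun i _ => mul_self_nonneg _
  have h1 := h0 (u + z)
  have h2 := h0 (u - z)
  simp [dotProduct_add, add_dotProduct, dotProduct_sub, sub_dotProduct, dotProduct_comm z u] at h1 h2
  have := h0 u
  have := h0 z
  rw [abs_le]; constructor <;> nlinarith [mul_nonneg (h0 u) (h0 z)]

lemma integrable_of_poly {d : ℕ} {f : (Fin d → ℝ) → ℝ} (hf : Continuous f) (C : ℝ)
    (h : ∀ z, |f z| ≤ C * (1 + z ⬝ᵥ z) ^ 3 * gaussPDF d z) : Integrable f := by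
  have h0 : ∀ y : Fin d → ℝ, 0 ≤ y ⬝ᵥ y := fun y => by
    simp only [dotProduct]; exact Finset.sum_nonneg fun i _ => mul_self_nonneg _
  have hC : 0 ≤ C := by
    have := (abs_nonneg _).trans (h 0)
    have h2 := gauss_pos (0 : Fin d → ℝ)
    simp at this
    exact nonneg_of_mul_nonneg_left this h2
  refine ((integrable_exp_dot (d := d) (c := 1 / 4) (by norm_num)).const_mul
    (C * 12 ^ 3 * (2 * π) ^ (-(d : ℝ) / 2))).mono' hf.aestronglyMeasurable
    (Filter.Eventually.of_forall fun z => ?_)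
  refine (h z).trans ?_
  rw [gaussPDF_eq]
  have h1 : (1 + z ⬝ᵥ z) ≤ 12 * Real.exp (z ⬝ᵥ z / 12) := by
    have := Real.add_one_le_exp (z ⬝ᵥ z / 12)
    linarith [h0 z]
  have h2 : (1 + z ⬝ᵥ z) ^ 3 ≤ 12 ^ 3 * Real.exp (z ⬝ᵥ z / 4) := by
    calc (1 + z ⬝ᵥ z) ^ 3 ≤ (12 * Real.exp (z ⬝ᵥ z / 12)) ^ 3 :=
          pow_le_pow_left₀ (by linarith [h0 z]) h1 3
      _ = 12 ^ 3 * Real.exp (z ⬝ᵥ z / 4) := by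
          rw [mul_pow, ← Real.exp_nat_mul]; congr 2; push_cast; ring
  calc C * (1 + z ⬝ᵥ z) ^ 3 * ((2 * π) ^ (-(d : ℝ) / 2) * Real.exp (-(z ⬝ᵥ z) / 2))
      ≤ C * (12 ^ 3 * Real.exp (z ⬝ᵥ z / 4)) *
        ((2 * π) ^ (-(d : ℝ) / 2) * Real.exp (-(z ⬝ᵥ z) / 2)) := by gcongr
    _ = C * 12 ^ 3 * (2 * π) ^ (-(d : ℝ) / 2) *
        (Real.exp (z ⬝ᵥ z / 4) * Real.exp (-(z ⬝ᵥ z) / 2)) := by ring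
    _ = _ := by rw [← Real.exp_add]; congr 2; ring

lemma integrable_gauss {d : ℕ} : Integrable (gaussPDF d) := by
  refine integrable_of_poly continuous_gauss 1 fun z => ?_
  rw [abs_of_pos (gauss_pos z)]
  have h0 : 0 ≤ z ⬝ᵥ z := by
    simp only [dotProduct]; exact Finset.sum_nonneg fun i _ => mul_self_nonneg _
  have : 1 ≤ (1 + z ⬝ᵥ z) ^ 3 := one_le_pow₀ (by linarith)
  nlinarith [gauss_pos z]

lemma integrable_D1 {d : ℕ} (u : Fin d → ℝ) : Integrable (D1 u) := by
  refine integrable_of_poly (continuous_D1 u) (u ⬝ᵥ u + 1) fun z => ?_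
  unfold D1
  have h0 : 0 ≤ z ⬝ᵥ z := by
    simp only [dotProduct]; exact Finset.sum_nonneg fun i _ => mul_self_nonneg _
  have h1 : 0 ≤ u ⬝ᵥ u := by
    simp only [dotProduct]; exact Finset.sum_nonneg fun i _ => mul_self_nonneg _
  rw [abs_mul, abs_neg, abs_of_pos (gauss_pos z)]
  gcongr
  · exact (gauss_pos z).le
  · refine (abs_dot_le u z).trans ?_
    gcongr
    exact le_self_pow₀ (by linarith) (by norm_num)

lemma integrable_D2 {d : ℕ} (u w : Fin d → ℝ) : Integrable (D2 u w) := by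
  refine integrable_of_poly (continuous_D2 u w) ((u ⬝ᵥ u + 1) * (w ⬝ᵥ w + 1) + |u ⬝ᵥ w|)
    fun z => ?_
  unfold D2
  have h0 : 0 ≤ z ⬝ᵥ z := by
    simp only [dotProduct]; exact Finset.sum_nonneg fun i _ => mul_self_nonneg _
  have h1 : 0 ≤ u ⬝ᵥ u := by
    simp only [dotProduct]; exact Finset.sum_nonneg fun i _ => mul_self_nonneg _
  have h2 : 0 ≤ w ⬝ᵥ w := by
    simp only [dotProduct]; exact Finset.sum_nonneg fun i _ => mul_self_nonneg _
  rw [abs_mul, abs_of_pos (gauss_pos z)]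
  gcongr
  · exact (gauss_pos z).le
  · refine (abs_sub _ _).trans ?_
    rw [abs_mul, add_mul]
    have e1 : (1 + z ⬝ᵥ z) ^ 2 ≤ (1 + z ⬝ᵥ z) ^ 3 :=
      pow_le_pow_right₀ (by linarith) (by norm_num)
    have e2 : 1 ≤ (1 + z ⬝ᵥ z) ^ 3 := one_le_pow₀ (by linarith)
    refine add_le_add ?_ (le_mul_of_one_le_right (abs_nonneg _) e2)
    calc |u ⬝ᵥ z| * |w ⬝ᵥ z| ≤ ((u ⬝ᵥ u + 1) * (1 + z ⬝ᵥ z)) * ((w ⬝ᵥ w + 1) * (1 + z ⬝ᵥ z)) := by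
          gcongr <;> exact abs_dot_le _ _
      _ = (u ⬝ᵥ u + 1) * (w ⬝ᵥ w + 1) * (1 + z ⬝ᵥ z) ^ 2 := by ring
      _ ≤ _ := by gcongr

lemma integrable_D3 {d : ℕ} (u w y : Fin d → ℝ) : Integrable (D3 u w y) := by
  refine integrable_of_poly (continuous_D3 u w y) ((u ⬝ᵥ u + 1) * (w ⬝ᵥ w + 1) * (y ⬝ᵥ y + 1)
    + |u ⬝ᵥ w| * (y ⬝ᵥ y + 1) + |u ⬝ᵥ y| * (w ⬝ᵥ w + 1) + |w ⬝ᵥ y| * (u ⬝ᵥ u + 1))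
    fun z => ?_
  unfold D3
  have h0 : 0 ≤ z ⬝ᵥ z := by
    simp only [dotProduct]; exact Finset.sum_nonneg fun i _ => mul_self_nonneg _
  have h1 : 0 ≤ u ⬝ᵥ u := by
    simp only [dotProduct]; exact Finset.sum_nonneg fun i _ => mul_self_nonneg _
  have h2 : 0 ≤ w ⬝ᵥ w := by
    simp only [dotProduct]; exact Finset.sum_nonneg fun i _ => mul_self_nonneg _
  have h3 : 0 ≤ y ⬝ᵥ y := by
    simp only [dotProduct]; exact Finset.sum_nonneg fun i _ => mul_self_nonneg _
  rw [abs_mul, abs_of_pos (gauss_pos z)]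
  have e1 : (1 + z ⬝ᵥ z) ≤ (1 + z ⬝ᵥ z) ^ 3 := le_self_pow₀ (by linarith) (by norm_num)
  have key : ∀ p q : Fin d → ℝ, ∀ r : Fin d → ℝ, 
      |(p ⬝ᵥ q) * (r ⬝ᵥ z)| ≤ |p ⬝ᵥ q| * (r ⬝ᵥ r + 1) * (1 + z ⬝ᵥ z) ^ 3 := by
    intro p q r
    have h3 : 0 ≤ r ⬝ᵥ r := by
      simp only [dotProduct]; exact Finset.sum_nonneg fun i _ => mul_self_nonneg _
    rw [abs_mul, mul_assoc]
    gcongr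
    exact (abs_dot_le r z).trans (by gcongr)
  have k0 : |-((u ⬝ᵥ z) * (w ⬝ᵥ z) * (y ⬝ᵥ z))| ≤
      (u ⬝ᵥ u + 1) * (w ⬝ᵥ w + 1) * (y ⬝ᵥ y + 1) * (1 + z ⬝ᵥ z) ^ 3 := by
    rw [abs_neg, abs_mul, abs_mul]
    calc |u ⬝ᵥ z| * |w ⬝ᵥ z| * |y ⬝ᵥ z| ≤ ((u ⬝ᵥ u + 1) * (1 + z ⬝ᵥ z)) *
          ((w ⬝ᵥ w + 1) * (1 + z ⬝ᵥ z)) * ((y ⬝ᵥ y + 1) * (1 + z ⬝ᵥ z)) := by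
          gcongr <;> exact abs_dot_le _ _
      _ = _ := by ring
  gcongr
  · exact (gauss_pos z).le
  · refine (abs_add_le _ _).trans ?_
    rw [add_mul]
    refine add_le_add ?_ (key _ _ _)
    refine (abs_add_le _ _).trans ?_
    rw [add_mul]
    refine add_le_add ?_ (key _ _ _)
    refine (abs_add_le _ _).trans ?_
    rw [add_mul]
    exact add_le_add k0 (key _ _ _)

end GaussPoly
namespace GaussPoly

open ProbabilityTheory Filter Topology
open scoped ENNReal

/-- the quotient of the gaussian density by its marginal is invariant along `e` -/
lemma gauss_shift {d : ℕ} (e y : Fin d → ℝ) (he : e ⬝ᵥ e = 1) (τ : ℝ) :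
    gaussPDF d (y + τ • e) * gaussianPDFReal 0 1 (e ⬝ᵥ y)
      = gaussPDF d y * gaussianPDFReal 0 1 (e ⬝ᵥ (y + τ • e)) := by
  rw [gaussPDF_eq, gaussPDF_eq]
  simp only [gaussianPDFReal]
  simp only [dotProduct_add, add_dotProduct, dotProduct_smul, smul_dotProduct,
    dotProduct_comm y e, he, smul_eq_mul, sub_zero, NNReal.coe_one, mul_one]
  have : Real.exp (-(y ⬝ᵥ y + τ * e ⬝ᵥ y + τ * (e ⬝ᵥ y + τ)) / 2)
      * Real.exp (-(e ⬝ᵥ y) ^ 2 / 2)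
      = Real.exp (-(y ⬝ᵥ y) / 2) * Real.exp (-(e ⬝ᵥ y + τ) ^ 2 / 2) := by
    rw [← Real.exp_add, ← Real.exp_add]; congr 1; ring
  linear_combination ((2 * π) ^ (-(d : ℝ) / 2) * (√(2 * π))⁻¹) * this

lemma peel {d : ℕ} (m e : Fin d → ℝ) (he : e ⬝ᵥ e = 1) (k q H : (Fin d → ℝ) → ℝ≥0∞)
    (hk : Measurable k) (hHm : Measurable H)
    (hH : ∀ z (τ : ℝ), H (z + τ • e) = H z) (M : ℝ≥0∞) (hM : M ≠ ∞)
    (hk1 : ∀ z, ∫⁻ τ : ℝ, k (z + τ • e) ≤ 1)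
    (hq : ∀ z, q z * ENNReal.ofReal (gaussianPDFReal 0 1 (e ⬝ᵥ (z - m))) ≤ M) :
    ∫⁻ z, (k z * q z) * H z * ENNReal.ofReal (gaussPDF d (z - m)) ≤
      M * ∫⁻ z, H z * ENNReal.ofReal (gaussPDF d (z - m)) := by
  have p1pos : ∀ t, 0 < gaussianPDFReal 0 1 t := fun t => gaussianPDFReal_pos 0 1 t (by simp)
  set X : (Fin d → ℝ) → ℝ := fun z => gaussPDF d (z - m) / gaussianPDFReal 0 1 (e ⬝ᵥ (z - m))
    with hX
  have hXm : Measurable X := by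
    have h1 : Measurable fun z : Fin d → ℝ => gaussPDF d (z - m) :=
      (continuous_gauss.comp (by fun_prop : Continuous fun z : Fin d → ℝ => z - m)).measurable
    have h2 : Measurable fun z : Fin d → ℝ => e ⬝ᵥ (z - m) :=
      ((continuous_dot e).comp (by fun_prop : Continuous fun z : Fin d → ℝ => z - m)).measurable
    exact h1.div ((measurable_gaussianPDFReal 0 1).comp h2)
  have hX0 : ∀ z, 0 ≤ X z := fun z => div_nonneg (gauss_pos _).le (p1pos _).le
  have hXinv : ∀ z (τ : ℝ), X (z + τ • e) = X z := by
    intro z τ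
    simp only [hX]
    rw [div_eq_div_iff (p1pos _).ne' (p1pos _).ne']
    have := gauss_shift e (z - m) he τ
    rw [show z + τ • e - m = z - m + τ • e by abel]
    exact this
  have hfac : ∀ z, ENNReal.ofReal (gaussPDF d (z - m)) =
      ENNReal.ofReal (gaussianPDFReal 0 1 (e ⬝ᵥ (z - m))) * ENNReal.ofReal (X z) := by
    intro z
    rw [← ENNReal.ofReal_mul (p1pos _).le, hX]
    congr 1
    exact (mul_div_cancel₀ _ (p1pos (e ⬝ᵥ (z - m))).ne').symm
  have step1 : ∫⁻ z, (k z * q z) * H z * ENNReal.ofReal (gaussPDF d (z - m)) ≤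
      M * ∫⁻ z, k z * H z * ENNReal.ofReal (X z) := by
    rw [← lintegral_const_mul' _ _ hM]
    refine lintegral_mono fun z => ?_
    rw [hfac]
    calc k z * q z * H z * (ENNReal.ofReal (gaussianPDFReal 0 1 (e ⬝ᵥ (z - m)))
          * ENNReal.ofReal (X z))
        = (q z * ENNReal.ofReal (gaussianPDFReal 0 1 (e ⬝ᵥ (z - m)))) *
          (k z * H z * ENNReal.ofReal (X z)) := by ring
      _ ≤ _ := by gcongr; exact hq z
  refine step1.trans (mul_le_mul_right ?_ M)
  have hpm : Measurable fun p : (Fin d → ℝ) × ℝ =>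
      ENNReal.ofReal (gaussianPDFReal 0 1 (e ⬝ᵥ (p.1 - m) - p.2)) := by
    refine ENNReal.measurable_ofReal.comp ((measurable_gaussianPDFReal 0 1).comp ?_)
    have : Continuous fun p : (Fin d → ℝ) × ℝ => e ⬝ᵥ (p.1 - m) - p.2 :=
      ((continuous_dot e).comp (by fun_prop : Continuous fun p : (Fin d → ℝ) × ℝ => p.1 - m)).sub
        continuous_snd
    exact this.measurable
  have hp1m : Measurable fun z : Fin d → ℝ =>
      ENNReal.ofReal (gaussianPDFReal 0 1 (e ⬝ᵥ (z - m))) := by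
    have := hpm.comp (measurable_id.prodMk (measurable_const (a := (0 : ℝ))))
    simpa [Function.comp_def] using this
  have hXo : Measurable fun z => ENNReal.ofReal (X z) := ENNReal.measurable_ofReal.comp hXm
  have mass : ∀ c : ℝ, ∫⁻ τ : ℝ, ENNReal.ofReal (gaussianPDFReal 0 1 (c - τ)) = 1 := by
    intro c
    rw [lintegral_sub_left_eq_self (fun t => ENNReal.ofReal (gaussianPDFReal 0 1 t)) c]
    exact lintegral_gaussianPDFReal_eq_one 0 (by simp)
  have hpz : ∀ z : Fin d → ℝ, Measurable fun τ : ℝ =>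
      ENNReal.ofReal (gaussianPDFReal 0 1 (e ⬝ᵥ (z - m) - τ)) := fun z =>
    ENNReal.measurable_ofReal.comp ((measurable_gaussianPDFReal 0 1).comp
      (measurable_const.sub measurable_id))
  have hadd : Measurable fun p : (Fin d → ℝ) × ℝ => p.1 + p.2 • e := by
    have : Continuous fun p : (Fin d → ℝ) × ℝ => p.1 + p.2 • e := by fun_prop
    exact this.measurable
  calc ∫⁻ z, k z * H z * ENNReal.ofReal (X z)
      = ∫⁻ z, ∫⁻ τ : ℝ, (k z * H z * ENNReal.ofReal (X z)) *
          ENNReal.ofReal (gaussianPDFReal 0 1 (e ⬝ᵥ (z - m) - τ)) := by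
        refine lintegral_congr fun z => ?_
        rw [lintegral_const_mul _ (hpz z), mass, mul_one]
    _ = ∫⁻ τ : ℝ, ∫⁻ z, (k z * H z * ENNReal.ofReal (X z)) *
          ENNReal.ofReal (gaussianPDFReal 0 1 (e ⬝ᵥ (z - m) - τ)) := by
        refine lintegral_lintegral_swap ?_
        refine Measurable.aemeasurable ?_
        exact (((hk.mul hHm).mul hXo).comp measurable_fst).mul hpm
    _ = ∫⁻ τ : ℝ, ∫⁻ z, (k (z + τ • e) * H z * ENNReal.ofReal (X z)) *
          ENNReal.ofReal (gaussianPDFReal 0 1 (e ⬝ᵥ (z - m))) := by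
        refine lintegral_congr fun τ => ?_
        rw [← lintegral_add_right_eq_self _ (τ • e)]
        refine lintegral_congr fun z => ?_
        rw [hH, hXinv]
        congr 4
        rw [show z + τ • e - m = z - m + τ • e by abel, dotProduct_add, dotProduct_smul, he]
        simp
    _ = ∫⁻ z, ∫⁻ τ : ℝ, (k (z + τ • e) * H z * ENNReal.ofReal (X z)) *
          ENNReal.ofReal (gaussianPDFReal 0 1 (e ⬝ᵥ (z - m))) := by
        refine (lintegral_lintegral_swap ?_).symm
        refine Measurable.aemeasurable ?_
        exact (((hk.comp hadd).mul (hHm.comp measurable_fst)).mul (hXo.comp measurable_fst)).mul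
          (hp1m.comp measurable_fst)
    _ ≤ ∫⁻ z, H z * ENNReal.ofReal (gaussPDF d (z - m)) := by
        refine lintegral_mono fun z => ?_
        have : ∀ τ : ℝ, (k (z + τ • e) * H z * ENNReal.ofReal (X z)) *
            ENNReal.ofReal (gaussianPDFReal 0 1 (e ⬝ᵥ (z - m)))
            = k (z + τ • e) * (H z * ENNReal.ofReal (gaussPDF d (z - m))) := by
          intro τ; rw [hfac]; ring
        simp only [this]
        have hkz : Measurable fun τ : ℝ => k (z + τ • e) := by
          have : Continuous fun τ : ℝ => z + τ • e := by fun_prop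
          exact hk.comp this.measurable
        rw [lintegral_mul_const _ hkz]
        exact mul_le_of_le_one_left zero_le (hk1 z)

lemma lint_deriv_le_one {g : ℝ → ℝ} (hg : ContDiff ℝ 1 g) (ha : Antitone g)
    (h0 : ∀ x, 0 ≤ g x) (h1 : ∀ x, g x ≤ 1) :
    ∫⁻ τ : ℝ, ENNReal.ofReal |deriv g τ| ≤ 1 := by
  have hc : Continuous (deriv g) := hg.continuous_deriv le_rfl
  have hcov : AECover (volume : Measure ℝ) atTop (fun n : ℕ => Set.Ioc (-(n : ℝ)) n) :=
    aecover_Ioc (tendsto_neg_atTop_atBot.comp tendsto_natCast_atTop_atTop)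
      tendsto_natCast_atTop_atTop
  have ht := hcov.lintegral_tendsto_of_nat (f := fun τ => ENNReal.ofReal |deriv g τ|)
    (ENNReal.measurable_ofReal.comp hc.abs.measurable).aemeasurable
  refine le_of_tendsto' ht fun n => ?_
  have hn : (-(n : ℝ)) ≤ n := by
    have : (0 : ℝ) ≤ n := Nat.cast_nonneg n
    linarith
  have hneg : ∀ τ, |deriv g τ| = -deriv g τ := fun τ => abs_of_nonpos ha.deriv_nonpos
  simp only [hneg]
  have hint : IntervalIntegrable (fun τ => -deriv g τ) volume (-(n : ℝ)) n :=
    hc.neg.intervalIntegrable _ _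
  rw [← ofReal_integral_eq_lintegral_ofReal hint.1
    (Eventually.of_forall fun τ => by simpa using ha.deriv_nonpos)]
  rw [← intervalIntegral.integral_of_le hn, intervalIntegral.integral_neg,
    intervalIntegral.integral_deriv_eq_sub (fun x _ => (hg.differentiable (by simp)) x)
      (hc.intervalIntegrable _ _)]
  rw [← ENNReal.ofReal_one]
  refine ENNReal.ofReal_le_ofReal ?_
  linarith [h0 n, h1 (-(n : ℝ))]

/-- a decreasing smooth cutoff -/
structure Cut (f : ℝ → ℝ) : Prop where
  smooth : ContDiff ℝ 1 f
  anti : Antitone f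
  nonneg : ∀ x, 0 ≤ f x
  le_one : ∀ x, f x ≤ 1

lemma Cut.kernel {d : ℕ} {f : ℝ → ℝ} (hf : Cut f) (v e : Fin d → ℝ) (hr : 0 ≤ v ⬝ᵥ e)
    (z : Fin d → ℝ) :
    ∫⁻ τ : ℝ, ENNReal.ofReal ((v ⬝ᵥ e) * |deriv f (v ⬝ᵥ (z + τ • e))|) ≤ 1 := by
  have hg : ContDiff ℝ 1 (fun τ : ℝ => f (v ⬝ᵥ z + τ * (v ⬝ᵥ e))) :=
    hf.smooth.comp (by fun_prop)
  have h := lint_deriv_le_one hg (fun a b hab => hf.anti (by gcongr))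
    (fun _ => hf.nonneg _) (fun _ => hf.le_one _)
  refine le_trans (le_of_eq ?_) h
  refine lintegral_congr fun τ => ?_
  congr 1
  have hd : HasDerivAt f (deriv f (v ⬝ᵥ z + τ * (v ⬝ᵥ e))) (v ⬝ᵥ z + τ * (v ⬝ᵥ e)) :=
    ((hf.smooth.differentiable (by simp)) _).hasDerivAt
  have := hd.comp τ (((hasDerivAt_id τ).mul_const (v ⬝ᵥ e)).const_add (v ⬝ᵥ z))
  have h2 : deriv (fun τ : ℝ => f (v ⬝ᵥ z + τ * (v ⬝ᵥ e))) τ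
      = deriv f (v ⬝ᵥ z + τ * (v ⬝ᵥ e)) * (1 * v ⬝ᵥ e) := this.deriv
  rw [h2, dotProduct_add, dotProduct_smul, smul_eq_mul, abs_mul, one_mul, abs_of_nonneg hr,
    mul_comm]

lemma weight_bound {κ a t : ℝ} (ha : |a| ≤ κ) :
    ENNReal.ofReal (1 + t ^ 2) * ENNReal.ofReal (gaussianPDFReal 0 1 (t - a))
      ≤ ENNReal.ofReal (5 * (1 + κ ^ 2)) := by
  rw [← ENNReal.ofReal_mul (by positivity)]
  refine ENNReal.ofReal_le_ofReal ?_
  have hp : gaussianPDFReal 0 1 (t - a) ≤ Real.exp (-(t - a) ^ 2 / 2) := by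
    simp only [gaussianPDFReal, sub_zero, NNReal.coe_one, mul_one]
    refine mul_le_of_le_one_left (Real.exp_pos _).le ?_
    refine inv_le_one_of_one_le₀ ?_
    rw [Real.one_le_sqrt]
    nlinarith [Real.pi_gt_three]
  have ha2 : a ^ 2 ≤ κ ^ 2 := sq_le_sq' (by linarith [neg_abs_le a]) ((le_abs_self a).trans ha)
  have h1 : 1 + t ^ 2 ≤ 1 + 2 * κ ^ 2 + 2 * (t - a) ^ 2 := by nlinarith [sq_nonneg (t - 2 * a)]
  have h2 : 1 + (t - a) ^ 2 / 2 ≤ Real.exp ((t - a) ^ 2 / 2) := by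
    linarith [Real.add_one_le_exp ((t - a) ^ 2 / 2)]
  have h3 : Real.exp (-(t - a) ^ 2 / 2) * Real.exp ((t - a) ^ 2 / 2) = 1 := by
    rw [← Real.exp_add]; ring_nf; simp
  calc (1 + t ^ 2) * gaussianPDFReal 0 1 (t - a)
      ≤ (1 + 2 * κ ^ 2 + 2 * (t - a) ^ 2) * Real.exp (-(t - a) ^ 2 / 2) := by
        gcongr
        exact gaussianPDFReal_nonneg _ _ _
    _ ≤ (5 * (1 + κ ^ 2) * Real.exp ((t - a) ^ 2 / 2)) * Real.exp (-(t - a) ^ 2 / 2) := by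
        gcongr
        nlinarith [sq_nonneg κ, sq_nonneg (t - a), mul_nonneg (sq_nonneg κ) (sq_nonneg (t - a))]
    _ = 5 * (1 + κ ^ 2) := by rw [mul_assoc, mul_comm (Real.exp _), h3, mul_one]

lemma dot_self_nonneg {d : ℕ} (y : Fin d → ℝ) : 0 ≤ y ⬝ᵥ y := by
  simp only [dotProduct]; exact Finset.sum_nonneg fun i _ => mul_self_nonneg _

lemma abs_dot_unit {d : ℕ} {e w : Fin d → ℝ} (he : e ⬝ᵥ e = 1) (hw : w ⬝ᵥ w = 1) :
    |e ⬝ᵥ w| ≤ 1 := by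
  have h1 := dot_self_nonneg (e + w)
  have h2 := dot_self_nonneg (e - w)
  simp [dotProduct_add, add_dotProduct, dotProduct_sub, sub_dotProduct, dotProduct_comm w e,
    he, hw] at h1 h2
  rw [abs_le]; constructor <;> linarith

/-- one factor of the bounding density -/
noncomputable def fac {d : ℕ} (f : ℝ → ℝ) (v e z : Fin d → ℝ) : ℝ :=
  ((v ⬝ᵥ e) * |deriv f (v ⬝ᵥ z)|) * (1 + (e ⬝ᵥ z) ^ 2)

lemma fac_nonneg {d : ℕ} (f : ℝ → ℝ) {v e : Fin d → ℝ} (h : 0 ≤ v ⬝ᵥ e) (z : Fin d → ℝ) :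
    0 ≤ fac f v e z := by unfold fac; positivity

lemma fac_cont {d : ℕ} {f : ℝ → ℝ} (hf : Cut f) (v e : Fin d → ℝ) :
    Continuous (fac f v e) := by
  have : Continuous (deriv f) := hf.smooth.continuous_deriv le_rfl
  unfold fac; fun_prop

lemma fac_inv {d : ℕ} (f : ℝ → ℝ) {v e e' : Fin d → ℝ} (h1 : v ⬝ᵥ e' = 0) (h2 : e ⬝ᵥ e' = 0)
    (z : Fin d → ℝ) (τ : ℝ) : fac f v e (z + τ • e') = fac f v e z := by
  simp [fac, dotProduct_add, dotProduct_smul, h1, h2]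

lemma peel_fac {d : ℕ} {κ : ℝ} (hκ : 0 ≤ κ) {w : Fin d → ℝ} (hw : w ⬝ᵥ w = 1) {f : ℝ → ℝ}
    (hf : Cut f) (v e : Fin d → ℝ) (hr : 0 ≤ v ⬝ᵥ e) (he : e ⬝ᵥ e = 1)
    (H : (Fin d → ℝ) → ℝ) (hH : Continuous H) (hinv : ∀ z (τ : ℝ), H (z + τ • e) = H z) :
    ∫⁻ z, ENNReal.ofReal (fac f v e z * H z) * ENNReal.ofReal (gaussPDF d (z - κ • w)) ≤
      ENNReal.ofReal (5 * (1 + κ ^ 2)) *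
      ∫⁻ z, ENNReal.ofReal (H z) * ENNReal.ofReal (gaussPDF d (z - κ • w)) := by
  have hc : Continuous (deriv f) := hf.smooth.continuous_deriv le_rfl
  have hkc : Continuous fun z : Fin d → ℝ => (v ⬝ᵥ e) * |deriv f (v ⬝ᵥ z)| := by fun_prop
  have := peel (κ • w) e he (fun z => ENNReal.ofReal ((v ⬝ᵥ e) * |deriv f (v ⬝ᵥ z)|))
    (fun z => ENNReal.ofReal (1 + (e ⬝ᵥ z) ^ 2)) (fun z => ENNReal.ofReal (H z))
    (ENNReal.measurable_ofReal.comp hkc.measurable)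
    (ENNReal.measurable_ofReal.comp hH.measurable) (fun z τ => by simp only [hinv])
    (ENNReal.ofReal (5 * (1 + κ ^ 2))) ENNReal.ofReal_ne_top
    (fun z => hf.kernel v e hr z) (fun z => by
      rw [dotProduct_sub, dotProduct_smul]
      refine weight_bound ?_
      rw [smul_eq_mul, abs_mul, abs_of_nonneg hκ]
      exact mul_le_of_le_one_right hκ (abs_dot_unit he hw))
  refine le_trans (le_of_eq ?_) this
  refine lintegral_congr fun z => ?_
  rw [← ENNReal.ofReal_mul (by positivity : 0 ≤ (v ⬝ᵥ e) * |deriv f (v ⬝ᵥ z)|),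
    ENNReal.ofReal_mul (fac_nonneg f hr z)]
  rfl

lemma T1 {d : ℕ} {κ : ℝ} (hκ : 0 ≤ κ) {w : Fin d → ℝ} (hw : w ⬝ᵥ w = 1) {f1 : ℝ → ℝ}
    (hf1 : Cut f1) {e1 : Fin d → ℝ} (h11 : e1 ⬝ᵥ e1 = 1) :
    ∫⁻ z, ENNReal.ofReal (fac f1 e1 e1 z) * ENNReal.ofReal (gaussPDF d (z - κ • w)) ≤
      ENNReal.ofReal (5 * (1 + κ ^ 2)) := by
  have := peel_fac hκ hw hf1 e1 e1 (by rw [h11]; norm_num) h11 (fun _ => 1) continuous_const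
    (fun _ _ => rfl)
  simp only [mul_one, ENNReal.ofReal_one, one_mul] at this
  rw [lintegral_sub_right_eq_self (fun z => ENNReal.ofReal (gaussPDF d z)), lintegral_gauss,
    mul_one] at this
  exact this

lemma T2 {d : ℕ} {κ : ℝ} (hκ : 0 ≤ κ) {w : Fin d → ℝ} (hw : w ⬝ᵥ w = 1) {f1 f2 : ℝ → ℝ}
    (hf1 : Cut f1) (hf2 : Cut f2) {e1 v2 e2 : Fin d → ℝ} (h11 : e1 ⬝ᵥ e1 = 1)
    (h22 : e2 ⬝ᵥ e2 = 1) (h12 : e1 ⬝ᵥ e2 = 0) (hr : 0 ≤ v2 ⬝ᵥ e2) :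
    ∫⁻ z, ENNReal.ofReal (fac f2 v2 e2 z * fac f1 e1 e1 z) *
      ENNReal.ofReal (gaussPDF d (z - κ • w)) ≤
      ENNReal.ofReal (5 * (1 + κ ^ 2)) ^ 2 := by
  refine (peel_fac hκ hw hf2 v2 e2 hr h22 (fac f1 e1 e1) (fac_cont hf1 _ _)
    (fun z τ => fac_inv _ h12 h12 z τ)).trans ?_
  rw [pow_two (ENNReal.ofReal _)]
  exact mul_le_mul_right (T1 hκ hw hf1 h11) _

lemma T3 {d : ℕ} {κ : ℝ} (hκ : 0 ≤ κ) {w : Fin d → ℝ} (hw : w ⬝ᵥ w = 1) {f1 f2 f3 : ℝ → ℝ}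
    (hf1 : Cut f1) (hf2 : Cut f2) (hf3 : Cut f3) {e1 v2 e2 v3 e3 : Fin d → ℝ}
    (h11 : e1 ⬝ᵥ e1 = 1)
    (h22 : e2 ⬝ᵥ e2 = 1) (h33 : e3 ⬝ᵥ e3 = 1) (h12 : e1 ⬝ᵥ e2 = 0) (h13 : e1 ⬝ᵥ e3 = 0)
    (h23 : e2 ⬝ᵥ e3 = 0) (hv : v2 ⬝ᵥ e3 = 0) (hr : 0 ≤ v2 ⬝ᵥ e2) (hr3 : 0 ≤ v3 ⬝ᵥ e3) :
    ∫⁻ z, ENNReal.ofReal (fac f3 v3 e3 z * (fac f2 v2 e2 z * fac f1 e1 e1 z)) *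
      ENNReal.ofReal (gaussPDF d (z - κ • w)) ≤
      ENNReal.ofReal (5 * (1 + κ ^ 2)) ^ 3 := by
  refine (peel_fac hκ hw hf3 v3 e3 hr3 h33 (fun z => fac f2 v2 e2 z * fac f1 e1 e1 z)
    ((fac_cont hf2 _ _).mul (fac_cont hf1 _ _))
    (fun z τ => by rw [fac_inv _ h13 h13 z τ, fac_inv _ hv h23 z τ])).trans ?_
  rw [pow_succ' (ENNReal.ofReal _)]
  exact mul_le_mul_right (T2 hκ hw hf1 hf2 h11 h22 h12 hr) _

lemma gauss_tilt {d : ℕ} {κ : ℝ} (hκ : 0 ≤ κ) {w z : Fin d → ℝ} (hw : w ⬝ᵥ w = 1)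
    (h : κ ≤ w ⬝ᵥ z) :
    gaussPDF d z ≤ Real.exp (-κ ^ 2 / 2) * gaussPDF d (z - κ • w) := by
  rw [gaussPDF_eq, gaussPDF_eq]
  rw [mul_left_comm, ← Real.exp_add]
  gcongr
  simp only [dotProduct_sub, sub_dotProduct, dotProduct_smul, smul_dotProduct,
    dotProduct_comm z w, hw, smul_eq_mul]
  nlinarith

lemma final_int {d : ℕ} {κ : ℝ} (hκ : 0 ≤ κ) {w : Fin d → ℝ} (hw : w ⬝ᵥ w = 1)
    (F R : (Fin d → ℝ) → ℝ) (hR : ∀ z, 0 ≤ R z) (n : ℕ) (hn : n ≤ 3)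
    (hsupp : ∀ z, F z ≠ 0 → κ ≤ w ⬝ᵥ z) (hF : ∀ z, |F z| ≤ R z * gaussPDF d z)
    (hI : ∫⁻ z, ENNReal.ofReal (R z) * ENNReal.ofReal (gaussPDF d (z - κ • w)) ≤
      ENNReal.ofReal (5 * (1 + κ ^ 2)) ^ n) :
    |∫ z, F z| ≤ 216000 * Real.exp (-κ ^ 2 / 4) := by
  have h1 : ‖∫ z, F z‖ₑ ≤ ENNReal.ofReal (Real.exp (-κ ^ 2 / 2) * (5 * (1 + κ ^ 2)) ^ n) := by
    refine (enorm_integral_le_lintegral_enorm _).trans ?_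
    rw [ENNReal.ofReal_mul (Real.exp_pos _).le, ENNReal.ofReal_pow (by positivity)]
    refine le_trans ?_ (mul_le_mul_right hI _)
    rw [← lintegral_const_mul' _ _ ENNReal.ofReal_ne_top]
    refine lintegral_mono fun z => ?_
    simp only
    rw [← ENNReal.ofReal_mul (hR z), ← ENNReal.ofReal_mul (Real.exp_pos _).le,
      Real.enorm_eq_ofReal_abs]
    refine ENNReal.ofReal_le_ofReal ?_
    by_cases hz : F z = 0
    · rw [hz, abs_zero]
      have := hR z
      have := gauss_pos (z - κ • w)
      positivity
    · refine (hF z).trans ?_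
      calc R z * gaussPDF d z ≤ R z * (Real.exp (-κ ^ 2 / 2) * gaussPDF d (z - κ • w)) :=
            mul_le_mul_of_nonneg_left (gauss_tilt hκ hw (hsupp z hz)) (hR z)
        _ = _ := by ring
  rw [Real.enorm_eq_ofReal_abs, ENNReal.ofReal_le_ofReal_iff (by positivity)] at h1
  refine h1.trans ?_
  have h2 : (5 * (1 + κ ^ 2)) ^ n ≤ (5 * (1 + κ ^ 2)) ^ 3 :=
    pow_le_pow_right₀ (by nlinarith [sq_nonneg κ]) hn
  have h3 : 5 * (1 + κ ^ 2) ≤ 60 * Real.exp (κ ^ 2 / 12) := by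
    linarith [Real.add_one_le_exp (κ ^ 2 / 12)]
  have h4 : (5 * (1 + κ ^ 2)) ^ 3 ≤ 216000 * Real.exp (κ ^ 2 / 4) := by
    calc (5 * (1 + κ ^ 2)) ^ 3 ≤ (60 * Real.exp (κ ^ 2 / 12)) ^ 3 :=
          pow_le_pow_left₀ (by positivity) h3 3
      _ = 216000 * Real.exp (κ ^ 2 / 4) := by
          rw [mul_pow, ← Real.exp_nat_mul]
          norm_num
          ring
  calc Real.exp (-κ ^ 2 / 2) * (5 * (1 + κ ^ 2)) ^ n
      ≤ Real.exp (-κ ^ 2 / 2) * (216000 * Real.exp (κ ^ 2 / 4)) := by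
        gcongr; exact h2.trans h4
    _ = 216000 * (Real.exp (-κ ^ 2 / 2) * Real.exp (κ ^ 2 / 4)) := by ring
    _ = _ := by rw [← Real.exp_add]; congr 2; ring

end GaussPoly
namespace GaussPoly

open Filter Topology
open scoped ContDiff

/-- smooth bounded functions whose derivative has compact support -/
structure Good (f : ℝ → ℝ) : Prop where
  smooth : ContDiff ℝ ∞ f
  bdd : ∃ C, ∀ x, |f x| ≤ C
  supp : HasCompactSupport (deriv f)

lemma Good.deriv {f : ℝ → ℝ} (hf : Good f) : Good (deriv f) := by
  have hs : ContDiff ℝ ∞ (_root_.deriv f) := by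
    have := hf.smooth
    rw [show (∞ : WithTop ℕ∞) = ∞ + 1 by rfl, contDiff_succ_iff_deriv] at this
    exact this.2.2
  refine ⟨hs, ?_, hf.supp.deriv⟩
  obtain ⟨C, hC⟩ := hf.supp.exists_bound_of_continuous hs.continuous
  exact ⟨C, hC⟩

/-- the product of functions of the `v i ⬝ᵥ z` -/
noncomputable def PP {d : ℕ} (v : Fin d → Fin d → ℝ) (f : Fin d → ℝ → ℝ) (z : Fin d → ℝ) : ℝ :=
  ∏ i, f i (v i ⬝ᵥ z)

/-- differentiate the `k`-th function -/
noncomputable def dsub {d : ℕ} (f : Fin d → ℝ → ℝ) (k : Fin d) : Fin d → ℝ → ℝ :=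
  Function.update f k (deriv (f k))

lemma Good.dsub {d : ℕ} {f : Fin d → ℝ → ℝ} (hf : ∀ i, Good (f i)) (k : Fin d) :
    ∀ i, Good (dsub f k i) := by
  intro i
  unfold GaussPoly.dsub
  by_cases h : i = k
  · subst h; simpa using (hf i).deriv
  · simpa [Function.update_of_ne h] using hf i

lemma PP_cont {d : ℕ} (v : Fin d → Fin d → ℝ) {f : Fin d → ℝ → ℝ} (hf : ∀ i, Good (f i)) :
    Continuous (PP v f) := by
  unfold PP
  exact continuous_finsetProd _ fun i _ => (hf i).smooth.continuous.comp (continuous_dot _)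

lemma PP_bdd {d : ℕ} (v : Fin d → Fin d → ℝ) {f : Fin d → ℝ → ℝ} (hf : ∀ i, Good (f i)) :
    ∃ C, ∀ z, |PP v f z| ≤ C := by
  choose C hC using fun i => (hf i).bdd
  refine ⟨∏ i, C i, fun z => ?_⟩
  rw [PP, Finset.abs_prod]
  exact Finset.prod_le_prod (fun i _ => abs_nonneg _) fun i _ => hC i _

lemma PP_integrable {d : ℕ} (v : Fin d → Fin d → ℝ) {f : Fin d → ℝ → ℝ} (hf : ∀ i, Good (f i))
    {g : (Fin d → ℝ) → ℝ} (hg : Integrable g) : Integrable fun z => PP v f z * g z := by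
  obtain ⟨C, hC⟩ := PP_bdd v hf
  exact hg.bdd_mul (c := C) (PP_cont v hf).aestronglyMeasurable (Eventually.of_forall hC)

lemma PP_line {d : ℕ} (v : Fin d → Fin d → ℝ) {f : Fin d → ℝ → ℝ} (hf : ∀ i, Good (f i))
    (u z : Fin d → ℝ) :
    HasLineDerivAt ℝ (PP v f) (∑ k, (v k ⬝ᵥ u) * PP v (dsub f k) z) z u := by
  have h1 : ∀ i, HasDerivAt (fun t : ℝ => f i (v i ⬝ᵥ (z + t • u)))
      (deriv (f i) (v i ⬝ᵥ z) * (v i ⬝ᵥ u)) 0 := by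
    intro i
    have hd : HasDerivAt (f i) (deriv (f i) (v i ⬝ᵥ (z + (0 : ℝ) • u)))
        (v i ⬝ᵥ (z + (0 : ℝ) • u)) :=
      (((hf i).smooth.differentiable (by simp)) _).hasDerivAt
    have hl : HasDerivAt (fun t : ℝ => v i ⬝ᵥ (z + t • u)) (v i ⬝ᵥ u) 0 :=
      hasLineDeriv_dot (v i) u z
    have := hd.comp (0 : ℝ) hl
    simpa [Function.comp_def] using this
  have h2 := HasDerivAt.fun_finsetProd (u := Finset.univ) fun i _ => h1 i
  unfold HasLineDerivAt PP
  refine h2.congr_deriv ?_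
  refine Finset.sum_congr rfl fun k _ => ?_
  rw [← Finset.mul_prod_erase _ _ (Finset.mem_univ k)]
  have h3 : ∏ x ∈ Finset.univ.erase k, dsub f k x (v x ⬝ᵥ z)
      = ∏ x ∈ Finset.univ.erase k, f x (v x ⬝ᵥ z) := by
    refine Finset.prod_congr rfl fun x hx => ?_
    rw [dsub, Function.update_of_ne (Finset.ne_of_mem_erase hx)]
  rw [h3]
  simp [dsub]
  ring

lemma ibp {d : ℕ} (v : Fin d → Fin d → ℝ) {f : Fin d → ℝ → ℝ} (hf : ∀ i, Good (f i))
    (u : Fin d → ℝ) {g g' : (Fin d → ℝ) → ℝ} (hg : Integrable g) (hg' : Integrable g')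
    (hl : ∀ z, HasLineDerivAt ℝ g (g' z) z u) :
    ∫ z, PP v f z * g' z = -∑ k, (v k ⬝ᵥ u) * ∫ z, PP v (dsub f k) z * g z := by
  have hi : ∀ k, Integrable fun z => (v k ⬝ᵥ u) * (PP v (dsub f k) z * g z) := fun k =>
    (PP_integrable v (Good.dsub hf k) hg).const_mul _
  have e : ∀ z, (∑ k, (v k ⬝ᵥ u) * PP v (dsub f k) z) * g z
      = ∑ k, (v k ⬝ᵥ u) * (PP v (dsub f k) z * g z) := by
    intro z; rw [Finset.sum_mul]; exact Finset.sum_congr rfl fun k _ => by ring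
  have := integral_bilinear_hasLineDerivAt_right_eq_neg_left_of_integrable (μ := volume)
    (f := PP v f) (f' := fun z => ∑ k, (v k ⬝ᵥ u) * PP v (dsub f k) z) (g := g) (g' := g')
    (v := u) (B := ContinuousLinearMap.mul ℝ ℝ)
    (by
      simp only [ContinuousLinearMap.mul_apply', e]
      exact integrable_finset_sum _ fun k _ => hi k)
    (by simpa using PP_integrable v hf hg') (by simpa using PP_integrable v hf hg)
    (fun x _ => PP_line v hf u x) (fun x _ => hl x)
  simp only [ContinuousLinearMap.mul_apply', e] at this
  rw [this, integral_finset_sum _ fun k _ => hi k]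
  simp only [integral_const_mul]

/-- the smooth cutoff -/
noncomputable def cut (β ε s : ℝ) : ℝ := Real.smoothTransition (1 + (β - s) / ε)

lemma cut_one {β ε s : ℝ} (hε : 0 < ε) (h : s ≤ β) : cut β ε s = 1 := by
  refine Real.smoothTransition.one_of_one_le ?_
  have : 0 ≤ (β - s) / ε := div_nonneg (by linarith) hε.le
  linarith

lemma cut_zero {β ε s : ℝ} (hε : 0 < ε) (h : β + ε ≤ s) : cut β ε s = 0 := by
  refine Real.smoothTransition.zero_of_nonpos ?_
  have : (β - s) / ε ≤ -1 := by rw [div_le_iff₀ hε]; linarith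
  linarith

lemma cut_deriv_lt {β ε s : ℝ} (hε : 0 < ε) (h : s < β) : deriv (cut β ε) s = 0 := by
  have : cut β ε =ᶠ[𝓝 s] fun _ => 1 := by
    filter_upwards [Iio_mem_nhds h] with t ht using cut_one hε (le_of_lt ht)
  rw [this.deriv_eq]; simp

lemma cut_deriv_gt {β ε s : ℝ} (hε : 0 < ε) (h : β + ε < s) : deriv (cut β ε) s = 0 := by
  have : cut β ε =ᶠ[𝓝 s] fun _ => 0 := by
    filter_upwards [Ioi_mem_nhds h] with t ht using cut_zero hε (le_of_lt ht)
  rw [this.deriv_eq]; simp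

lemma cut_smooth (β ε : ℝ) : ContDiff ℝ ∞ (cut β ε) := by
  unfold cut
  exact Real.smoothTransition.contDiff.comp (by fun_prop)

lemma cut_Cut {β ε : ℝ} (hε : 0 < ε) : Cut (cut β ε) where
  smooth := (cut_smooth β ε).of_le (by simp)
  anti := fun a b hab => Real.smoothTransition.monotone (by gcongr)
  nonneg := fun x => Real.smoothTransition.nonneg _
  le_one := fun x => Real.smoothTransition.le_one _

lemma cut_Good {β ε : ℝ} (hε : 0 < ε) : Good (cut β ε) where
  smooth := cut_smooth β ε
  bdd := ⟨1, fun x => by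
    rw [abs_of_nonneg ((cut_Cut hε).nonneg x)]; exact (cut_Cut hε).le_one x⟩
  supp := by
    refine HasCompactSupport.intro (K := Set.Icc β (β + ε)) isCompact_Icc fun x hx => ?_
    rw [Set.mem_Icc, not_and_or, not_le, not_le] at hx
    exact hx.elim (cut_deriv_lt hε) (cut_deriv_gt hε)

/-- unnormalised component of `w` orthogonal to `v` -/
def pv {d : ℕ} (v w : Fin d → ℝ) : Fin d → ℝ := w - (v ⬝ᵥ w) • v

/-- unnormalised component of `u` orthogonal to `v` and `w` -/
noncomputable def pv2 {d : ℕ} (v w u : Fin d → ℝ) : Fin d → ℝ :=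
  u - (v ⬝ᵥ u) • v - (perpUnit v w ⬝ᵥ u) • perpUnit v w

/-- Euclidean norm -/
noncomputable def nr {d : ℕ} (x : Fin d → ℝ) : ℝ := √(x ⬝ᵥ x)

lemma perpUnit_eq {d : ℕ} (v w : Fin d → ℝ) : perpUnit v w = (nr (pv v w))⁻¹ • pv v w := by
  simp only [perpUnit, nr, pv, dotProduct, pow_two]; rfl

lemma perpUnit2_eq {d : ℕ} (v w u : Fin d → ℝ) :
    perpUnit2 v w u = (nr (pv2 v w u))⁻¹ • pv2 v w u := by
  simp only [perpUnit2, nr, pv2, dotProduct, pow_two]; rfl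

lemma nr_nonneg {d : ℕ} (x : Fin d → ℝ) : 0 ≤ nr x := Real.sqrt_nonneg _

lemma nr_zero {d : ℕ} {x : Fin d → ℝ} (h : nr x = 0) : x = 0 := by
  rw [nr, Real.sqrt_eq_zero (dot_self_nonneg x)] at h
  exact dotProduct_self_eq_zero.1 h

lemma nr_smul_unit {d : ℕ} (x : Fin d → ℝ) : nr x • ((nr x)⁻¹ • x) = x := by
  by_cases h : nr x = 0
  · rw [nr_zero h]; simp
  · rw [smul_smul, mul_inv_cancel₀ h, one_smul]

lemma unit_dot {d : ℕ} {x : Fin d → ℝ} (h : nr x ≠ 0) :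
    ((nr x)⁻¹ • x) ⬝ᵥ ((nr x)⁻¹ • x) = 1 := by
  have : x ⬝ᵥ x = nr x * nr x := (Real.mul_self_sqrt (dot_self_nonneg x)).symm
  rw [dotProduct_smul, smul_dotProduct, this]
  simp only [smul_eq_mul]; field_simp

section perp
variable {d : ℕ} {v w u : Fin d → ℝ}

lemma pv_eq (v w : Fin d → ℝ) : nr (pv v w) • perpUnit v w = pv v w := by
  rw [perpUnit_eq]; exact nr_smul_unit _

lemma pv2_eq (v w u : Fin d → ℝ) : nr (pv2 v w u) • perpUnit2 v w u = pv2 v w u := by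
  rw [perpUnit2_eq]; exact nr_smul_unit _

lemma perp_unit (h : nr (pv v w) ≠ 0) : perpUnit v w ⬝ᵥ perpUnit v w = 1 := by
  rw [perpUnit_eq]; exact unit_dot h

lemma perp2_unit (h : nr (pv2 v w u) ≠ 0) : perpUnit2 v w u ⬝ᵥ perpUnit2 v w u = 1 := by
  rw [perpUnit2_eq]; exact unit_dot h

lemma perp_orth (hv : v ⬝ᵥ v = 1) : v ⬝ᵥ perpUnit v w = 0 := by
  rw [perpUnit_eq, dotProduct_smul, pv, dotProduct_sub, dotProduct_smul, hv]; simp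

lemma decomp1 : w = nr (pv v w) • perpUnit v w + (v ⬝ᵥ w) • v := by
  rw [pv_eq, pv]; abel

lemma perp_dot (hv : v ⬝ᵥ v = 1) (h : nr (pv v w) ≠ 0) :
    w ⬝ᵥ perpUnit v w = nr (pv v w) := by
  conv_lhs => rw [decomp1 (v := v) (w := w)]
  have := perp_orth (v := v) (w := w) hv
  rw [add_dotProduct, smul_dotProduct, smul_dotProduct, ← decomp1, perp_unit h, this]
  simp

lemma perp2_orth1 (hv : v ⬝ᵥ v = 1) : v ⬝ᵥ perpUnit2 v w u = 0 := by
  rw [perpUnit2_eq, dotProduct_smul, pv2, dotProduct_sub, dotProduct_sub, dotProduct_smul,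
    dotProduct_smul, hv, perp_orth hv]; simp

lemma perp2_orth2 (hv : v ⬝ᵥ v = 1) (h : nr (pv v w) ≠ 0) :
    perpUnit v w ⬝ᵥ perpUnit2 v w u = 0 := by
  rw [perpUnit2_eq, dotProduct_smul, pv2, dotProduct_sub, dotProduct_sub, dotProduct_smul,
    dotProduct_smul, perp_unit h, dotProduct_comm _ v, perp_orth hv]; simp

lemma perp2_orth3 (hv : v ⬝ᵥ v = 1) (h : nr (pv v w) ≠ 0) : w ⬝ᵥ perpUnit2 v w u = 0 := by
  have h1 := perp2_orth1 (v := v) (w := w) (u := u) hv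
  have h2 := perp2_orth2 (v := v) (w := w) (u := u) hv h
  have h3 : w ⬝ᵥ perpUnit2 v w u =
      (nr (pv v w) • perpUnit v w + (v ⬝ᵥ w) • v) ⬝ᵥ perpUnit2 v w u := by rw [← decomp1]
  rw [h3, add_dotProduct, smul_dotProduct, smul_dotProduct, h1, h2]; simp

lemma perp2_dot (hv : v ⬝ᵥ v = 1) (h : nr (pv v w) ≠ 0) (h' : nr (pv2 v w u) ≠ 0) :
    u ⬝ᵥ perpUnit2 v w u = nr (pv2 v w u) := by
  have h1 := perp2_orth1 (v := v) (w := w) (u := u) hv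
  have h2 := perp2_orth2 (v := v) (w := w) (u := u) hv h
  have h3 : u ⬝ᵥ perpUnit2 v w u =
      (nr (pv2 v w u) • perpUnit2 v w u + (v ⬝ᵥ u) • v + (perpUnit v w ⬝ᵥ u) • perpUnit v w)
        ⬝ᵥ perpUnit2 v w u := by
    congr 1; rw [pv2_eq, pv2]; abel
  rw [h3, add_dotProduct, add_dotProduct, smul_dotProduct, smul_dotProduct, smul_dotProduct,
    h1, h2, perp2_unit h']; simp

lemma perp_li (hv : v ⬝ᵥ v = 1) (h : nr (pv v w) ≠ 0) (h' : nr (pv2 v w u) ≠ 0) :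
    LinearIndependent ℝ ![v, w, u] := by
  rw [Fintype.linearIndependent_iff]
  intro g hg
  simp only [Fin.sum_univ_three, Matrix.cons_val_zero, Matrix.cons_val_one,
    Matrix.cons_val_two, Matrix.cons_val] at hg
  have key : ∀ y : Fin d → ℝ, g 0 * (v ⬝ᵥ y) + g 1 * (w ⬝ᵥ y) + g 2 * (u ⬝ᵥ y) = 0 := by
    intro y
    have := congrArg (fun x => x ⬝ᵥ y) hg
    simpa [add_dotProduct, smul_dotProduct] using this
  have k3 := key (perpUnit2 v w u)
  rw [perp2_orth1 hv, perp2_orth3 hv h, perp2_dot hv h h'] at k3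
  have g2 : g 2 = 0 := by simpa [h'] using k3
  have k2 := key (perpUnit v w)
  rw [perp_orth hv, perp_dot hv h, g2] at k2
  have g1 : g 1 = 0 := by simpa [h] using k2
  have k1 := key v
  rw [g1, g2, hv] at k1
  have g0 : g 0 = 0 := by simpa using k1
  intro i; fin_cases i <;> assumption

end perp

end GaussPoly
namespace GaussPoly

lemma PP_le {d : ℕ} (v : Fin d → Fin d → ℝ) (h : Fin d → ℝ → ℝ) (s : Finset (Fin d))
    (z : Fin d → ℝ) (hs : ∀ i ∉ s, |h i (v i ⬝ᵥ z)| ≤ 1) :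
    |PP v h z| ≤ ∏ i ∈ s, |h i (v i ⬝ᵥ z)| := by
  rw [PP, Finset.abs_prod, ← Finset.prod_mul_prod_compl s]
  have h1 : ∏ i ∈ sᶜ, |h i (v i ⬝ᵥ z)| ≤ 1 :=
    Finset.prod_le_one (fun i _ => abs_nonneg _) fun i hi => hs i (Finset.mem_compl.1 hi)
  have h2 : 0 ≤ ∏ i ∈ s, |h i (v i ⬝ᵥ z)| := Finset.prod_nonneg fun i _ => abs_nonneg _
  exact mul_le_of_le_one_right h2 h1

/-- the standing hypotheses on the smoothed indicator family -/
structure Fam {d : ℕ} (κ : ℝ) (v : Fin d → Fin d → ℝ) (f : Fin d → ℝ → ℝ) : Prop where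
  kpos : 0 ≤ κ
  unit : ∀ j, v j ⬝ᵥ v j = 1
  good : ∀ j, Good (f j)
  cut : ∀ j, Cut (f j)
  sep : ∀ j, ∃ w : Fin d → ℝ, w ⬝ᵥ w = 1 ∧ ∀ z, deriv (f j) (v j ⬝ᵥ z) ≠ 0 →
    (∀ i, f i (v i ⬝ᵥ z) ≠ 0 ∨ deriv (f i) (v i ⬝ᵥ z) ≠ 0) → κ ≤ w ⬝ᵥ z

lemma Cut.abs_le {f : ℝ → ℝ} (hf : Cut f) (x : ℝ) : |f x| ≤ 1 := by
  rw [abs_of_nonneg (hf.nonneg x)]; exact hf.le_one x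

lemma abs_le_one_add_sq (t : ℝ) : |t| ≤ 1 + t ^ 2 := by
  rw [← sq_abs t]; nlinarith [sq_nonneg (|t| - 1), abs_nonneg t]

/-- common part of the three basic bounds -/
lemma base {d : ℕ} {κ : ℝ} {v : Fin d → Fin d → ℝ} {f : Fin d → ℝ → ℝ} (hF : Fam κ v f)
    (j : Fin d) (h : Fin d → ℝ → ℝ) (hj : h j = deriv (f j))
    (hh : ∀ i, h i = f i ∨ h i = deriv (f i)) (g R : (Fin d → ℝ) → ℝ) (c : ℝ)
    (hc : 0 ≤ c) (hR : ∀ z, 0 ≤ R z) (n : ℕ) (hn : n ≤ 3)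
    (hb : ∀ z, c * |PP v h z| * |g z| ≤ R z * gaussPDF d z)
    (hI : ∀ w : Fin d → ℝ, w ⬝ᵥ w = 1 →
      ∫⁻ z, ENNReal.ofReal (R z) * ENNReal.ofReal (gaussPDF d (z - κ • w))
        ≤ ENNReal.ofReal (5 * (1 + κ ^ 2)) ^ n) :
    c * |∫ z, PP v h z * g z| ≤ 216000 * Real.exp (-κ ^ 2 / 4) := by
  obtain ⟨w, hw, hs⟩ := hF.sep j
  have := final_int hF.kpos hw (fun z => c * (PP v h z * g z)) R hR n hn ?_ ?_ (hI w hw)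
  · rwa [integral_const_mul, abs_mul, abs_of_nonneg hc] at this
  · intro z hz
    have hP : PP v h z ≠ 0 := by
      intro h0; exact hz (by simp [h0])
    have hP' : ∀ i, h i (v i ⬝ᵥ z) ≠ 0 := fun i => by
      have := Finset.prod_ne_zero_iff.1 hP i (Finset.mem_univ i)
      exact this
    refine hs z (by rw [← hj]; exact hP' j) fun i => ?_
    rcases hh i with hi | hi
    · left; rw [← hi]; exact hP' i
    · right; rw [← hi]; exact hP' i
  · intro z
    rw [abs_mul, abs_mul, abs_of_nonneg hc, ← mul_assoc]; exact hb z

lemma B1 {d : ℕ} {κ : ℝ} {v : Fin d → Fin d → ℝ} {f : Fin d → ℝ → ℝ} (hF : Fam κ v f)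
    (j : Fin d) :
    |∫ z, PP v (dsub f j) z * D2 (v j) (v j) z| ≤ 216000 * Real.exp (-κ ^ 2 / 4) := by
  have := base hF j (dsub f j) (by simp [dsub]) (fun i => by
      by_cases h : i = j
      · subst h; right; simp [dsub]
      · left; simp [dsub, h]) (D2 (v j) (v j)) (fac (f j) (v j) (v j)) 1 zero_le_one
      (fac_nonneg _ (by rw [hF.unit]; norm_num)) 1 (by norm_num) ?_
      (fun w hw => by simpa using T1 hF.kpos hw (hF.cut j) (hF.unit j))
  · simpa using this
  · intro z
    have h1 := PP_le v (dsub f j) {j} z (fun i hi => by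
      have hi : i ≠ j := by simpa using hi
      simp only [dsub, Function.update_of_ne hi]
      exact (hF.cut i).abs_le _)
    simp only [Finset.prod_singleton] at h1
    simp only [dsub, Function.update_self] at h1 ⊢
    rw [D2, fac, hF.unit, abs_mul, abs_of_pos (gauss_pos z), ← mul_assoc]
    have h2 : |v j ⬝ᵥ z * v j ⬝ᵥ z - 1| ≤ 1 + (v j ⬝ᵥ z) ^ 2 := by
      rw [abs_le]; constructor <;> nlinarith [sq_nonneg (v j ⬝ᵥ z)]
    have := gauss_pos z
    gcongr

lemma B2 {d : ℕ} {κ : ℝ} {v : Fin d → Fin d → ℝ} {f : Fin d → ℝ → ℝ} (hF : Fam κ v f)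
    (j k : Fin d) (y : Fin d → ℝ) (hy : y = v j ∨ y = perpUnit (v j) (v k)) :
    nr (pv (v j) (v k)) * |∫ z, PP v (dsub (dsub f j) k) z * D1 y z|
      ≤ 216000 * Real.exp (-κ ^ 2 / 4) := by
  by_cases hs : nr (pv (v j) (v k)) = 0
  · rw [hs, zero_mul]; positivity
  have hjk : j ≠ k := by
    rintro rfl
    apply hs
    simp [pv, hF.unit, nr]
  have hu := hF.unit j
  have hd := perp_dot hu hs
  refine base hF j _ (by simp [dsub, hjk]) (fun i => by
      by_cases h : i = k
      · subst h; right; simp [dsub, hjk.symm]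
      · by_cases h' : i = j
        · subst h'; right; simp [dsub, h]
        · left; simp [dsub, h, h']) (D1 y)
      (fun z => fac (f k) (v k) (perpUnit (v j) (v k)) z * fac (f j) (v j) (v j) z) _
      (nr_nonneg _) (fun z => mul_nonneg (fac_nonneg _ (by rw [hd]; exact nr_nonneg _) _)
        (fac_nonneg _ (by rw [hu]; norm_num) _)) 2 (by norm_num) ?_
      (fun w hw => T2 hF.kpos hw (hF.cut j) (hF.cut k) hu (perp_unit hs) (perp_orth hu)
        (by rw [hd]; exact nr_nonneg _))
  intro z
  have h1 := PP_le v (dsub (dsub f j) k) {j, k} z (fun i hi => by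
    have hi : ¬ i = j ∧ ¬ i = k := by simpa using hi
    simp only [dsub, Function.update_of_ne hi.1, Function.update_of_ne hi.2]
    exact (hF.cut i).abs_le _)
  rw [Finset.prod_pair hjk] at h1
  have e1 : dsub (dsub f j) k j = deriv (f j) := by simp [dsub, hjk]
  have e2 : dsub (dsub f j) k k = deriv (f k) := by simp [dsub, hjk.symm]
  rw [e1, e2] at h1
  have h2 : |y ⬝ᵥ z| ≤ (1 + (perpUnit (v j) (v k) ⬝ᵥ z) ^ 2) * (1 + (v j ⬝ᵥ z) ^ 2) := by
    have a1 := sq_nonneg (perpUnit (v j) (v k) ⬝ᵥ z)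
    have a2 := sq_nonneg (v j ⬝ᵥ z)
    rcases hy with rfl | rfl
    · refine (abs_le_one_add_sq _).trans ?_
      nlinarith
    · refine (abs_le_one_add_sq _).trans ?_
      nlinarith
  have h3 := gauss_pos z
  have h4 := nr_nonneg (pv (v j) (v k))
  simp only [D1, fac]
  rw [hd, hu, abs_mul, abs_neg, abs_of_pos h3]
  calc nr (pv (v j) (v k)) * |PP v (dsub (dsub f j) k) z| * (|y ⬝ᵥ z| * gaussPDF d z)
      ≤ nr (pv (v j) (v k)) * (|deriv (f j) (v j ⬝ᵥ z)| * |deriv (f k) (v k ⬝ᵥ z)|)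
        * (((1 + (perpUnit (v j) (v k) ⬝ᵥ z) ^ 2) * (1 + (v j ⬝ᵥ z) ^ 2)) * gaussPDF d z) := by
        gcongr
    _ = _ := by ring

lemma pv2_left {d : ℕ} {v w : Fin d → ℝ} (hv : v ⬝ᵥ v = 1) : pv2 v w v = 0 := by
  have h : perpUnit v w ⬝ᵥ v = 0 := by rw [dotProduct_comm]; exact perp_orth hv
  simp [pv2, hv, h]

lemma pv2_right {d : ℕ} {v w : Fin d → ℝ} (hv : v ⬝ᵥ v = 1) (h : nr (pv v w) ≠ 0) :
    pv2 v w w = 0 := by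
  rw [pv2, dotProduct_comm (perpUnit v w), perp_dot hv h, pv_eq]
  simp [pv]

lemma B3 {d : ℕ} {κ : ℝ} {v : Fin d → Fin d → ℝ} {f : Fin d → ℝ → ℝ} (hF : Fam κ v f)
    (j k l : Fin d) :
    nr (pv (v j) (v k)) * nr (pv2 (v j) (v k) (v l))
        * |∫ z, PP v (dsub (dsub (dsub f j) k) l) z * gaussPDF d z|
      ≤ 216000 * Real.exp (-κ ^ 2 / 4) := by
  by_cases hs : nr (pv (v j) (v k)) = 0
  · rw [hs, zero_mul, zero_mul]; positivity
  by_cases hr : nr (pv2 (v j) (v k) (v l)) = 0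
  · rw [hr, mul_zero, zero_mul]; positivity
  have hu := hF.unit j
  have hjk : j ≠ k := by
    rintro rfl
    apply hs
    simp [pv, hF.unit, nr]
  have hjl : j ≠ l := by
    rintro rfl
    apply hr
    simp [pv2_left hu, nr]
  have hkl : k ≠ l := by
    rintro rfl
    apply hr
    simp [pv2_right hu hs, nr]
  have hd := perp_dot hu hs
  have hd2 := perp2_dot hu hs hr
  refine base hF j _ (by simp [dsub, hjk, hjl]) (fun i => by
      by_cases h : i = k
      · subst h; right; simp [dsub, hjk.symm, hkl]
      · by_cases h' : i = j
        · subst h'; right; simp [dsub, h, hjl]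
        · by_cases h'' : i = l
          · subst h''; right; simp [dsub, h, h']
          · left; simp [dsub, h, h', h'']) (gaussPDF d)
      (fun z => fac (f l) (v l) (perpUnit2 (v j) (v k) (v l)) z *
        (fac (f k) (v k) (perpUnit (v j) (v k)) z * fac (f j) (v j) (v j) z)) _
      (mul_nonneg (nr_nonneg _) (nr_nonneg _))
      (fun z => mul_nonneg (fac_nonneg _ (by rw [hd2]; exact nr_nonneg _) _)
        (mul_nonneg (fac_nonneg _ (by rw [hd]; exact nr_nonneg _) _)
        (fac_nonneg _ (by rw [hu]; norm_num) _))) 3 (by norm_num) ?_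
      (fun w hw => T3 hF.kpos hw (hF.cut j) (hF.cut k) (hF.cut l) hu (perp_unit hs)
        (perp2_unit hr) (perp_orth hu) (perp2_orth1 hu) (perp2_orth2 hu hs) (perp2_orth3 hu hs)
        (by rw [hd]; exact nr_nonneg _) (by rw [hd2]; exact nr_nonneg _))
  intro z
  have h1 := PP_le v (dsub (dsub (dsub f j) k) l) {j, k, l} z (fun i hi => by
    have hi : ¬ i = j ∧ ¬ i = k ∧ ¬ i = l := by simpa using hi
    simp only [dsub, Function.update_of_ne hi.1, Function.update_of_ne hi.2.1,
      Function.update_of_ne hi.2.2]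
    exact (hF.cut i).abs_le _)
  rw [Finset.prod_insert (by simp [hjk, hjl]), Finset.prod_pair hkl] at h1
  have e1 : dsub (dsub (dsub f j) k) l j = deriv (f j) := by simp [dsub, hjk, hjl]
  have e2 : dsub (dsub (dsub f j) k) l k = deriv (f k) := by simp [dsub, hjk.symm, hkl]
  have e3 : dsub (dsub (dsub f j) k) l l = deriv (f l) := by simp [dsub, hjl.symm, hkl.symm]
  rw [e1, e2, e3] at h1
  have h3 := gauss_pos z
  have h4 := nr_nonneg (pv (v j) (v k))
  have h5 := nr_nonneg (pv2 (v j) (v k) (v l))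
  have h2 : (1 : ℝ) ≤ (1 + (perpUnit2 (v j) (v k) (v l) ⬝ᵥ z) ^ 2) *
      ((1 + (perpUnit (v j) (v k) ⬝ᵥ z) ^ 2) * (1 + (v j ⬝ᵥ z) ^ 2)) := by
    have a1 := sq_nonneg (perpUnit (v j) (v k) ⬝ᵥ z)
    have a2 := sq_nonneg (v j ⬝ᵥ z)
    have a3 := sq_nonneg (perpUnit2 (v j) (v k) (v l) ⬝ᵥ z)
    exact one_le_mul_of_one_le_of_one_le (by linarith)
      (one_le_mul_of_one_le_of_one_le (by linarith) (by linarith))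
  simp only [fac]
  rw [hd, hd2, hu, abs_of_pos h3]
  calc nr (pv (v j) (v k)) * nr (pv2 (v j) (v k) (v l))
        * |PP v (dsub (dsub (dsub f j) k) l) z| * gaussPDF d z
      ≤ nr (pv (v j) (v k)) * nr (pv2 (v j) (v k) (v l)) *
        (|deriv (f j) (v j ⬝ᵥ z)| * (|deriv (f k) (v k ⬝ᵥ z)| * |deriv (f l) (v l ⬝ᵥ z)|))
        * gaussPDF d z := by gcongr
    _ ≤ nr (pv (v j) (v k)) * nr (pv2 (v j) (v k) (v l)) *
        (|deriv (f j) (v j ⬝ᵥ z)| * (|deriv (f k) (v k ⬝ᵥ z)| * |deriv (f l) (v l ⬝ᵥ z)|))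
        * gaussPDF d z * ((1 + (perpUnit2 (v j) (v k) (v l) ⬝ᵥ z) ^ 2) *
      ((1 + (perpUnit (v j) (v k) ⬝ᵥ z) ^ 2) * (1 + (v j ⬝ᵥ z) ^ 2))) :=
        le_mul_of_one_le_right (by positivity) h2
    _ = _ := by ring

end GaussPoly
namespace GaussPoly

lemma dot_pv {d : ℕ} (v w u : Fin d → ℝ) :
    w ⬝ᵥ pv v u = nr (pv v w) * (u ⬝ᵥ perpUnit v w) := by
  rw [← smul_eq_mul, ← dotProduct_smul, pv_eq, pv, pv, dotProduct_sub, dotProduct_sub,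
    dotProduct_smul, dotProduct_smul, smul_eq_mul, smul_eq_mul, dotProduct_comm w u,
    dotProduct_comm w v, dotProduct_comm u v]
  ring

lemma dot_pv2 {d : ℕ} (v w x u : Fin d → ℝ) :
    x ⬝ᵥ pv2 v w u = nr (pv2 v w x) * (u ⬝ᵥ perpUnit2 v w x) := by
  rw [← smul_eq_mul, ← dotProduct_smul, pv2_eq, pv2, pv2]
  simp only [dotProduct_sub, dotProduct_smul, smul_eq_mul]
  rw [dotProduct_comm x u, dotProduct_comm x v, dotProduct_comm u v,
    dotProduct_comm x (perpUnit v w), dotProduct_comm u (perpUnit v w)]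
  ring

lemma D1_split {d : ℕ} (v w u z : Fin d → ℝ) :
    D1 u z = (u ⬝ᵥ v) * D1 v z + (u ⬝ᵥ perpUnit v w) * D1 (perpUnit v w) z
      + D1 (pv2 v w u) z := by
  simp only [D1, pv2, sub_dotProduct, smul_dotProduct, smul_eq_mul]
  rw [dotProduct_comm u v, dotProduct_comm u (perpUnit v w)]
  ring

lemma D2_split {d : ℕ} (v u w z : Fin d → ℝ) :
    D2 u w z = (u ⬝ᵥ v) * (w ⬝ᵥ v) * D2 v v z + (u ⬝ᵥ v) * D2 (pv v w) v z
      + D2 (pv v u) w z := by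
  simp only [D2, pv, sub_dotProduct, smul_dotProduct, smul_eq_mul]
  rw [dotProduct_comm u v, dotProduct_comm w v, dotProduct_comm v w]
  rw [dotProduct_comm w v]
  ring

lemma sum_bound {d : ℕ} (g : Fin d → ℝ) (B c : ℝ) (hc : 0 ≤ c) (h : ∀ k, c * |g k| ≤ B) :
    c * |-∑ k, g k| ≤ d * B := by
  rw [abs_neg]
  calc c * |∑ k, g k| ≤ c * ∑ k, |g k| := by
        gcongr; exact Finset.abs_sum_le_sum_abs _ _
    _ = ∑ k, c * |g k| := by rw [Finset.mul_sum]
    _ ≤ ∑ _k : Fin d, B := Finset.sum_le_sum fun k _ => h k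
    _ = d * B := by simp

lemma L3 {d : ℕ} {κ : ℝ} {v : Fin d → Fin d → ℝ} {f : Fin d → ℝ → ℝ} (hF : Fam κ v f)
    (j k : Fin d) (u : Fin d → ℝ) (c M : ℝ) (hc : 0 ≤ c) (hM : 0 ≤ M)
    (h1 : c * |u ⬝ᵥ v j| ≤ M) (h2 : c * |u ⬝ᵥ perpUnit (v j) (v k)| ≤ M)
    (h3 : ∀ l, nr (pv2 (v j) (v k) (v l)) ≠ 0 →
      c * |u ⬝ᵥ perpUnit2 (v j) (v k) (v l)| ≤ M) :
    c * nr (pv (v j) (v k)) * |∫ z, PP v (dsub (dsub f j) k) z * D1 u z|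
      ≤ (2 + d) * (M * (216000 * Real.exp (-κ ^ 2 / 4))) := by
  set Φ := 216000 * Real.exp (-κ ^ 2 / 4) with hΦ
  have hΦ0 : 0 ≤ Φ := by positivity
  set s := nr (pv (v j) (v k)) with hs
  have hs0 : 0 ≤ s := nr_nonneg _
  set e := perpUnit (v j) (v k) with he
  have hg := Good.dsub (Good.dsub hF.good j) k
  set h := dsub (dsub f j) k with hh
  have I1 := (PP_integrable v hg (integrable_D1 (v j))).const_mul (u ⬝ᵥ v j)
  have I2 := (PP_integrable v hg (integrable_D1 e)).const_mul (u ⬝ᵥ e)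
  have I3 := PP_integrable v hg (integrable_D1 (pv2 (v j) (v k) u))
  have E : ∫ z, PP v h z * D1 u z = (u ⬝ᵥ v j) * (∫ z, PP v h z * D1 (v j) z)
      + (u ⬝ᵥ e) * (∫ z, PP v h z * D1 e z)
      + ∫ z, PP v h z * D1 (pv2 (v j) (v k) u) z := by
    rw [← integral_const_mul, ← integral_const_mul, ← integral_add I1 I2,
      ← integral_add (I1.fun_add I2) I3]
    refine integral_congr_ae (Filter.Eventually.of_forall fun z => ?_)
    simp only [D1_split (v j) (v k) u z, Pi.add_apply]
    ring
  have b1 := B2 hF j k (v j) (Or.inl rfl)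
  have b2 := B2 hF j k e (Or.inr rfl)
  have b3 := ibp v hg (pv2 (v j) (v k) u) integrable_gauss
    (integrable_D1 (pv2 (v j) (v k) u)) (hasLineDeriv_gauss (pv2 (v j) (v k) u))
  have b3' : c * s * |∫ z, PP v h z * D1 (pv2 (v j) (v k) u) z| ≤ d * (M * Φ) := by
    rw [b3]
    refine sum_bound _ _ _ (by positivity) fun l => ?_
    have b := B3 hF j k l
    rw [dot_pv2, abs_mul, abs_mul, abs_of_nonneg (nr_nonneg _)]
    by_cases hr : nr (pv2 (v j) (v k) (v l)) = 0
    · rw [hr]; simp; positivity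
    calc _ = (c * |u ⬝ᵥ perpUnit2 (v j) (v k) (v l)|) * (s * nr (pv2 (v j) (v k) (v l)) *
          |∫ z, PP v (dsub h l) z * gaussPDF d z|) := by ring
      _ ≤ M * Φ := mul_le_mul (h3 l hr) b (mul_nonneg (mul_nonneg hs0 (nr_nonneg _))
          (abs_nonneg _)) hM
  rw [E]
  calc _ ≤ c * s * (|u ⬝ᵥ v j| * |∫ z, PP v h z * D1 (v j) z|
        + |u ⬝ᵥ e| * |∫ z, PP v h z * D1 e z|
        + |∫ z, PP v h z * D1 (pv2 (v j) (v k) u) z|) := by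
        refine mul_le_mul_of_nonneg_left ?_ (by positivity)
        refine (abs_add_three _ _ _).trans ?_
        rw [abs_mul, abs_mul]
    _ = (c * |u ⬝ᵥ v j|) * (s * |∫ z, PP v h z * D1 (v j) z|)
        + (c * |u ⬝ᵥ e|) * (s * |∫ z, PP v h z * D1 e z|)
        + c * s * |∫ z, PP v h z * D1 (pv2 (v j) (v k) u) z| := by ring
    _ ≤ M * Φ + M * Φ + d * (M * Φ) := by
        gcongr
    _ = _ := by ring

/-- all the admissible products are at most `M` -/
structure MB {d : ℕ} (v : Fin d → Fin d → ℝ) (u1 u2 u3 : Fin d → ℝ) (M : ℝ) : Prop where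
  nonneg : 0 ≤ M
  a : ∀ j, |u1 ⬝ᵥ v j| * |u2 ⬝ᵥ v j| * |u3 ⬝ᵥ v j| ≤ M
  b1 : ∀ j k, nr (pv (v j) (v k)) ≠ 0 →
    |u1 ⬝ᵥ v j| * |u2 ⬝ᵥ v j| * |u3 ⬝ᵥ perpUnit (v j) (v k)| ≤ M
  b2 : ∀ j k, nr (pv (v j) (v k)) ≠ 0 →
    |u1 ⬝ᵥ v j| * |u2 ⬝ᵥ perpUnit (v j) (v k)| * |u3 ⬝ᵥ v j| ≤ M
  b3 : ∀ j k, nr (pv (v j) (v k)) ≠ 0 →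
    |u1 ⬝ᵥ v j| * |u2 ⬝ᵥ perpUnit (v j) (v k)| * |u3 ⬝ᵥ perpUnit (v j) (v k)| ≤ M
  c : ∀ j k l, nr (pv (v j) (v k)) ≠ 0 → nr (pv2 (v j) (v k) (v l)) ≠ 0 →
    |u1 ⬝ᵥ v j| * |u2 ⬝ᵥ perpUnit (v j) (v k)| * |u3 ⬝ᵥ perpUnit2 (v j) (v k) (v l)| ≤ M

lemma L2 {d : ℕ} {κ : ℝ} {v : Fin d → Fin d → ℝ} {f : Fin d → ℝ → ℝ} (hF : Fam κ v f)
    {u1 u2 u3 : Fin d → ℝ} {M : ℝ} (hM : MB v u1 u2 u3 M) (j : Fin d) :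
    |u1 ⬝ᵥ v j| * |∫ z, PP v (dsub f j) z * D2 u2 u3 z|
      ≤ (1 + d + d * (2 + d)) * (M * (216000 * Real.exp (-κ ^ 2 / 4))) := by
  have hΦ0 : 0 ≤ 216000 * Real.exp (-κ ^ 2 / 4) := by positivity
  have b0 := B1 hF j
  have hM0 := hM.nonneg
  have hg := Good.dsub hF.good j
  have P : ∀ k y, (y = v j ∨ y = perpUnit (v j) (v k)) → _ := fun k y h => B2 hF j k y h
  have Q := fun k => L3 hF j k u3
  set Φ := 216000 * Real.exp (-κ ^ 2 / 4) with hΦ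
  have I1 := (PP_integrable v hg (integrable_D2 (v j) (v j))).const_mul
    ((u2 ⬝ᵥ v j) * (u3 ⬝ᵥ v j))
  have I2 := (PP_integrable v hg (integrable_D2 (pv (v j) u3) (v j))).const_mul (u2 ⬝ᵥ v j)
  have I3 := PP_integrable v hg (integrable_D2 (pv (v j) u2) u3)
  have E : ∫ z, PP v (dsub f j) z * D2 u2 u3 z =
      (u2 ⬝ᵥ v j) * (u3 ⬝ᵥ v j) * (∫ z, PP v (dsub f j) z * D2 (v j) (v j) z)
      + (u2 ⬝ᵥ v j) * (∫ z, PP v (dsub f j) z * D2 (pv (v j) u3) (v j) z)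
      + ∫ z, PP v (dsub f j) z * D2 (pv (v j) u2) u3 z := by
    rw [← integral_const_mul, ← integral_const_mul, ← integral_add I1 I2,
      ← integral_add (I1.fun_add I2) I3]
    refine integral_congr_ae (Filter.Eventually.of_forall fun z => ?_)
    simp only [D2_split (v j) u2 u3 z, Pi.add_apply]
    ring
  have t2 : |u1 ⬝ᵥ v j| * |u2 ⬝ᵥ v j| * |∫ z, PP v (dsub f j) z * D2 (pv (v j) u3) (v j) z|
      ≤ d * (M * Φ) := by
    rw [ibp v hg (pv (v j) u3) (integrable_D1 (v j)) (integrable_D2 (pv (v j) u3) (v j))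
      (hasLineDeriv_D1 (pv (v j) u3) (v j))]
    refine sum_bound _ _ _ (by positivity) fun k => ?_
    rw [dot_pv, abs_mul, abs_mul, abs_of_nonneg (nr_nonneg _)]
    by_cases hs : nr (pv (v j) (v k)) = 0
    · rw [hs]; simp; positivity
    calc _ = (|u1 ⬝ᵥ v j| * |u2 ⬝ᵥ v j| * |u3 ⬝ᵥ perpUnit (v j) (v k)|) *
          (nr (pv (v j) (v k)) * |∫ z, PP v (dsub (dsub f j) k) z * D1 (v j) z|) := by ring
      _ ≤ M * Φ := mul_le_mul (hM.b1 j k hs) (P k _ (Or.inl rfl))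
          (mul_nonneg (nr_nonneg _) (abs_nonneg _)) hM0
  have t3 : |u1 ⬝ᵥ v j| * |∫ z, PP v (dsub f j) z * D2 (pv (v j) u2) u3 z|
      ≤ d * ((2 + d) * (M * Φ)) := by
    rw [ibp v hg (pv (v j) u2) (integrable_D1 u3) (integrable_D2 (pv (v j) u2) u3)
      (hasLineDeriv_D1 (pv (v j) u2) u3)]
    refine sum_bound _ _ _ (by positivity) fun k => ?_
    rw [dot_pv, abs_mul, abs_mul, abs_of_nonneg (nr_nonneg _)]
    by_cases hs : nr (pv (v j) (v k)) = 0
    · rw [hs]; simp; positivity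
    calc _ = (|u1 ⬝ᵥ v j| * |u2 ⬝ᵥ perpUnit (v j) (v k)|) * nr (pv (v j) (v k)) *
          |∫ z, PP v (dsub (dsub f j) k) z * D1 u3 z| := by ring
      _ ≤ _ := Q k _ M (by positivity) hM0 (hM.b2 j k hs) (hM.b3 j k hs)
          fun l hl => hM.c j k l hs hl
  rw [E]
  calc _ ≤ |u1 ⬝ᵥ v j| * (|u2 ⬝ᵥ v j| * |u3 ⬝ᵥ v j| *
          |∫ z, PP v (dsub f j) z * D2 (v j) (v j) z|
        + |u2 ⬝ᵥ v j| * |∫ z, PP v (dsub f j) z * D2 (pv (v j) u3) (v j) z|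
        + |∫ z, PP v (dsub f j) z * D2 (pv (v j) u2) u3 z|) := by
        refine mul_le_mul_of_nonneg_left ?_ (by positivity)
        refine (abs_add_three _ _ _).trans ?_
        rw [abs_mul, abs_mul, abs_mul]
    _ = (|u1 ⬝ᵥ v j| * |u2 ⬝ᵥ v j| * |u3 ⬝ᵥ v j|) *
          |∫ z, PP v (dsub f j) z * D2 (v j) (v j) z|
        + |u1 ⬝ᵥ v j| * |u2 ⬝ᵥ v j| * |∫ z, PP v (dsub f j) z * D2 (pv (v j) u3) (v j) z|
        + |u1 ⬝ᵥ v j| * |∫ z, PP v (dsub f j) z * D2 (pv (v j) u2) u3 z| := by ring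
    _ ≤ M * Φ + d * (M * Φ) + d * ((2 + d) * (M * Φ)) := by
        have := hM.a j
        gcongr
    _ = _ := by ring

lemma L1 {d : ℕ} (hd : 1 ≤ d) {κ : ℝ} {v : Fin d → Fin d → ℝ} {f : Fin d → ℝ → ℝ}
    (hF : Fam κ v f) {u1 u2 u3 : Fin d → ℝ} {M : ℝ} (hM : MB v u1 u2 u3 M) :
    |∫ z, PP v f z * D3 u1 u2 u3 z| ≤ 1080000 * d ^ 3 * Real.exp (-κ ^ 2 / 4) * M := by
  have Q := L2 hF hM
  have hM0 := hM.nonneg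
  have hE : 0 ≤ Real.exp (-κ ^ 2 / 4) := by positivity
  rw [ibp v hF.good u1 (integrable_D2 u2 u3) (integrable_D3 u1 u2 u3)
    (hasLineDeriv_D2 u1 u2 u3), ← one_mul |_|]
  refine (sum_bound _ _ 1 zero_le_one fun j => ?_).trans (?_ :
    (d : ℝ) * ((1 + d + d * (2 + d)) * (M * (216000 * Real.exp (-κ ^ 2 / 4)))) ≤ _)
  · rw [one_mul, abs_mul, dotProduct_comm]; exact Q j
  · have hd' : (1 : ℝ) ≤ d := by exact_mod_cast hd
    have h1 : (1 : ℝ) + d + d * (2 + d) ≤ 5 * d ^ 2 := by nlinarith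
    calc _ ≤ (d : ℝ) * ((5 * d ^ 2) * (M * (216000 * Real.exp (-κ ^ 2 / 4)))) := by
          gcongr
      _ = _ := by ring

end GaussPoly
namespace GaussPoly

open Filter Topology

lemma meas_poly {d : ℕ} (v : Fin d → Fin d → ℝ) (β : Fin d → ℝ) :
    MeasurableSet {y : Fin d → ℝ | ∀ j, v j ⬝ᵥ y ≤ β j} := by
  rw [Set.setOf_forall]
  exact MeasurableSet.iInter fun j =>
    (isClosed_le (continuous_dot (v j)) continuous_const).measurableSet

lemma limit_bound {d : ℕ} (v : Fin d → Fin d → ℝ) (β : Fin d → ℝ) (g : (Fin d → ℝ) → ℝ)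
    (hg : Integrable g) (K : ℝ)
    (h : ∀ᶠ n : ℕ in atTop, |∫ z, PP v (fun i => cut (β i) (1 / ((n : ℝ) + 1))) z * g z| ≤ K) :
    |∫ z in {y : Fin d → ℝ | ∀ j, v j ⬝ᵥ y ≤ β j}, g z| ≤ K := by
  have hp : ∀ n : ℕ, (0 : ℝ) < 1 / ((n : ℝ) + 1) := fun n => Nat.one_div_pos_of_nat
  have hlim : Tendsto (fun n : ℕ => ∫ z, PP v (fun i => cut (β i) (1 / ((n : ℝ) + 1))) z * g z)
      atTop (𝓝 (∫ z in {y : Fin d → ℝ | ∀ j, v j ⬝ᵥ y ≤ β j}, g z)) := by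
    rw [← integral_indicator (meas_poly v β)]
    refine tendsto_integral_of_dominated_convergence (fun z => |g z|) (fun n => ?_) hg.abs
      (fun n => ?_) ?_
    · exact (PP_integrable v (fun i => cut_Good (hp n)) hg).aestronglyMeasurable
    · refine Eventually.of_forall fun z => ?_
      have := PP_le v (fun i => cut (β i) (1 / ((n : ℝ) + 1))) ∅ z
        fun i _ => (cut_Cut (hp n)).abs_le _
      rw [Finset.prod_empty] at this
      rw [Real.norm_eq_abs, abs_mul]
      exact mul_le_of_le_one_left (abs_nonneg _) this
    · refine Eventually.of_forall fun z => ?_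
      refine tendsto_const_nhds.congr' ?_
      by_cases hz : ∀ j, v j ⬝ᵥ z ≤ β j
      · refine Eventually.of_forall fun n => ?_
        rw [Set.indicator_of_mem (show z ∈ {y : Fin d → ℝ | ∀ j, v j ⬝ᵥ y ≤ β j} from hz)]
        have : PP v (fun i => cut (β i) (1 / ((n : ℝ) + 1))) z = 1 :=
          Finset.prod_eq_one fun i _ => cut_one (hp n) (hz i)
        simp only [this, one_mul]
      · rw [Set.indicator_of_notMem (show z ∉ {y : Fin d → ℝ | ∀ j, v j ⬝ᵥ y ≤ β j} from hz)]
        push Not at hz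
        obtain ⟨j, hj⟩ := hz
        have := (tendsto_one_div_add_atTop_nhds_zero_nat (𝕜 := ℝ)).eventually_lt_const
          (sub_pos.2 hj)
        filter_upwards [this] with n hn
        have h0 : PP v (fun i => cut (β i) (1 / ((n : ℝ) + 1))) z = 0 :=
          Finset.prod_eq_zero (Finset.mem_univ j) (cut_zero (hp n) (by linarith))
        rw [h0, zero_mul]
  exact le_of_tendsto hlim.abs h

lemma core {d : ℕ} (hd : 1 ≤ d) {κ : ℝ} (hκ : 0 < κ) {v : Fin d → Fin d → ℝ}
    (hv : ∀ j, v j ⬝ᵥ v j = 1) (β : Fin d → ℝ) (hβ : (∃ l, β l < -κ) ∨ ∀ j, κ ≤ β j)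
    {u1 u2 u3 : Fin d → ℝ} {M : ℝ} (hM : MB v u1 u2 u3 M) :
    |∫ z in {y : Fin d → ℝ | ∀ j, v j ⬝ᵥ y ≤ β j}, D3 u1 u2 u3 z|
      ≤ 1080000 * d ^ 3 * Real.exp (-κ ^ 2 / 4) * M := by
  have hp : ∀ n : ℕ, (0 : ℝ) < 1 / ((n : ℝ) + 1) := fun n => Nat.one_div_pos_of_nat
  refine limit_bound v β _ (integrable_D3 u1 u2 u3) _ ?_
  rcases hβ with ⟨l, hl⟩ | hβ
  · have := (tendsto_one_div_add_atTop_nhds_zero_nat (𝕜 := ℝ)).eventually_lt_const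
          (sub_pos.2 hl)
    filter_upwards [this] with n hn
    refine L1 hd ⟨hκ.le, hv, fun j => cut_Good (hp n), fun j => cut_Cut (hp n), fun j => ?_⟩ hM
    refine ⟨-v l, by simp [hv], fun z _ hz => ?_⟩
    rw [neg_dotProduct]
    by_contra hcon
    have h1 : β l + 1 / ((n : ℝ) + 1) < v l ⬝ᵥ z := by linarith
    rcases hz l with h | h
    · exact h (cut_zero (hp n) h1.le)
    · exact h (cut_deriv_gt (hp n) h1)
  · refine Eventually.of_forall fun n => ?_
    refine L1 hd ⟨hκ.le, hv, fun j => cut_Good (hp n), fun j => cut_Cut (hp n), fun j => ?_⟩ hM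
    refine ⟨v j, hv j, fun z hz _ => (hβ j).trans ?_⟩
    by_contra hcon
    exact hz (cut_deriv_lt (hp n) (not_le.1 hcon))

lemma translate {d : ℕ} (v : Fin d → Fin d → ℝ) (b : Fin d → ℝ) (x : Fin d → ℝ)
    (g : (Fin d → ℝ) → ℝ) :
    ∫ z in {y : Fin d → ℝ | ∀ j, y ⬝ᵥ v j ≤ b j}, g (z - x)
      = ∫ z in {y : Fin d → ℝ | ∀ j, v j ⬝ᵥ y ≤ b j - x ⬝ᵥ v j}, g z := by
  have hm := meas_poly v b
  have hs : {y : Fin d → ℝ | ∀ j, y ⬝ᵥ v j ≤ b j} = {y : Fin d → ℝ | ∀ j, v j ⬝ᵥ y ≤ b j} := by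
    ext y; simp only [Set.mem_setOf_eq, dotProduct_comm]
  rw [hs, ← integral_indicator hm, ← integral_indicator (meas_poly v _),
    ← integral_sub_right_eq_self (μ := volume)
      (Set.indicator {y : Fin d → ℝ | ∀ j, v j ⬝ᵥ y ≤ b j - x ⬝ᵥ v j} g) x]
  refine integral_congr_ae (Eventually.of_forall fun z => ?_)
  simp only [Set.indicator, Set.mem_setOf_eq, dotProduct_sub]
  have : (∀ j, v j ⬝ᵥ z ≤ b j) ↔ ∀ j, v j ⬝ᵥ z - v j ⬝ᵥ x ≤ b j - x ⬝ᵥ v j := by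
    refine forall_congr' fun j => ?_
    rw [dotProduct_comm x]; constructor <;> intro h <;> linarith
  simp only [this]

end GaussPoly
/-- the third-derivative integral is small away from the boundary region
`A(κ) \ A(−κ)`. -/
theorem stmt10 :
    ∃ C : ℝ, 0 < C ∧
      ∀ d : ℕ, 3 ≤ d →
      ∀ v : Fin d → (Fin d → ℝ), Function.Injective v → (∀ j, ∑ i, v j i ^ 2 = 1) →
      ∀ b : Fin d → ℝ, ∀ κ : ℝ, 0 < κ → ∀ u1 u2 u3 : Fin d → ℝ,
        letI V1 : Set (Fin d → ℝ) := {u | ∃ j, u = v j}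
        letI V2 : Set (Fin d → ℝ) :=
          {u | ∃ j k : Fin d, j ≠ k ∧ v k ≠ -v j ∧ u = perpUnit (v j) (v k)}
        letI V3 : Set (Fin d → ℝ) :=
          {u | ∃ j k l : Fin d, j ≠ k ∧ k ≠ l ∧ j ≠ l ∧
            LinearIndependent ℝ ![v j, v k, v l] ∧ u = perpUnit2 (v j) (v k) (v l)}
      ∀ x : Fin d → ℝ,
        x ∉ {y : Fin d → ℝ | ∀ j, y ⬝ᵥ v j ≤ b j + κ} \
            {y : Fin d → ℝ | ∀ j, y ⬝ᵥ v j ≤ b j + -κ} →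
        |∫ z in {y : Fin d → ℝ | ∀ j, y ⬝ᵥ v j ≤ b j},
            ∑ a, ∑ c, ∑ e, u1 a * u2 c * u3 e * gaussPDF3 d a c e (z - x)| ≤
          C * d ^ 3 * Real.exp (-κ ^ 2 / 4) *
            sSup {r : ℝ | ∃ w1 ∈ V1, ∃ w2 ∈ V1 ∪ V2, ∃ w3 ∈ V1 ∪ V2 ∪ V3,
              r = |u1 ⬝ᵥ w1| * |u2 ⬝ᵥ w2| * |u3 ⬝ᵥ w3|} := by
  refine ⟨1080000, by norm_num, ?_⟩
  intro d hd v hinj hunit b κ hκ u1 u2 u3 x hx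
  set V1 : Set (Fin d → ℝ) := {u | ∃ j, u = v j} with hV1
  set V2 : Set (Fin d → ℝ) :=
    {u | ∃ j k : Fin d, j ≠ k ∧ v k ≠ -v j ∧ u = perpUnit (v j) (v k)} with hV2
  set V3 : Set (Fin d → ℝ) :=
    {u | ∃ j k l : Fin d, j ≠ k ∧ k ≠ l ∧ j ≠ l ∧
      LinearIndependent ℝ ![v j, v k, v l] ∧ u = perpUnit2 (v j) (v k) (v l)} with hV3
  have hv : ∀ j, v j ⬝ᵥ v j = 1 := fun j => by
    rw [← hunit j]; simp [dotProduct, sq]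
  simp only [GaussPoly.sum_gaussPDF3]
  rw [GaussPoly.translate v b x (GaussPoly.D3 u1 u2 u3)]
  set S : Set ℝ := {r : ℝ | ∃ w1 ∈ V1, ∃ w2 ∈ V1 ∪ V2, ∃ w3 ∈ V1 ∪ V2 ∪ V3,
              r = |u1 ⬝ᵥ w1| * |u2 ⬝ᵥ w2| * |u3 ⬝ᵥ w3|} with hS
  have f1 : V1.Finite := (Set.finite_range v).subset fun u ⟨j, hj⟩ => ⟨j, hj.symm⟩
  have f2 : V2.Finite :=
    (Set.finite_range fun p : Fin d × Fin d => perpUnit (v p.1) (v p.2)).subset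
      fun u ⟨j, k, _, _, hj⟩ => ⟨(j, k), hj.symm⟩
  have f3 : V3.Finite :=
    (Set.finite_range fun p : Fin d × Fin d × Fin d =>
      perpUnit2 (v p.1) (v p.2.1) (v p.2.2)).subset
      fun u ⟨j, k, l, _, _, _, _, hj⟩ => ⟨(j, k, l), hj.symm⟩
  have fS : S.Finite := by
    have := ((f1.prod ((f1.union f2).prod ((f1.union f2).union f3))).image
      fun p : (Fin d → ℝ) × (Fin d → ℝ) × (Fin d → ℝ) =>
        |u1 ⬝ᵥ p.1| * |u2 ⬝ᵥ p.2.1| * |u3 ⬝ᵥ p.2.2|)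
    refine this.subset ?_
    rintro r ⟨w1, h1, w2, h2, w3, h3, rfl⟩
    exact ⟨(w1, w2, w3), ⟨h1, h2, h3⟩, rfl⟩
  have key : ∀ w1 ∈ V1, ∀ w2 ∈ V1 ∪ V2, ∀ w3 ∈ V1 ∪ V2 ∪ V3,
      |u1 ⬝ᵥ w1| * |u2 ⬝ᵥ w2| * |u3 ⬝ᵥ w3| ≤ sSup S := fun w1 h1 w2 h2 w3 h3 =>
    le_csSup fS.bddAbove ⟨w1, h1, w2, h2, w3, h3, rfl⟩
  have m1 : ∀ j, v j ∈ V1 := fun j => ⟨j, rfl⟩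
  have m2 : ∀ j k, GaussPoly.nr (GaussPoly.pv (v j) (v k)) ≠ 0 →
      perpUnit (v j) (v k) ∈ V2 := by
    intro j k hs
    refine ⟨j, k, ?_, ?_, rfl⟩
    · rintro rfl
      apply hs
      simp [GaussPoly.pv, hv, GaussPoly.nr]
    · intro h
      apply hs
      simp [GaussPoly.pv, h, hv, GaussPoly.nr]
  have m3 : ∀ j k l, GaussPoly.nr (GaussPoly.pv (v j) (v k)) ≠ 0 →
      GaussPoly.nr (GaussPoly.pv2 (v j) (v k) (v l)) ≠ 0 →
      perpUnit2 (v j) (v k) (v l) ∈ V3 := by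
    intro j k l hs hr
    refine ⟨j, k, l, ?_, ?_, ?_, GaussPoly.perp_li (hv j) hs hr, rfl⟩
    · rintro rfl
      apply hs
      simp [GaussPoly.pv, hv, GaussPoly.nr]
    · rintro rfl
      apply hr
      simp [GaussPoly.pv2_right (hv j) hs, GaussPoly.nr]
    · rintro rfl
      apply hr
      simp [GaussPoly.pv2_left (hv j), GaussPoly.nr]
  have hM : GaussPoly.MB v u1 u2 u3 (sSup S) := by
    refine ⟨?_, ?_, ?_, ?_, ?_, ?_⟩
    · refine Real.sSup_nonneg ?_
      rintro r ⟨w1, _, w2, _, w3, _, rfl⟩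
      positivity
    · exact fun j => key _ (m1 j) _ (Or.inl (m1 j)) _ (Or.inl (Or.inl (m1 j)))
    · exact fun j k h => key _ (m1 j) _ (Or.inl (m1 j)) _ (Or.inl (Or.inr (m2 j k h)))
    · exact fun j k h => key _ (m1 j) _ (Or.inr (m2 j k h)) _ (Or.inl (Or.inl (m1 j)))
    · exact fun j k h => key _ (m1 j) _ (Or.inr (m2 j k h)) _ (Or.inl (Or.inr (m2 j k h)))
    · exact fun j k l h h' => key _ (m1 j) _ (Or.inr (m2 j k h)) _ (Or.inr (m3 j k l h h'))
  refine GaussPoly.core (by omega) hκ hv _ ?_ hM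
  by_cases h : ∀ j, x ⬝ᵥ v j ≤ b j + κ
  · right
    have : ∀ j, x ⬝ᵥ v j ≤ b j + -κ := by
      by_contra hc
      exact hx ⟨h, hc⟩
    intro j
    have := this j
    linarith
  · left
    push Not at h
    obtain ⟨l, hl⟩ := h
    exact ⟨l, by linarith⟩
end
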